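/- Let f₁ : ℝ → ℝ be a continuously differentiable function such that for some constant C > 0 one has |x·f₁'(x)| ≤ C for all x. Let f₂(x) = α₁x + α₂x² + ⋯ + α_k x^k be a polynomial with at least one irrational coefficient. Put f = f₁ + f₂. Then the sequence (f(p_n))_{n∈ℕ} is uniformly distributed mod 1, where p_n is the n-th prime. -/

import Mathlib

open Filter Topology MeasureTheory
open scoped Pointwise

noncomputable section

/-- The germ of a real function at `+∞`. -/
def germAtTop (f : ℝ → ℝ) : Filter.Germ (Filter.atTop : Filter ℝ) ℝ := ↑f

/-- A Hardy field: a subring of the ring of germs at `+∞` of real-valued functions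
which is a field and is closed under differentiation. -/
def IsHardyField (H : Subring (Filter.Germ (Filter.atTop : Filter ℝ) ℝ)) : Prop :=
  (∀ g ∈ H, g ≠ 0 → ∃ h ∈ H, g * h = 1) ∧
  (∀ g ∈ H, ∃ f : ℝ → ℝ, germAtTop f = g ∧
    (∀ᶠ x in Filter.atTop, DifferentiableAt ℝ f x) ∧ germAtTop (deriv f) ∈ H)

/-- A function is subpolynomial if it is eventually dominated by some power `x ^ n`. -/
def Subpolynomial (f : ℝ → ℝ) : Prop := ∃ n : ℕ, ∀ᶠ x in Filter.atTop, |f x| < x ^ n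

open scoped Classical in
/-- A sequence of reals is uniformly distributed mod 1. -/
def UDMod1 (a : ℕ → ℝ) : Prop :=
  ∀ α β : ℝ, 0 ≤ α → α ≤ β → β ≤ 1 →
    Filter.Tendsto
      (fun N : ℕ =>
        (((Finset.range N).filter fun n => Int.fract (a n) ∈ Set.Icc α β).card : ℝ) / N)
      Filter.atTop (nhds (β - α))

open scoped Classical in
/-- A sequence of points of the `d`-torus is uniformly distributed mod 1. -/
def UDMod1Vec {d : ℕ} (a : ℕ → Fin d → ℝ) : Prop :=
  ∀ α β : Fin d → ℝ, (∀ i, 0 ≤ α i) → (∀ i, α i ≤ β i) → (∀ i, β i ≤ 1) →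
    Filter.Tendsto
      (fun N : ℕ =>
        (((Finset.range N).filter fun n =>
            ∀ i, Int.fract (a n i) ∈ Set.Icc (α i) (β i)).card : ℝ) / N)
      Filter.atTop (nhds (∏ i, (β i - α i)))

/-- The `n`-th prime (indexed from `0`, so `nthPrime 0 = 2`). -/
def nthPrime (n : ℕ) : ℕ := Nat.nth Nat.Prime n

/-- `e x = exp (2 π i x)`. -/
def e (x : ℝ) : ℂ := Complex.exp (2 * Real.pi * Complex.I * x)

/-- `f` is of type `x^{l+}`: `x^l / f x → 0` and `f x / x^(l+1) → 0` as `x → ∞`. -/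
def TypeXPow (f : ℝ → ℝ) (l : ℕ) : Prop :=
  Filter.Tendsto (fun x : ℝ => x ^ l / f x) Filter.atTop (nhds 0) ∧
  Filter.Tendsto (fun x : ℝ => f x / x ^ (l + 1)) Filter.atTop (nhds 0)

/-- Membership in the class `𝐇` attached to a Hardy field `H`: a subpolynomial member of `H`
which either is of type `x^{l+}` for some `l ≥ 1`, or satisfies
`ξ x / x → 0` and `log x / ξ x → 0`. -/
def MemBoldH (H : Subring (Filter.Germ (Filter.atTop : Filter ℝ) ℝ)) (ξ : ℝ → ℝ) : Prop :=
  germAtTop ξ ∈ H ∧ Subpolynomial ξ ∧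
  ((∃ l : ℕ, 1 ≤ l ∧
      Filter.Tendsto (fun x : ℝ => ξ x / x ^ (l + 1)) Filter.atTop (nhds 0) ∧
      Filter.Tendsto (fun x : ℝ => x ^ l / ξ x) Filter.atTop (nhds 0)) ∨
    (Filter.Tendsto (fun x : ℝ => ξ x / x) Filter.atTop (nhds 0) ∧
      Filter.Tendsto (fun x : ℝ => Real.log x / ξ x) Filter.atTop (nhds 0)))

/-- The upper Banach density of a subset of `ℤ^m`. -/
def upperBanachDensity {m : ℕ} (E : Set (Fin m → ℤ)) : ℝ :=
  sSup { d : ℝ | ∃ a b : ℕ → Fin m → ℤ,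
    (∀ i, Filter.Tendsto (fun n => b n i - a n i) Filter.atTop Filter.atTop) ∧
    d = Filter.limsup (fun n : ℕ =>
        (Nat.card ↥(E ∩ Set.pi Set.univ fun i => Set.Icc (a n i) (b n i)) : ℝ) /
        (Nat.card ↥(Set.pi Set.univ fun i : Fin m => Set.Icc (a n i) (b n i)) : ℝ))
      Filter.atTop }

/-- The Fourier transform of a measure on the `m`-torus, evaluated at `d ∈ ℤ^m`. -/
def measureFourier {m : ℕ} (σ : Measure (Fin m → AddCircle (1 : ℝ))) (d : Fin m → ℤ) : ℂ :=
  ∫ γ, (∏ i, fourier (d i) (γ i)) ∂σ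

/-- The filter `|d| → ∞, d ∈ D` on `ℤ^m`, where `|d| = max |d_i|`. -/
def alongD {m : ℕ} (D : Set (Fin m → ℤ)) : Filter (Fin m → ℤ) :=
  (Filter.atTop.comap fun d : Fin m → ℤ => Finset.univ.sup fun i => (d i).natAbs) ⊓
    Filter.principal D

/-- A nice `FC⁺` set in `ℤ^m`. -/
def IsNiceFCPlus {m : ℕ} (D : Set (Fin m → ℤ)) : Prop :=
  D.Infinite ∧
  ∀ σ : Measure (Fin m → AddCircle (1 : ℝ)), IsFiniteMeasure σ →
    (σ {0}).toReal ≤ Filter.limsup (fun d => ‖measureFourier σ d‖) (alongD D)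



namespace UDP

/-- `x` is within `ε` of an integer. -/
def Near (x ε : ℝ) : Prop := ∃ a : ℤ, |x - a| ≤ ε

lemma Near.mono {x ε ε' : ℝ} (h : Near x ε) (hε : ε ≤ ε') : Near x ε' := by
  obtain ⟨a, ha⟩ := h
  exact ⟨a, ha.trans hε⟩

lemma Near.natMul {x ε : ℝ} (h : Near x ε) (n : ℕ) : Near (n * x) (n * ε) := by
  obtain ⟨a, ha⟩ := h
  refine ⟨n * a, ?_⟩
  push_cast
  rw [← mul_sub, abs_mul, Nat.abs_cast]
  exact mul_le_mul_of_nonneg_left ha (Nat.cast_nonneg n)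

lemma Near.sub {x y ε ε' : ℝ} (h : Near x ε) (h' : Near y ε') : Near (x - y) (ε + ε') := by
  obtain ⟨a, ha⟩ := h
  obtain ⟨b, hb⟩ := h'
  refine ⟨a - b, ?_⟩
  push_cast
  calc |x - y - (a - b)| = |(x - a) - (y - b)| := by ring_nf
    _ ≤ _ := (abs_sub _ _).trans (add_le_add ha hb)

/-- Counting via bins of length `g`. -/
lemma card_le_bins (S : Finset ℤ) (c : ℤ) (W g : ℕ) (hg : 0 < g)
    (hS : S ⊆ Finset.Ico c (c + W)) (t : ℝ)
    (hbin : ∀ T ⊆ S, (∀ h ∈ T, ∀ h' ∈ T, h' - h < g) → (T.card : ℝ) ≤ t) :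
    (S.card : ℝ) ≤ ((W : ℝ) / g + 1) * t := by
  have hg' : (0:ℤ) < g := by exact_mod_cast hg
  have ht : 0 ≤ t := by
    have := hbin ∅ (by simp) (by simp)
    simpa using this
  have hmaps : ∀ h ∈ S, ((h - c) / g) ∈ Finset.Ico (0:ℤ) (W / g + 1 : ℕ) := by
    intro h hh
    have := Finset.mem_Ico.1 (hS hh)
    rw [Finset.mem_Ico]
    constructor
    · apply Int.ediv_nonneg <;> omega
    · push_cast
      have : (h - c) / g ≤ (W:ℤ) / g := Int.ediv_le_ediv hg' (by omega)
      omega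
  have h1 := Finset.card_eq_sum_card_fiberwise (f := fun h : ℤ => (h - c) / (g:ℤ)) (s := S)
    (t := Finset.Ico (0:ℤ) (W / g + 1 : ℕ)) (by intro h hh; exact hmaps h hh)
  have h2 : (S.card : ℝ) = ∑ b ∈ Finset.Ico (0:ℤ) (W / g + 1 : ℕ),
      (((S.filter fun h => (h - c) / (g:ℤ) = b).card : ℕ) : ℝ) := by
    rw [h1]; push_cast; rfl
  rw [h2]
  calc _ ≤ ∑ b ∈ Finset.Ico (0:ℤ) (W / g + 1 : ℕ), t := by
        apply Finset.sum_le_sum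
        intro b _
        apply hbin _ (Finset.filter_subset _ _)
        intro h hh h' hh'
        have e1 := (Finset.mem_filter.1 hh).2
        have e2 := (Finset.mem_filter.1 hh').2
        have a1 := Int.emod_add_mul_ediv (h - c) g
        have a2 := Int.emod_add_mul_ediv (h' - c) g
        have b1 := Int.emod_nonneg (h - c) hg'.ne'
        have b2 := Int.emod_lt_of_pos (h' - c) hg'
        rw [e1] at a1
        rw [e2] at a2
        omega
    _ = ((W / g + 1 : ℕ) : ℝ) * t := by
        rw [Finset.sum_const, Int.card_Ico, nsmul_eq_mul]
        congr 2
    _ ≤ _ := by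
        apply mul_le_mul_of_nonneg_right _ ht
        push_cast
        have := Nat.cast_div_le (α := ℝ) (m := W) (n := g)
        linarith

/-- Linear recurrence lemma. -/
lemma lin (θ : ℝ) (S : Finset ℤ) (c : ℤ) (W : ℕ) (δ ε : ℝ) (hδ : 0 < δ)
    (hS : S ⊆ Finset.Ico c (c + W)) (hcard : δ * W ≤ S.card)
    (hε0 : 0 ≤ ε) (hε : 32 * ε ≤ δ) (hW : 4 ≤ δ * W)
    (hn : ∀ h ∈ S, Near (h * θ) ε) :
    ∃ q : ℕ, 0 < q ∧ (q : ℝ) ≤ 2 / δ ∧ Near (q * θ) (8 * ε / (δ * W)) := by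
  classical
  have hSW : S.card ≤ W := by
    have := Finset.card_le_card hS
    simpa using this
  have hWpos : (0:ℝ) < W := by
    by_contra h
    have : (W:ℝ) = 0 := le_antisymm (not_lt.1 h) (Nat.cast_nonneg _)
    rw [this] at hW; norm_num at hW
  have hδ1 : δ ≤ 1 := by
    have : δ * W ≤ 1 * W := by
      rw [one_mul]; exact hcard.trans (by exact_mod_cast hSW)
    exact le_of_mul_le_mul_right this hWpos
  -- pigeonhole
  have hpig : ∃ q : ℕ, 0 < q ∧ (q : ℝ) ≤ 2 / δ ∧ Near (q * θ) (2 * ε) := by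
    by_contra hcon
    push Not at hcon
    set g := ⌈2 / δ⌉₊ with hgdef
    have hg : 0 < g := Nat.ceil_pos.2 (by positivity)
    have key := card_le_bins S c W g hg hS 1 (by
      intro T hT hTd
      have : T.card ≤ 1 := by
        rw [Finset.card_le_one]
        by_contra hne
        push Not at hne
        obtain ⟨a, ha, b, hb, hab⟩ := hne
        wlog hlt : a < b generalizing a b
        · exact this b hb a ha hab.symm (lt_of_le_of_ne (not_lt.1 hlt) hab.symm)
        have h1 := hTd a ha b hb
        have hq : ((b - a).toNat : ℤ) = b - a := Int.toNat_of_nonneg (by omega)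
        have hqr : (((b - a).toNat : ℕ) : ℝ) = (b:ℝ) - a := by
          have : (((b - a).toNat : ℤ) : ℝ) = ((b - a : ℤ) : ℝ) := by rw [hq]
          push_cast at this
          simpa using this
        apply hcon (b - a).toNat (by omega)
        · have : (b - a).toNat < g := by omega
          exact (Nat.lt_ceil.1 this).le
        · rw [hqr, sub_mul]
          have := (hn b (hT hb)).sub (hn a (hT ha))
          exact this.mono (by linarith)
      exact_mod_cast this)
    have hg2 : 2 / δ ≤ g := Nat.le_ceil _
    have : (W:ℝ) / g ≤ W / (2 / δ) := by
      apply div_le_div_of_nonneg_left hWpos.le (by positivity) hg2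
    have e1 : (W:ℝ) / (2 / δ) = δ * W / 2 := by field_simp
    nlinarith
  -- minimal q
  let q := Nat.find hpig
  obtain ⟨hq0, hqδ, hqN⟩ : 0 < q ∧ (q : ℝ) ≤ 2 / δ ∧ Near (q * θ) (2 * ε) := Nat.find_spec hpig
  have hmin : ∀ m : ℕ, m < q → ¬ (0 < m ∧ (m : ℝ) ≤ 2 / δ ∧ Near (m * θ) (2 * ε)) :=
    fun m hm => Nat.find_min hpig hm
  obtain ⟨a, ha⟩ := hqN
  have hq0' : (0:ℝ) < q := by exact_mod_cast hq0
  have hqδ' : q * δ ≤ 2 := by rwa [le_div_iff₀ hδ] at hqδ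
  set ξ := q * θ - a with hξ
  have hcop : IsCoprime (a : ℤ) q := by
    rw [Int.isCoprime_iff_gcd_eq_one]
    by_contra hne
    set G := Int.gcd a q with hG
    have hGpos : 0 < G := Int.gcd_pos_of_ne_zero_right _ (by exact_mod_cast hq0.ne')
    have hG2 : 1 < G := by omega
    obtain ⟨a', ha'⟩ : (G:ℤ) ∣ a := Int.gcd_dvd_left ..
    obtain ⟨q', hq'⟩ : G ∣ q := by
      have : (G:ℤ) ∣ q := Int.gcd_dvd_right ..
      exact_mod_cast this
    have hq'pos : 0 < q' := by
      rcases Nat.eq_zero_or_pos q' with h | h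
      · subst h; simp at hq'; omega
      · exact h
    have hlt : q' < q := by rw [hq']; nlinarith
    apply hmin q' hlt
    refine ⟨hq'pos, ?_, a', ?_⟩
    · refine le_trans ?_ hqδ
      exact_mod_cast hlt.le
    · have hGr : (1:ℝ) ≤ G := by exact_mod_cast hG2.le
      have : ξ = G * (q' * θ - a') := by
        rw [hξ, hq', ha']; push_cast; ring
      rw [this, abs_mul, abs_of_nonneg (by linarith)] at ha
      have h0 := abs_nonneg (q' * θ - a')
      nlinarith
  rcases eq_or_ne ξ 0 with hξ0 | hξ0
  · refine ⟨q, hq0, hqδ, a, ?_⟩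
    rw [← hξ, hξ0, abs_zero]; positivity
  set γ := |ξ| with hγ
  have hγpos : 0 < γ := abs_pos.2 hξ0
  have h16 : γ ≤ 1 / 16 := by linarith
  set w := ⌊1 / (2 * γ)⌋₊ with hw
  have hw1 : (w:ℝ) * (2 * γ) ≤ 1 := by
    have := Nat.floor_le (a := 1 / (2 * γ)) (by positivity)
    rwa [← hw, le_div_iff₀ (by positivity)] at this
  have hwbig : 1 ≤ (w:ℝ) * (4 * γ) := by
    have := Nat.lt_floor_add_one (1 / (2 * γ))
    rw [← hw, div_lt_iff₀ (by positivity)] at this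
    nlinarith
  have hwpos : 0 < w := by
    rcases Nat.eq_zero_or_pos w with h | h
    · rw [h] at hwbig; norm_num at hwbig
    · exact h
  have key := card_le_bins S c W w hwpos hS (2 * ε / γ + 1) (by
    intro T hT hTd
    rcases T.eq_empty_or_nonempty with h | hne
    · rw [h]; simp; positivity
    set m0 := T.min' hne with hm0
    have hm0T : m0 ∈ T := Finset.min'_mem _ _
    -- each element is m0 + q t with 0 ≤ t ≤ 2ε/γ
    have hstr : ∀ h ∈ T, ∃ t : ℕ, t ≤ ⌊2 * ε / γ⌋₊ ∧ h = m0 + q * t := by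
      intro h hh
      have hle : m0 ≤ h := Finset.min'_le _ _ hh
      have hlt := hTd m0 hm0T h hh
      obtain ⟨m, hm⟩ := Int.eq_ofNat_of_zero_le (sub_nonneg.2 hle)
      have hmw : m < w := by omega
      have hmw' : (m:ℝ) < w := by exact_mod_cast hmw
      have hmr : (h:ℝ) - m0 = m := by
        have : ((h - m0 : ℤ) : ℝ) = ((m:ℤ) : ℝ) := by rw [hm]
        push_cast at this; exact this
      obtain ⟨b, hb⟩ : Near (m * θ) (2 * ε) := by
        have := (hn h (hT hh)).sub (hn m0 (hT hm0T))
        rw [← sub_mul, hmr] at this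
        exact this.mono (by linarith)
      have hmγ : (m:ℝ) * γ ≤ 1 / 2 := by nlinarith
      have hεq : 2 * ε * q ≤ 1 / 8 := by nlinarith
      have hdvd : (q:ℤ) ∣ m := by
        by_contra hnd
        have hnd' : (m * a - b * q : ℤ) ≠ 0 := by
          intro h0
          apply hnd
          have : (q:ℤ) ∣ m * a := ⟨b, by linarith⟩
          exact (hcop.symm).dvd_of_dvd_mul_right this
        have h1 : (1:ℝ) ≤ |((m * a - b * q : ℤ) : ℝ)| := by
          rw [← Int.cast_abs]; exact_mod_cast Int.one_le_abs hnd'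
        have h2 : ((m * a - b * q : ℤ) : ℝ) = q * (m * θ - b) - m * ξ := by
          push_cast; rw [hξ]; ring
        have h3 : |q * (m * θ - b) - m * ξ| ≤ q * (2 * ε) + m * γ := by
          refine (abs_sub _ _).trans ?_
          rw [abs_mul, abs_mul, Nat.abs_cast, Nat.abs_cast]
          gcongr
        rw [h2] at h1
        linarith
      obtain ⟨t, ht⟩ := hdvd
      have ht0 : 0 ≤ t := by
        by_contra hneg
        push Not at hneg
        have : (q:ℤ) * t < 0 := mul_neg_of_pos_of_neg (by exact_mod_cast hq0) hneg
        omega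
      obtain ⟨t, rfl⟩ := Int.eq_ofNat_of_zero_le ht0
      have hmqt : (m:ℝ) = q * t := by exact_mod_cast ht
      have htm : (t:ℝ) ≤ m := by
        have : (1:ℝ) ≤ q := by exact_mod_cast hq0
        have ht' : (0:ℝ) ≤ t := Nat.cast_nonneg _
        rw [hmqt]; nlinarith
      have htγ : (t:ℝ) * γ ≤ 1 / 2 := by nlinarith
      have hsplit : m * θ - b = ((t * a - b : ℤ) : ℝ) + t * ξ := by
        push_cast; rw [hmqt, hξ]; ring
      have hzero : (t * a - b : ℤ) = 0 := by
        by_contra hnz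
        have h1 : (1:ℝ) ≤ |((t * a - b : ℤ) : ℝ)| := by
          rw [← Int.cast_abs]; exact_mod_cast Int.one_le_abs hnz
        have h2 : |((t * a - b : ℤ) : ℝ)| ≤ 2 * ε + t * γ := by
          have : ((t * a - b : ℤ) : ℝ) = (m * θ - b) - t * ξ := by linarith
          rw [this]
          refine (abs_sub _ _).trans ?_
          rw [abs_mul (t:ℝ) ξ, Nat.abs_cast]
          gcongr
        linarith
      refine ⟨t, ?_, ?_⟩
      · apply Nat.le_floor
        rw [le_div_iff₀ hγpos]
        rw [hsplit, hzero, Int.cast_zero, zero_add, abs_mul, Nat.abs_cast] at hb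
        exact hb
      · have : h - m0 = q * t := by rw [hm]; exact ht
        linarith
    have hsub : T ⊆ (Finset.range (⌊2 * ε / γ⌋₊ + 1)).image (fun t : ℕ => m0 + q * t) := by
      intro h hh
      obtain ⟨t, ht, rfl⟩ := hstr h hh
      exact Finset.mem_image.2 ⟨t, Finset.mem_range.2 (by omega), rfl⟩
    have h1 := (Finset.card_le_card hsub).trans Finset.card_image_le
    rw [Finset.card_range] at h1
    have h2 := Nat.floor_le (a := 2 * ε / γ) (by positivity)
    have h3 : (T.card : ℝ) ≤ (⌊2 * ε / γ⌋₊ : ℝ) + 1 := by exact_mod_cast h1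
    linarith)
  refine ⟨q, hq0, hqδ, a, ?_⟩
  change γ ≤ _
  rw [le_div_iff₀ (by positivity)]
  have hwr : (0:ℝ) < w := by exact_mod_cast hwpos
  have hWw : (W:ℝ) / w ≤ 4 * γ * W := by
    rw [div_le_iff₀ hwr]; nlinarith
  have hmain : δ * W ≤ (4 * γ * W + 1) * (2 * ε / γ + 1) := by
    refine (hcard.trans key).trans ?_
    gcongr
  have hexp : (4 * γ * W + 1) * (2 * ε / γ + 1) = 8 * ε * W + 4 * γ * W + 2 * ε / γ + 1 := by
    field_simp; ring
  rw [hexp] at hmain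
  have hγW : γ * W ≤ 2 * ε * W := by gcongr
  have hεW : 32 * ε * W ≤ δ * W := by gcongr
  have h5 : δ * W / 4 ≤ 2 * ε / γ := by linarith
  rw [le_div_iff₀ hγpos] at h5
  linarith

/-- Recurrence with varying multiplier `q_h ≤ K`. -/
lemma recur (θ : ℝ) (S : Finset ℤ) (c : ℤ) (W : ℕ) (δ ε K : ℝ) (hδ : 0 < δ) (hK : 1 ≤ K)
    (hS : S ⊆ Finset.Ico c (c + W)) (hcard : δ * W ≤ S.card)
    (hε0 : 0 ≤ ε) (hε : 32 * ε * K ≤ δ) (hW : 4 * K ≤ δ * W)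
    (hn : ∀ h ∈ S, ∃ q : ℕ, 0 < q ∧ (q : ℝ) ≤ K ∧ Near (q * (h * θ)) ε) :
    ∃ q : ℕ, 0 < q ∧ (q : ℝ) ≤ 2 * K ^ 2 / δ ∧ Near (q * θ) (8 * K * ε / (δ * W)) := by
  classical
  have hK0 : 0 < K := by linarith
  choose! Q hQ0 hQK hQN using hn
  have hmaps : ∀ h ∈ S, Q h ∈ Finset.Icc 1 ⌊K⌋₊ := by
    intro h hh
    exact Finset.mem_Icc.2 ⟨hQ0 h hh, Nat.le_floor (hQK h hh)⟩
  have hcardsum : (S.card : ℝ) = ∑ b ∈ Finset.Icc 1 ⌊K⌋₊, ((S.filter fun h => Q h = b).card : ℝ) := by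
    exact_mod_cast Finset.card_eq_sum_card_fiberwise hmaps
  have hex : ∃ b ∈ Finset.Icc 1 ⌊K⌋₊, δ / K * W ≤ ((S.filter fun h => Q h = b).card : ℝ) := by
    by_contra hcon
    push Not at hcon
    have hne : (Finset.Icc 1 ⌊K⌋₊).Nonempty := ⟨1, Finset.mem_Icc.2 ⟨le_rfl, Nat.le_floor (by simpa using hK)⟩⟩
    have h1 := Finset.sum_lt_sum_of_nonempty hne hcon
    rw [← hcardsum, Finset.sum_const, Nat.card_Icc, nsmul_eq_mul] at h1
    have h2 : ((⌊K⌋₊ + 1 - 1 : ℕ) : ℝ) ≤ K := by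
      simpa using Nat.floor_le hK0.le
    have h3 : ((⌊K⌋₊ + 1 - 1 : ℕ) : ℝ) * (δ / K * W) ≤ K * (δ / K * W) := by gcongr
    have h4 : K * (δ / K * W) = δ * W := by field_simp
    linarith
  obtain ⟨b, hb, hbc⟩ := hex
  obtain ⟨hb1, hbK⟩ := Finset.mem_Icc.1 hb
  have hbK' : (b:ℝ) ≤ K := (Nat.le_floor_iff hK0.le).1 hbK
  obtain ⟨q, hq0, hqδ, hqN⟩ := lin (b * θ) (S.filter fun h => Q h = b) c W (δ / K) ε (by positivity)
    ((Finset.filter_subset _ _).trans hS) hbc hε0 (by rw [le_div_iff₀ hK0]; linarith)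
    (by rw [div_mul_eq_mul_div, le_div_iff₀ hK0]; linarith) (by
      intro h hh
      obtain ⟨hh1, hh2⟩ := Finset.mem_filter.1 hh
      have := hQN h hh1
      rw [hh2] at this
      convert this using 1; ring)
  refine ⟨q * b, by positivity, ?_, ?_⟩
  · push_cast
    have e1 : 2 * K ^ 2 / δ = 2 / (δ / K) * K := by field_simp
    rw [e1]; gcongr
  · push_cast
    rw [mul_assoc]
    convert hqN using 1
    field_simp
end UDP

namespace UDP

lemma e_add (x y : ℝ) : e (x + y) = e x * e y := by
  unfold e
  rw [← Complex.exp_add]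
  congr 1
  push_cast
  ring

lemma e_zero : e 0 = 1 := by simp [e]

lemma e_int (n : ℤ) : e (n : ℝ) = 1 := by
  unfold e
  rw [Complex.exp_eq_one_iff]
  exact ⟨n, by push_cast; ring⟩

lemma e_eq (x : ℝ) : e x = Complex.exp (Complex.I * ((2 * Real.pi * x : ℝ) : ℂ)) := by
  unfold e
  congr 1
  push_cast
  ring

lemma norm_e (x : ℝ) : ‖e x‖ = 1 := by
  rw [e_eq, mul_comm, Complex.norm_exp_ofReal_mul_I]

lemma conj_e (x : ℝ) : (starRingEnd ℂ) (e x) = e (-x) := by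
  unfold e
  rw [← Complex.exp_conj]
  congr 1
  simp only [map_mul, Complex.conj_ofReal, Complex.conj_I, map_ofNat]
  push_cast
  ring

lemma e_mul_conj (x y : ℝ) : e x * (starRingEnd ℂ) (e y) = e (x - y) := by
  rw [conj_e, ← e_add, sub_eq_add_neg]

lemma e_add_int (x : ℝ) (n : ℤ) : e (x + n) = e x := by
  rw [e_add, e_int, mul_one]

lemma e_sub_int (x : ℝ) (n : ℤ) : e (x - n) = e x := by
  have := e_add_int x (-n)
  push_cast at this
  rwa [← sub_eq_add_neg] at this

lemma norm_e_sub_one_le (x : ℝ) : ‖e x - 1‖ ≤ 2 * Real.pi * |x| := by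
  rw [e_eq]
  have := Real.norm_exp_I_mul_ofReal_sub_one_le (x := 2 * Real.pi * x)
  refine this.trans ?_
  rw [Real.norm_eq_abs, abs_mul, abs_of_pos (by positivity)]

lemma norm_e_sub_le (x y : ℝ) : ‖e x - e y‖ ≤ 2 * Real.pi * |x - y| := by
  have : e x - e y = e y * (e (x - y) - 1) := by
    rw [mul_sub, ← e_add]; ring_nf
  rw [this, norm_mul, norm_e, one_mul]
  exact norm_e_sub_one_le _

lemma four_le_norm_e_sub_one (θ : ℝ) : 4 * |θ - round θ| ≤ ‖e θ - 1‖ := by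
  have h1 : e θ = e (θ - round θ) := (e_sub_int θ _).symm
  rw [h1, e_eq, Complex.norm_exp_I_mul_ofReal_sub_one]
  set t := θ - round θ with ht
  have h2 : |t| ≤ 1 / 2 := abs_sub_round θ
  have h3 : 2 * Real.pi * t / 2 = Real.pi * t := by ring
  rw [h3, Real.norm_eq_abs, abs_mul]
  have h4 : |Real.pi * t| ≤ Real.pi / 2 := by
    rw [abs_mul, abs_of_pos Real.pi_pos]
    nlinarith [Real.pi_pos]
  have h5 := Real.mul_abs_le_abs_sin h4
  rw [abs_mul, abs_of_pos Real.pi_pos] at h5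
  have : 2 / Real.pi * (Real.pi * |t|) = 2 * |t| := by
    field_simp
  rw [this] at h5
  simp only [abs_two]
  linarith

/-- Real sequences on the integers of polynomial type with degree `j` and leading coefficient `θ`. -/
def IsPoly : ℕ → ℝ → (ℤ → ℝ) → Prop
  | 0, θ, g => ∀ n, g n = θ
  | (j + 1), θ, g => ∀ h : ℤ, IsPoly j (((j : ℝ) + 1) * h * θ) (fun n => g (n + h) - g n)

lemma IsPoly.congr {j : ℕ} {θ θ' : ℝ} {g g' : ℤ → ℝ} (h : IsPoly j θ g) (hθ : θ = θ')
    (hg : ∀ n, g n = g' n) : IsPoly j θ' g' := by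
  have : g = g' := funext hg
  subst this; subst hθ; exact h

lemma IsPoly.add {j : ℕ} : ∀ {θ θ' : ℝ} {g g' : ℤ → ℝ}, IsPoly j θ g → IsPoly j θ' g' →
    IsPoly j (θ + θ') (fun n => g n + g' n) := by
  induction j with
  | zero => intro θ θ' g g' h h' n; simp only; rw [h n, h' n]
  | succ j ih =>
    intro θ θ' g g' h h' k
    exact (ih (h k) (h' k)).congr (by ring) (fun n => by ring)

lemma IsPoly.smul {j : ℕ} (c : ℝ) : ∀ {θ : ℝ} {g : ℤ → ℝ}, IsPoly j θ g →
    IsPoly j (c * θ) (fun n => c * g n) := by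
  induction j with
  | zero => intro θ g h n; simp only; rw [h n]
  | succ j ih =>
    intro θ g h k
    exact (ih (h k)).congr (by ring) (fun n => by ring)

lemma IsPoly.raise {j : ℕ} : ∀ {θ : ℝ} {g : ℤ → ℝ}, IsPoly j θ g → IsPoly (j + 1) 0 g := by
  induction j with
  | zero => intro θ g h k n; simp only; rw [h n, h (n + k)]; simp
  | succ j ih =>
    intro θ g h k
    exact (ih (h k)).congr (by ring) (fun n => rfl)

lemma IsPoly.comp {j : ℕ} (d r : ℤ) : ∀ {θ : ℝ} {g : ℤ → ℝ}, IsPoly j θ g →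
    IsPoly j ((d : ℝ) ^ j * θ) (fun n => g (d * n + r)) := by
  induction j with
  | zero => intro θ g h n; simp only; rw [h]; simp
  | succ j ih =>
    intro θ g h k
    exact (ih (h (d * k))).congr (by push_cast; ring) (fun n => by
      have : d * (n + k) + r = d * n + r + d * k := by ring
      simp only [this])

lemma IsPoly.mulId {j : ℕ} : ∀ {θ : ℝ} {g : ℤ → ℝ}, IsPoly j θ g →
    IsPoly (j + 1) θ (fun n => n * g n) := by
  induction j with
  | zero => intro θ g h k n; simp only; rw [h n, h (n + k)]; push_cast; ring
  | succ j ih =>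
    intro θ g h k
    have h2 := ((h.comp 1 k).smul (k : ℝ))
    exact ((ih (h k)).add h2).congr (by push_cast; ring) (fun n => by
      simp only [one_mul]; push_cast; ring)

lemma isPoly_pow (j : ℕ) : IsPoly j 1 (fun n => (n : ℝ) ^ j) := by
  induction j with
  | zero => intro n; simp
  | succ j ih => exact ih.mulId.congr rfl (fun n => by ring)

lemma isPoly_mono (j : ℕ) (θ : ℝ) : IsPoly j θ (fun n => θ * (n : ℝ) ^ j) :=
  ((isPoly_pow j).smul θ).congr (by ring) (fun _ => rfl)

lemma isPoly_sum (j : ℕ) (α : ℕ → ℝ) :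
    IsPoly j (α j) (fun n => ∑ i ∈ Finset.range (j + 1), α i * (n : ℝ) ^ i) := by
  induction j with
  | zero => intro n; simp
  | succ j ih =>
    refine (ih.raise.add (isPoly_mono (j + 1) (α (j + 1)))).congr (by ring) (fun n => ?_)
    rw [Finset.sum_range_succ _ (j + 1)]

/-- Telescoping sums over integer intervals. -/
lemma sum_Ioc_telescope (F : ℤ → ℂ) (x y : ℤ) (hxy : x ≤ y) :
    ∑ a ∈ Finset.Ioc x y, (F (a + 1) - F a) = F (y + 1) - F (x + 1) := by
  induction y, hxy using Int.leInduction with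
  | base => simp
  | succ n hn ih =>
    have : Finset.Ioc x (n + 1) = insert (n + 1) (Finset.Ioc x n) := by
      ext a; simp only [Finset.mem_Ioc, Finset.mem_insert]; omega
    rw [this, Finset.sum_insert (by simp), ih]
    ring

lemma geom_bound {θ : ℝ} {g : ℤ → ℝ} (hg : IsPoly 1 θ g) (x y : ℤ) :
    ‖∑ a ∈ Finset.Ioc x y, e (g a)‖ * (4 * |θ - round θ|) ≤ 2 := by
  rcases le_or_gt x y with hxy | hxy
  swap
  · rw [Finset.Ioc_eq_empty (by omega)]; simp
  refine (mul_le_mul_of_nonneg_left (four_le_norm_e_sub_one θ) (norm_nonneg _)).trans ?_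
  rw [← norm_mul, Finset.sum_mul]
  have : ∀ a ∈ Finset.Ioc x y, e (g a) * (e θ - 1) = e (g (a + 1)) - e (g a) := by
    intro a _
    have := hg 1 a
    simp only [Nat.cast_zero] at this
    have h2 : g (a + 1) = g a + θ := by
      push_cast at this; linarith
    rw [h2, e_add]; ring
  rw [Finset.sum_congr rfl this, sum_Ioc_telescope (fun a => e (g a)) x y hxy]
  refine (norm_sub_le _ _).trans ?_
  rw [norm_e, norm_e]; norm_num

/-- Van der Corput expansion. -/
lemma vdc (φ : ℤ → ℂ) (c c' : ℤ) (W : ℕ) (hW : c' - c ≤ W) :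
    ((‖∑ b ∈ Finset.Ioc c c', φ b‖ ^ 2 : ℝ) : ℂ) =
      ∑ h ∈ Finset.Ioo (-(W : ℤ)) W, ∑ b ∈ (Finset.Ioc c c').filter (fun b => b + h ∈ Finset.Ioc c c'),
        φ (b + h) * (starRingEnd ℂ) (φ b) := by
  have h1 : ((‖∑ b ∈ Finset.Ioc c c', φ b‖ ^ 2 : ℝ) : ℂ) =
      ∑ b ∈ Finset.Ioc c c', ∑ b' ∈ Finset.Ioc c c', φ b' * (starRingEnd ℂ) (φ b) := by
    rw [← Complex.normSq_eq_norm_sq, ← Complex.mul_conj, map_sum, Finset.sum_mul_sum,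
      Finset.sum_comm]
  have h2 : ∑ h ∈ Finset.Ioo (-(W : ℤ)) W,
      ∑ b ∈ (Finset.Ioc c c').filter (fun b => b + h ∈ Finset.Ioc c c'),
        φ (b + h) * (starRingEnd ℂ) (φ b) = ∑ b ∈ Finset.Ioc c c', ∑ h ∈ Finset.Ioo (-(W : ℤ)) W,
        if b + h ∈ Finset.Ioc c c' then φ (b + h) * (starRingEnd ℂ) (φ b) else 0 := by
    rw [Finset.sum_comm]
    apply Finset.sum_congr rfl
    intro h _
    rw [Finset.sum_filter]
  rw [h1, h2]
  apply Finset.sum_congr rfl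
  intro b hb
  rw [← Finset.sum_filter]
  symm
  rw [Finset.mem_Ioc] at hb
  refine Finset.sum_bij (fun h _ => b + h) ?_ ?_ ?_ ?_
  · intro h hh; exact (Finset.mem_filter.1 hh).2
  · intro a _ a' _ h; simpa using h
  · intro b' hb'
    refine ⟨b' - b, ?_, by ring⟩
    rw [Finset.mem_filter, Finset.mem_Ioo]
    have := Finset.mem_Ioc.1 hb'
    refine ⟨⟨by omega, by omega⟩, ?_⟩
    simpa using this
  · intro h _; rfl

lemma extract (θ : ℝ) (B : ℕ) (T : ℤ → ℝ) (M E K ε : ℝ) (hM : 0 < M) (hE : 1 ≤ E) (hK : 1 ≤ K)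
    (hε : 0 ≤ ε) (hT : ∀ h, T h ≤ M)
    (hsum : B * M / E ≤ ∑ h ∈ Finset.Ioo (-(B : ℤ)) B, T h)
    (hgood : ∀ h : ℤ, M / (4 * E) ≤ T h → ∃ q : ℕ, 0 < q ∧ (q : ℝ) ≤ K ∧ Near (q * (h * θ)) ε)
    (h1 : 128 * ε * K * E ≤ 1) (h2 : 8 * K * E ≤ B) :
    ∃ q : ℕ, 0 < q ∧ (q : ℝ) ≤ 8 * E * K ^ 2 ∧ Near (q * θ) (16 * E * K * ε / B) := by
  have hE0 : 0 < E := by linarith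
  set S := (Finset.Ioo (-(B : ℤ)) B).filter (fun h => M / (4 * E) ≤ T h) with hS
  have hBpos : (0 : ℝ) < B := lt_of_lt_of_le (by positivity) h2
  have hcard : 1 / (4 * E) * ((2 * B : ℕ) : ℝ) ≤ S.card := by
    have a1 : ∑ h ∈ Finset.Ioo (-(B : ℤ)) B, T h ≤
        ∑ h ∈ Finset.Ioo (-(B : ℤ)) B, ((if M / (4 * E) ≤ T h then M else 0) + M / (4 * E)) := by
      apply Finset.sum_le_sum
      intro h _
      have : 0 ≤ M / (4 * E) := by positivity
      split_ifs with hh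
      · linarith [hT h]
      · linarith
    rw [Finset.sum_add_distrib, ← Finset.sum_filter, Finset.sum_const, Finset.sum_const,
      nsmul_eq_mul, nsmul_eq_mul, ← hS] at a1
    have a2 : ((Finset.Ioo (-(B : ℤ)) B).card : ℝ) ≤ 2 * B := by
      rw [Int.card_Ioo]
      have : ((B:ℤ) - (-B) - 1).toNat ≤ 2 * B := by omega
      exact_mod_cast this
    have a3 : ((Finset.Ioo (-(B : ℤ)) B).card : ℝ) * (M / (4 * E)) ≤ 2 * B * (M / (4 * E)) :=
      mul_le_mul_of_nonneg_right a2 (by positivity)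
    have a4 : B * M / E - 2 * B * (M / (4 * E)) ≤ S.card * M := by linarith
    have a5 : B * M / E - 2 * B * (M / (4 * E)) = (1 / (4 * E) * ((2 * B : ℕ) : ℝ)) * M := by
      push_cast; field_simp; ring
    rw [a5] at a4
    exact le_of_mul_le_mul_right a4 hM
  obtain ⟨q, hq, hqle, hn⟩ := recur θ S (-(B : ℤ)) (2 * B) (1 / (4 * E)) ε K (by positivity) hK
    (by
      intro h hh
      have := Finset.mem_Ioo.1 (Finset.mem_filter.1 hh).1
      rw [Finset.mem_Ico]; push_cast; omega) hcard hε
    (by rw [le_div_iff₀ (by positivity)]; linarith)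
    (by push_cast
        rw [one_div, inv_mul_eq_div, le_div_iff₀ (by positivity)]; linarith)
    (by intro h hh; exact hgood h (Finset.mem_filter.1 hh).2)
  refine ⟨q, hq, hqle.trans (le_of_eq ?_), hn.mono (le_of_eq ?_)⟩
  · field_simp; ring
  · push_cast; field_simp; ring

lemma step (j C : ℕ) (D : ℝ) (hD : 2 ≤ D) (B : ℕ) (R M θ : ℝ) (T : ℤ → ℝ) (hM : 0 < M)
    (hT : ∀ h, T h ≤ M)
    (hsum : B * M / D ^ 2 ≤ ∑ h ∈ Finset.Ioo (-(B : ℤ)) B, T h)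
    (hR : D ^ (8 * C + 12 + j) ≤ R) (hB : D ^ (8 * C + 12 + j) ≤ B)
    (hgood : ∀ h : ℤ, M / (4 * D ^ 2) ≤ T h → ∃ q : ℕ, 0 < q ∧ (q : ℝ) ≤ (4 * D ^ 2) ^ C ∧
      Near (q * (((j : ℝ) + 1) * h * θ)) ((4 * D ^ 2) ^ C / R)) :
    ∃ q : ℕ, 0 < q ∧ (q : ℝ) ≤ D ^ (8 * C + 12 + j) ∧
      Near (q * θ) (D ^ (8 * C + 12 + j) / (R * B)) := by
  have hD0 : (0 : ℝ) < D := by linarith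
  have hD1 : (1 : ℝ) ≤ D := by linarith
  set K := (4 * D ^ 2) ^ C with hKdef
  have hK1 : 1 ≤ K := one_le_pow₀ (by nlinarith)
  have hRpos : 0 < R := lt_of_lt_of_le (by positivity) hR
  have hBpos : (0 : ℝ) < B := lt_of_lt_of_le (by positivity) hB
  have hK2 : K ^ 2 ≤ D ^ (8 * C) := by
    have : 4 * D ^ 2 ≤ D ^ 4 := by nlinarith [sq_nonneg D, mul_le_mul hD hD (by norm_num) hD0.le]
    calc K ^ 2 = (4 * D ^ 2) ^ (C * 2) := by rw [hKdef, ← pow_mul]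
      _ ≤ (D ^ 4) ^ (C * 2) := pow_le_pow_left₀ (by positivity) this _
      _ = _ := by rw [← pow_mul]; congr 1; ring
  have h128 : (128 : ℝ) ≤ D ^ 7 := by
    calc (128 : ℝ) = 2 ^ 7 := by norm_num
      _ ≤ _ := pow_le_pow_left₀ (by norm_num) hD 7
  have hj : ((j : ℝ) + 1) ≤ D ^ j := by
    calc ((j : ℝ) + 1) ≤ 2 ^ j := by exact_mod_cast Nat.lt_two_pow_self
      _ ≤ _ := pow_le_pow_left₀ (by norm_num) hD j
  have hmain : 128 * K ^ 2 * D ^ 2 * (j + 1) ≤ D ^ (8 * C + 12 + j) := by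
    calc 128 * K ^ 2 * D ^ 2 * (j + 1) ≤ D ^ 7 * D ^ (8 * C) * D ^ 2 * D ^ j := by gcongr
      _ = D ^ (8 * C + 9 + j) := by rw [← pow_add, ← pow_add, ← pow_add]; congr 1; ring
      _ ≤ _ := pow_le_pow_right₀ hD1 (by omega)
  have hj1 : (1:ℝ) ≤ (j:ℝ) + 1 := by linarith [Nat.cast_nonneg (α := ℝ) j]
  have hp : 0 ≤ 128 * K ^ 2 * D ^ 2 := by positivity
  have hmain2 : 128 * K ^ 2 * D ^ 2 ≤ D ^ (8 * C + 12 + j) := by nlinarith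
  obtain ⟨q, hq, hqle, hn⟩ := extract (((j : ℝ) + 1) * θ) B T M (D ^ 2) K (K / R) hM
    (one_le_pow₀ hD1) hK1 (by positivity) hT hsum
    (by
      intro h hh
      obtain ⟨q, h1, h2, h3⟩ := hgood h hh
      refine ⟨q, h1, h2, ?_⟩
      have : (q : ℝ) * (h * (((j : ℝ) + 1) * θ)) = q * (((j : ℝ) + 1) * h * θ) := by ring
      rwa [this])
    (by
      have : 128 * (K / R) * K * D ^ 2 = (128 * K ^ 2 * D ^ 2) / R := by ring
      rw [this, div_le_one hRpos]
      exact hmain2.trans hR)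
    (by
      have : K ≤ K ^ 2 := by nlinarith
      have : 8 * K * D ^ 2 ≤ 128 * K ^ 2 * D ^ 2 := by gcongr; norm_num
      linarith)
  refine ⟨q * (j + 1), by positivity, ?_, ?_⟩
  · push_cast
    calc (q : ℝ) * (j + 1) ≤ (8 * D ^ 2 * K ^ 2) * (j + 1) := by gcongr
      _ ≤ 128 * K ^ 2 * D ^ 2 * (j + 1) := by
        apply mul_le_mul_of_nonneg_right _ (by positivity)
        nlinarith [show 0 ≤ K ^ 2 * D ^ 2 by positivity]
      _ ≤ _ := hmain
  · have : ((q * (j + 1) : ℕ) : ℝ) * θ = q * ((j + 1) * θ) := by push_cast; ring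
    rw [this]
    apply hn.mono
    have : 16 * D ^ 2 * K * (K / R) / B = (16 * D ^ 2 * K ^ 2) / (R * B) := by field_simp
    rw [this]
    apply div_le_div_of_nonneg_right _ (by positivity)
    nlinarith [show 0 ≤ K ^ 2 * D ^ 2 by positivity]

lemma norm_sum_e_le (g : ℤ → ℝ) (s : Finset ℤ) : ‖∑ a ∈ s, e (g a)‖ ≤ s.card := by
  refine (norm_sum_le _ _).trans ?_
  simp [norm_e]

lemma four_D (C : ℕ) (D : ℝ) (hD : 2 ≤ D) (j : ℕ) :
    (4 * D ^ 2) ^ C ≤ D ^ (8 * C + 12 + j) := by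
  have : 4 * D ^ 2 ≤ D ^ 4 := by nlinarith [sq_nonneg D, mul_le_mul hD hD (by norm_num) (by linarith)]
  calc (4 * D ^ 2) ^ C ≤ (D ^ 4) ^ C := pow_le_pow_left₀ (by positivity) this _
    _ = D ^ (4 * C) := by rw [← pow_mul]
    _ ≤ _ := pow_le_pow_right₀ (by linarith) (by omega)

/-- Weyl's inequality in inverse form. -/
theorem weyl (j : ℕ) : ∃ C : ℕ, ∀ (D : ℝ) (A : ℕ) (θ : ℝ) (g : ℤ → ℝ) (x y : ℤ), 2 ≤ D →
    IsPoly (j + 1) θ g → y - x ≤ A → A / D ≤ ‖∑ a ∈ Finset.Ioc x y, e (g a)‖ → D ^ C ≤ A →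
    ∃ q : ℕ, 0 < q ∧ (q : ℝ) ≤ D ^ C ∧ Near (q * θ) (D ^ C / A ^ (j + 1)) := by
  induction j with
  | zero =>
    refine ⟨1, ?_⟩
    intro D A θ g x y hD hg hxy hS hA
    have hA0 : (0:ℝ) < A := lt_of_lt_of_le (by positivity) hA
    refine ⟨1, one_pos, by push_cast; rw [pow_one]; linarith, round θ, ?_⟩
    have h1 := geom_bound hg x y
    have h2 : A / D * (4 * |θ - round θ|) ≤ 2 :=
      (mul_le_mul_of_nonneg_right hS (by positivity)).trans h1
    push_cast
    rw [one_mul, pow_one, pow_one, le_div_iff₀ hA0]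
    rw [div_mul_eq_mul_div, div_le_iff₀ (by linarith)] at h2
    nlinarith [abs_nonneg (θ - round θ)]
  | succ j ih =>
    obtain ⟨C, hC⟩ := ih
    refine ⟨8 * C + 12 + (j + 1), ?_⟩
    intro D A θ g x y hD hg hxy hS hA
    have hA0 : (0:ℝ) < A := lt_of_lt_of_le (by positivity) hA
    have hcardA : ∀ x' y' : ℤ, y' - x' ≤ A → ((Finset.Ioc x' y').card : ℝ) ≤ A := by
      intro x' y' h
      rw [Int.card_Ioc]
      have : (y' - x').toNat ≤ A := by omega
      exact_mod_cast this
    set T : ℤ → ℝ := fun h => ‖∑ b ∈ Finset.Ioc (max x (x - h)) (min y (y - h)),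
      e (g (b + h) - g b)‖ with hTdef
    have hsq : ‖∑ a ∈ Finset.Ioc x y, e (g a)‖ ^ 2 ≤ ∑ h ∈ Finset.Ioo (-(A : ℤ)) A, T h := by
      have h1 := vdc (fun a => e (g a)) x y A hxy
      have h2 : ‖((‖∑ a ∈ Finset.Ioc x y, e (g a)‖ ^ 2 : ℝ) : ℂ)‖ =
          ‖∑ a ∈ Finset.Ioc x y, e (g a)‖ ^ 2 := by
        rw [Complex.norm_real, Real.norm_eq_abs, abs_of_nonneg (by positivity)]
      rw [← h2, h1]
      refine (norm_sum_le _ _).trans (Finset.sum_le_sum ?_)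
      intro h _
      apply le_of_eq
      rw [hTdef]
      simp only
      congr 1
      have h3 : (Finset.Ioc x y).filter (fun b => b + h ∈ Finset.Ioc x y) =
          Finset.Ioc (max x (x - h)) (min y (y - h)) := by
        ext b; simp only [Finset.mem_filter, Finset.mem_Ioc]; omega
      rw [h3]
      exact Finset.sum_congr rfl (fun b _ => e_mul_conj _ _)
    have hstep := step (j + 1) C D hD A ((A : ℝ) ^ (j + 1)) A θ T hA0
      (fun h => (norm_sum_e_le _ _).trans (hcardA _ _ (by omega)))
      (by
        refine le_trans ?_ hsq
        calc (A : ℝ) * A / D ^ 2 = (A / D) ^ 2 := by ring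
          _ ≤ _ := pow_le_pow_left₀ (by positivity) hS 2)
      (hA.trans (le_self_pow₀ (by
        have : (1:ℝ) ≤ D ^ (8 * C + 12 + (j + 1)) := one_le_pow₀ (by linarith)
        linarith) (by omega))) hA
      (by
        intro h hh
        have := hC (4 * D ^ 2) A _ _ _ _ (by nlinarith) (hg h) (by omega) hh
          ((four_D C D hD (j+1)).trans hA)
        exact this)
    rwa [← pow_succ] at hstep

/-- Bilinear inequality in inverse form. -/
theorem bilin (m j : ℕ) : ∃ C : ℕ, ∀ (D : ℝ) (A B : ℕ) (ξ : ℝ) (g : ℤ → ℤ → ℝ) (x y c : ℤ)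
    (w : ℤ → ℂ), 2 ≤ D → (∀ a : ℤ, IsPoly (j + 1) (ξ * (a : ℝ) ^ (m + 1)) (g a)) → y - x ≤ A →
    (∀ b, ‖w b‖ ≤ 1) →
    (A : ℝ) * B / D ≤ ∑ a ∈ Finset.Ioc x y, ‖∑ b ∈ Finset.Ioc c (c + B), w b * e (g a b)‖ →
    D ^ C ≤ A → D ^ C ≤ B →
    ∃ q : ℕ, 0 < q ∧ (q : ℝ) ≤ D ^ C ∧ Near (q * ξ) (D ^ C / (A ^ (m + 1) * B ^ (j + 1))) := by
  have cauchy : ∀ (D : ℝ) (A B : ℕ) (g : ℤ → ℤ → ℝ) (x y c : ℤ) (w : ℤ → ℂ), 2 ≤ D →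
      y - x ≤ A → (0:ℝ) < A →
      (A : ℝ) * B / D ≤ ∑ a ∈ Finset.Ioc x y, ‖∑ b ∈ Finset.Ioc c (c + B), w b * e (g a b)‖ →
      (B : ℝ) * (A * B) / D ^ 2 ≤ ∑ h ∈ Finset.Ioo (-(B : ℤ)) B, ‖∑ a ∈ Finset.Ioc x y,
        ∑ b ∈ Finset.Ioc c (c + B), (if b + h ∈ Finset.Ioc c (c + B) then
          w (b + h) * (starRingEnd ℂ) (w b) else 0) * e (g a (b + h) - g a b)‖ := by
    intro D A B g x y c w hD hxy hA hS
    have hcard : ((Finset.Ioc x y).card : ℝ) ≤ A := by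
      rw [Int.card_Ioc]
      have : (y - x).toNat ≤ A := by omega
      exact_mod_cast this
    have h1 : (∑ a ∈ Finset.Ioc x y, ‖∑ b ∈ Finset.Ioc c (c + B), w b * e (g a b)‖) ^ 2 ≤
        A * ∑ a ∈ Finset.Ioc x y, ‖∑ b ∈ Finset.Ioc c (c + B), w b * e (g a b)‖ ^ 2 := by
      refine sq_sum_le_card_mul_sum_sq.trans ?_
      gcongr
    have h2 : ∑ a ∈ Finset.Ioc x y, ‖∑ b ∈ Finset.Ioc c (c + B), w b * e (g a b)‖ ^ 2 ≤
        ∑ h ∈ Finset.Ioo (-(B : ℤ)) B, ‖∑ a ∈ Finset.Ioc x y,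
        ∑ b ∈ Finset.Ioc c (c + B), (if b + h ∈ Finset.Ioc c (c + B) then
          w (b + h) * (starRingEnd ℂ) (w b) else 0) * e (g a (b + h) - g a b)‖ := by
      refine le_trans ?_ (norm_sum_le _ _)
      rw [Finset.sum_comm]
      have h3 : ∀ a ∈ Finset.Ioc x y, ∑ h ∈ Finset.Ioo (-(B : ℤ)) B,
        ∑ b ∈ Finset.Ioc c (c + B), (if b + h ∈ Finset.Ioc c (c + B) then
          w (b + h) * (starRingEnd ℂ) (w b) else 0) * e (g a (b + h) - g a b) =
          ((‖∑ b ∈ Finset.Ioc c (c + B), w b * e (g a b)‖ ^ 2 : ℝ) : ℂ) := by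
        intro a _
        rw [vdc (fun b => w b * e (g a b)) c (c + B) B (by omega)]
        apply Finset.sum_congr rfl
        intro h _
        rw [Finset.sum_filter]
        apply Finset.sum_congr rfl
        intro b _
        split_ifs
        · rw [map_mul, ← e_mul_conj]; ring
        · simp
      rw [Finset.sum_congr rfl h3, ← Complex.ofReal_sum, Complex.norm_real, Real.norm_eq_abs]
      exact le_abs_self _
    have h4 : ((A : ℝ) * B / D) ^ 2 ≤ (∑ a ∈ Finset.Ioc x y,
        ‖∑ b ∈ Finset.Ioc c (c + B), w b * e (g a b)‖) ^ 2 :=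
      pow_le_pow_left₀ (by positivity) hS 2
    have h5 : (A:ℝ) * ((B : ℝ) * (A * B) / D ^ 2) = ((A : ℝ) * B / D) ^ 2 := by ring
    refine le_of_mul_le_mul_left ?_ hA
    rw [h5]
    exact h4.trans (h1.trans (mul_le_mul_of_nonneg_left h2 hA.le))
  induction j with
  | zero =>
    obtain ⟨C, hC⟩ := weyl m
    refine ⟨8 * C + 12 + 0, ?_⟩
    intro D A B ξ g x y c w hD hg hxy hw hS hA hB
    have hA0 : (0:ℝ) < A := lt_of_lt_of_le (by positivity) hA
    have hB0 : (0:ℝ) < B := lt_of_lt_of_le (by positivity) hB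
    have hcard : ((Finset.Ioc x y).card : ℝ) ≤ A := by
      rw [Int.card_Ioc]
      have : (y - x).toNat ≤ A := by omega
      exact_mod_cast this
    set T : ℤ → ℝ := fun h => B * ‖∑ a ∈ Finset.Ioc x y, e (((0:ℕ) + 1) * h * ξ * (a:ℝ) ^ (m + 1))‖
      with hTdef
    have hstep := step 0 C D hD B ((A : ℝ) ^ (m + 1)) (A * B) ξ T (by positivity)
      (fun h => by
        rw [hTdef, mul_comm (A:ℝ)]
        exact mul_le_mul_of_nonneg_left ((norm_sum_e_le _ _).trans hcard) hB0.le)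
      (by
        refine (cauchy D A B g x y c w hD hxy hA0 hS).trans (Finset.sum_le_sum ?_)
        intro h _
        rw [Finset.sum_comm]
        have h1 : ∀ b ∈ Finset.Ioc c (c + B), ‖∑ a ∈ Finset.Ioc x y,
            (if b + h ∈ Finset.Ioc c (c + B) then
            w (b + h) * (starRingEnd ℂ) (w b) else 0) * e (g a (b + h) - g a b)‖ ≤
            ‖∑ a ∈ Finset.Ioc x y, e (((0:ℕ) + 1) * h * ξ * (a:ℝ) ^ (m + 1))‖ := by
          intro b _
          rw [← Finset.mul_sum, norm_mul]
          have h2 : ∑ a ∈ Finset.Ioc x y, e (g a (b + h) - g a b) =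
              ∑ a ∈ Finset.Ioc x y, e (((0:ℕ) + 1) * h * ξ * (a:ℝ) ^ (m + 1)) := by
            apply Finset.sum_congr rfl
            intro a _
            have h3 : g a (b + h) - g a b = ((0:ℕ) + 1) * h * (ξ * (a:ℝ) ^ (m + 1)) := hg a h b
            rw [h3]; congr 1; ring
          rw [h2]
          refine mul_le_of_le_one_left (norm_nonneg _) ?_
          split_ifs
          · rw [norm_mul, RCLike.norm_conj]
            exact mul_le_one₀ (hw _) (norm_nonneg _) (hw _)
          · simp
        refine (norm_sum_le _ _).trans ((Finset.sum_le_sum h1).trans ?_)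
        rw [Finset.sum_const, nsmul_eq_mul, Int.card_Ioc]
        simp [hTdef])
      (hA.trans (le_self_pow₀ (by
        have : (1:ℝ) ≤ D ^ (8 * C + 12 + 0) := one_le_pow₀ (by linarith)
        linarith) (by omega))) hB
      (by
        intro h hh
        have := hC (4 * D ^ 2) A _ _ x y (by nlinarith)
          (isPoly_mono (m + 1) (((0:ℕ) + 1) * h * ξ)) hxy
          (by
            rw [hTdef] at hh
            refine le_of_mul_le_mul_left ?_ hB0
            refine le_trans (le_of_eq ?_) hh
            ring)
          ((four_D C D hD 0).trans hA)
        exact this)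
    rw [zero_add, pow_one]
    exact hstep
  | succ j ih =>
    obtain ⟨C, hC⟩ := ih
    refine ⟨8 * C + 12 + (j + 1), ?_⟩
    intro D A B ξ g x y c w hD hg hxy hw hS hA hB
    have hA0 : (0:ℝ) < A := lt_of_lt_of_le (by positivity) hA
    have hB0 : (0:ℝ) < B := lt_of_lt_of_le (by positivity) hB
    have hcard : ((Finset.Ioc x y).card : ℝ) ≤ A := by
      rw [Int.card_Ioc]
      have : (y - x).toNat ≤ A := by omega
      exact_mod_cast this
    set w' : ℤ → ℤ → ℂ := fun h b => (if b + h ∈ Finset.Ioc c (c + B) then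
            w (b + h) * (starRingEnd ℂ) (w b) else 0) with hw'
    have hw1 : ∀ h b, ‖w' h b‖ ≤ 1 := by
      intro h b
      rw [hw']
      simp only
      split_ifs
      · rw [norm_mul, RCLike.norm_conj]
        exact mul_le_one₀ (hw _) (norm_nonneg _) (hw _)
      · simp
    set T : ℤ → ℝ := fun h => ∑ a ∈ Finset.Ioc x y, ‖∑ b ∈ Finset.Ioc c (c + B),
      w' h b * e (g a (b + h) - g a b)‖ with hTdef
    have hone : (1:ℝ) ≤ D ^ (8 * C + 12 + (j + 1)) := one_le_pow₀ (by linarith)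
    have hstep := step (j + 1) C D hD B ((A : ℝ) ^ (m + 1) * B ^ (j + 1)) (A * B) ξ T (by positivity)
      (fun h => by
        rw [hTdef]
        have : ∀ a ∈ Finset.Ioc x y, ‖∑ b ∈ Finset.Ioc c (c + B),
            w' h b * e (g a (b + h) - g a b)‖ ≤ B := by
          intro a _
          refine (norm_sum_le _ _).trans ?_
          have : ∀ b ∈ Finset.Ioc c (c + B), ‖w' h b * e (g a (b + h) - g a b)‖ ≤ 1 := by
            intro b _
            rw [norm_mul, norm_e, mul_one]; exact hw1 h b
          refine (Finset.sum_le_sum this).trans ?_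
          simp
        refine (Finset.sum_le_sum this).trans ?_
        rw [Finset.sum_const, nsmul_eq_mul]
        gcongr)
      (by
        refine (cauchy D A B g x y c w hD hxy hA0 hS).trans (Finset.sum_le_sum ?_)
        intro h _
        exact norm_sum_le _ _)
      (by
        calc D ^ (8 * C + 12 + (j + 1)) ≤ A := hA
          _ ≤ (A:ℝ) ^ (m + 1) := le_self_pow₀ (by linarith) (by omega)
          _ = (A:ℝ) ^ (m + 1) * 1 := by ring
          _ ≤ (A:ℝ) ^ (m + 1) * B ^ (j + 1) := by
            gcongr; exact one_le_pow₀ (by linarith)) hB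
      (by
        intro h hh
        have := hC (4 * D ^ 2) A B (((j + 1 : ℕ) + 1) * h * ξ) (fun a b => g a (b + h) - g a b)
          x y c (w' h) (by nlinarith)
          (fun a => (hg a h).congr (by push_cast; ring) (fun _ => rfl)) hxy (hw1 h) hh
          ((four_D C D hD (j+1)).trans hA) ((four_D C D hD (j+1)).trans hB)
        exact this)
    rw [mul_assoc, ← pow_succ] at hstep
    exact hstep

end UDP

namespace UDP
open ArithmeticFunction

/-- Multiplication of an arithmetic function by the logarithm. -/
def DL (f : ArithmeticFunction ℝ) : ArithmeticFunction ℝ := ArithmeticFunction.pmul f ArithmeticFunction.log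

lemma DL_apply (f : ArithmeticFunction ℝ) (n : ℕ) : DL f n = f n * Real.log n := by
  simp [DL, ArithmeticFunction.pmul_apply, ArithmeticFunction.log_apply]

lemma DL_mul (f g : ArithmeticFunction ℝ) : DL (f * g) = DL f * g + f * DL g := by
  ext n
  rw [DL_apply, ArithmeticFunction.add_apply, ArithmeticFunction.mul_apply,
    ArithmeticFunction.mul_apply, ArithmeticFunction.mul_apply, Finset.sum_mul,
    ← Finset.sum_add_distrib]
  apply Finset.sum_congr rfl
  intro p hp
  have h := Nat.mem_divisorsAntidiagonal.1 hp
  rw [DL_apply, DL_apply, ← h.1, Nat.cast_mul, Real.log_mul]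
  · ring
  · intro h0; apply h.2; rw [← h.1]; rw [Nat.cast_eq_zero] at h0; simp [h0]
  · intro h0; apply h.2; rw [← h.1]; rw [Nat.cast_eq_zero] at h0; simp [h0]

/-- The Moebius function with real values. -/
def muR : ArithmeticFunction ℝ := ((ArithmeticFunction.moebius : ArithmeticFunction ℤ) : ArithmeticFunction ℝ)

lemma muR_apply (n : ℕ) : muR n = (ArithmeticFunction.moebius n : ℝ) := by
  simp [muR]

lemma muR_mul_zeta : muR * (ArithmeticFunction.zeta : ArithmeticFunction ℝ) = 1 := by
  unfold muR
  exact ArithmeticFunction.coe_moebius_mul_coe_zeta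

lemma DL_muR : DL muR = - (muR * ArithmeticFunction.vonMangoldt) := by
  have h : DL muR * (ArithmeticFunction.zeta : ArithmeticFunction ℝ) = - ArithmeticFunction.vonMangoldt := by
    have h1 := DL_mul muR (ArithmeticFunction.zeta : ArithmeticFunction ℝ)
    rw [muR_mul_zeta] at h1
    have h2 : DL (1 : ArithmeticFunction ℝ) = 0 := by
      ext n
      rw [DL_apply]
      by_cases hn : n = 1
      · simp [hn]
      · simp [ArithmeticFunction.one_apply_ne hn]
    have h3 : DL (ArithmeticFunction.zeta : ArithmeticFunction ℝ) = ArithmeticFunction.log := by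
      ext n
      rw [DL_apply]
      by_cases hn : n = 0
      · simp [hn]
      · simp [ArithmeticFunction.natCoe_apply, hn, ArithmeticFunction.log_apply]
    have h4 : muR * ArithmeticFunction.log = ArithmeticFunction.vonMangoldt := by
      unfold muR
      exact ArithmeticFunction.moebius_mul_log_eq_vonMangoldt
    rw [h2, h3, h4] at h1
    exact eq_neg_of_add_eq_zero_left h1.symm
  calc DL muR = DL muR * (muR * (ArithmeticFunction.zeta : ArithmeticFunction ℝ)) := by
        rw [muR_mul_zeta, mul_one]
    _ = muR * (DL muR * (ArithmeticFunction.zeta : ArithmeticFunction ℝ)) := by ring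
    _ = _ := by rw [h]; ring

lemma DL_DL_muR : DL (DL muR) * (ArithmeticFunction.zeta : ArithmeticFunction ℝ) =
    ArithmeticFunction.vonMangoldt * ArithmeticFunction.vonMangoldt - DL ArithmeticFunction.vonMangoldt := by
  have h0 : DL (DL muR) = - DL (muR * ArithmeticFunction.vonMangoldt) := by
    rw [DL_muR]
    ext n
    rw [DL_apply, ArithmeticFunction.neg_apply, ArithmeticFunction.neg_apply, DL_apply]; ring
  rw [h0, DL_mul, DL_muR]
  have : (-(-(muR * ArithmeticFunction.vonMangoldt) * ArithmeticFunction.vonMangoldt +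
      muR * DL ArithmeticFunction.vonMangoldt)) * (ArithmeticFunction.zeta : ArithmeticFunction ℝ) =
      (muR * (ArithmeticFunction.zeta : ArithmeticFunction ℝ)) *
      (ArithmeticFunction.vonMangoldt * ArithmeticFunction.vonMangoldt - DL ArithmeticFunction.vonMangoldt) := by
    ring
  rw [this, muR_mul_zeta, one_mul]


/-- Selberg weights. -/
def LL (L : ℝ) (n : ℕ) : ℝ := ∑ d ∈ n.divisors, muR d * (L - Real.log d) ^ 2

/-- Convolution of the von Mangoldt function with itself. -/
def VV (n : ℕ) : ℝ := ∑ p ∈ n.divisorsAntidiagonal, Λ p.1 * Λ p.2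

lemma VV_nonneg (n : ℕ) : 0 ≤ VV n :=
  Finset.sum_nonneg (fun _ _ => mul_nonneg vonMangoldt_nonneg vonMangoldt_nonneg)

lemma selberg (L : ℝ) (n : ℕ) :
    LL L n = (if n = 1 then L ^ 2 else 0) + (2 * L - Real.log n) * Λ n + VV n := by
  have key : ∀ f : ArithmeticFunction ℝ, (f * (ArithmeticFunction.zeta : ArithmeticFunction ℝ)) n =
      ∑ d ∈ n.divisors, f d := fun f => ArithmeticFunction.coe_mul_zeta_apply
  have h1 : ∑ d ∈ n.divisors, muR d = if n = 1 then 1 else 0 := by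
    rw [← key, muR_mul_zeta, ArithmeticFunction.one_apply]
  have h2 : ∑ d ∈ n.divisors, muR d * Real.log d = - Λ n := by
    have : ∑ d ∈ n.divisors, DL muR d = - Λ n := by
      rw [← key, DL_muR]
      have : -(muR * Λ) * (ArithmeticFunction.zeta : ArithmeticFunction ℝ) =
        - ((muR * (ArithmeticFunction.zeta : ArithmeticFunction ℝ)) * Λ) := by ring
      rw [this, muR_mul_zeta, one_mul, ArithmeticFunction.neg_apply]
    rw [← this]
    exact Finset.sum_congr rfl (fun d _ => (DL_apply _ _).symm)
  have h3 : ∑ d ∈ n.divisors, muR d * Real.log d ^ 2 = VV n - Λ n * Real.log n := by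
    have : ∑ d ∈ n.divisors, DL (DL muR) d = VV n - Λ n * Real.log n := by
      rw [← key, DL_DL_muR, sub_eq_add_neg, ArithmeticFunction.add_apply, ArithmeticFunction.neg_apply,
        DL_apply, ArithmeticFunction.mul_apply, VV]
      ring
    rw [← this]
    exact Finset.sum_congr rfl (fun d _ => by rw [DL_apply, DL_apply]; ring)
  have h4 : LL L n = L ^ 2 * ∑ d ∈ n.divisors, muR d - 2 * L * ∑ d ∈ n.divisors, muR d * Real.log d
      + ∑ d ∈ n.divisors, muR d * Real.log d ^ 2 := by
    rw [LL, Finset.mul_sum, Finset.mul_sum, ← Finset.sum_sub_distrib, ← Finset.sum_add_distrib]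
    exact Finset.sum_congr rfl (fun d _ => by ring)
  rw [h4, h1, h2, h3]
  split_ifs <;> ring

lemma LL_ge (L : ℝ) (n : ℕ) (h : Real.log n ≤ L) : L * Λ n ≤ LL L n := by
  rw [selberg]
  have h1 := VV_nonneg n
  have h2 : (0:ℝ) ≤ if n = 1 then L ^ 2 else 0 := by split_ifs <;> positivity
  have h3 : 0 ≤ (L - Real.log n) * Λ n := mul_nonneg (by linarith) vonMangoldt_nonneg
  nlinarith

lemma LL_nonneg (L : ℝ) (hL : 0 ≤ L) (n : ℕ) (h : Real.log n ≤ L) : 0 ≤ LL L n :=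
  (mul_nonneg hL vonMangoldt_nonneg).trans (LL_ge L n h)

lemma abs_muR_le (n : ℕ) : |muR n| ≤ 1 := by
  rw [muR_apply]
  have := ArithmeticFunction.abs_moebius_le_one (n := n)
  exact_mod_cast this

end UDP

namespace UDP
open ArithmeticFunction

/-- Hyperbola-type rearrangement. -/
lemma hyper {R : Type*} [AddCommMonoid R] (F : ℕ → ℕ → R) (X Y N : ℕ) (hY : Y ≤ N) :
    ∑ n ∈ Finset.Ioc X Y, ∑ p ∈ n.divisorsAntidiagonal, F p.1 p.2 =
      ∑ a ∈ Finset.Ioc 0 N, ∑ b ∈ Finset.Ioc (X / a) (Y / a), F a b := by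
  rw [Finset.sum_sigma', Finset.sum_sigma']
  refine Finset.sum_bij' (fun x _ => ⟨x.2.1, x.2.2⟩) (fun y _ => ⟨y.1 * y.2, (y.1, y.2)⟩) ?_ ?_ ?_ ?_ ?_
  · rintro ⟨n, a, b⟩ h
    simp only [Finset.mem_sigma, Finset.mem_Ioc, Nat.mem_divisorsAntidiagonal] at h ⊢
    obtain ⟨⟨h1, h2⟩, h3, h4⟩ := h
    have ha : 0 < a := Nat.pos_of_ne_zero (by rintro rfl; simp at h3; omega)
    have hb : 0 < b := Nat.pos_of_ne_zero (by rintro rfl; simp at h3; omega)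
    refine ⟨⟨ha, ?_⟩, ?_, ?_⟩
    · have : a ≤ a * b := Nat.le_mul_of_pos_right a hb
      omega
    · rw [Nat.div_lt_iff_lt_mul ha, mul_comm]; omega
    · rw [Nat.le_div_iff_mul_le ha, mul_comm]; omega
  · rintro ⟨a, b⟩ h
    simp only [Finset.mem_sigma, Finset.mem_Ioc, Nat.mem_divisorsAntidiagonal] at h ⊢
    obtain ⟨⟨h1, h2⟩, h3, h4⟩ := h
    rw [Nat.div_lt_iff_lt_mul h1, mul_comm] at h3
    rw [Nat.le_div_iff_mul_le h1, mul_comm] at h4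
    exact ⟨⟨h3, h4⟩, trivial, by omega⟩
  · rintro ⟨n, a, b⟩ h
    simp only [Finset.mem_sigma, Finset.mem_Ioc, Nat.mem_divisorsAntidiagonal] at h
    obtain ⟨_, h3, _⟩ := h
    subst h3; rfl
  · rintro ⟨a, b⟩ h; rfl
  · rintro ⟨n, a, b⟩ h; rfl

lemma sum_VV_mul (G : ℕ → ℂ) (X Y N : ℕ) (hY : Y ≤ N) :
    ∑ n ∈ Finset.Ioc X Y, (VV n : ℂ) * G n =
      ∑ a ∈ Finset.Ioc 0 N, ∑ b ∈ Finset.Ioc (X / a) (Y / a), (Λ a : ℂ) * Λ b * G (a * b) := by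
  rw [← hyper (fun a b => (Λ a : ℂ) * Λ b * G (a * b)) X Y N hY]
  apply Finset.sum_congr rfl
  intro n _
  rw [VV]
  push_cast
  rw [Finset.sum_mul]
  apply Finset.sum_congr rfl
  intro p hp
  rw [(Nat.mem_divisorsAntidiagonal.1 hp).1]

lemma sum_LL_mul (L : ℝ) (G : ℕ → ℂ) (X Y N : ℕ) (hY : Y ≤ N) :
    ∑ n ∈ Finset.Ioc X Y, (LL L n : ℂ) * G n =
      ∑ a ∈ Finset.Ioc 0 N, ∑ b ∈ Finset.Ioc (X / a) (Y / a),
        ((muR a * (L - Real.log a) ^ 2 : ℝ) : ℂ) * G (a * b) := by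
  rw [← hyper (fun a b => ((muR a * (L - Real.log a) ^ 2 : ℝ) : ℂ) * G (a * b)) X Y N hY]
  apply Finset.sum_congr rfl
  intro n _
  rw [LL, Complex.ofReal_sum, Finset.sum_mul, ← Nat.sum_divisorsAntidiagonal
    (fun d _ => ((muR d * (L - Real.log d) ^ 2 : ℝ) : ℂ) * G n)]
  apply Finset.sum_congr rfl
  intro p hp
  rw [(Nat.mem_divisorsAntidiagonal.1 hp).1]

lemma sum_hyper_real (f : ℕ → ℕ → ℝ) (G : ℕ → ℝ) (X Y N : ℕ) (hY : Y ≤ N) :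
    ∑ n ∈ Finset.Ioc X Y, (∑ p ∈ n.divisorsAntidiagonal, f p.1 p.2) * G n =
      ∑ a ∈ Finset.Ioc 0 N, ∑ b ∈ Finset.Ioc (X / a) (Y / a), f a b * G (a * b) := by
  rw [← hyper (fun a b => f a b * G (a * b)) X Y N hY]
  apply Finset.sum_congr rfl
  intro n _
  rw [Finset.sum_mul]
  apply Finset.sum_congr rfl
  intro p hp
  rw [(Nat.mem_divisorsAntidiagonal.1 hp).1]

lemma sum_dvd_Ioc {R : Type*} [AddCommMonoid R] (G : ℕ → R) (X Y d : ℕ) (hd : 0 < d) :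
    ∑ m ∈ Finset.Ioc (X / d) (Y / d), G (d * m) =
      ∑ n ∈ (Finset.Ioc X Y).filter (fun n => d ∣ n), G n := by
  refine Finset.sum_bij (fun m _ => d * m) ?_ ?_ ?_ ?_
  · intro m hm
    rw [Finset.mem_Ioc, Nat.div_lt_iff_lt_mul hd, Nat.le_div_iff_mul_le hd] at hm
    rw [Finset.mem_filter, Finset.mem_Ioc, mul_comm d m]
    exact ⟨hm, Dvd.intro_left m rfl⟩
  · intro a _ b _ h; exact Nat.eq_of_mul_eq_mul_left hd h
  · intro n hn
    rw [Finset.mem_filter, Finset.mem_Ioc] at hn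
    obtain ⟨hn, m, rfl⟩ := hn
    refine ⟨m, ?_, rfl⟩
    rw [Finset.mem_Ioc, Nat.div_lt_iff_lt_mul hd, Nat.le_div_iff_mul_le hd, mul_comm m d]
    exact hn
  · intro _ _; rfl

lemma card_modEq (X Y v M : ℕ) (hXY : X ≤ Y) (hM : 0 < M) :
    |(((Finset.Ioc X Y).filter (fun n => n ≡ v [MOD M])).card : ℝ) - ((Y:ℝ) - X) / M| ≤ 1 := by
  have h := Nat.Ioc_filter_modEq_card X Y hM v
  set c := ((Finset.Ioc X Y).filter (fun n => n ≡ v [MOD M])).card with hc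
  have hM' : (0:ℚ) < M := by exact_mod_cast hM
  have hXY' : (X:ℚ) ≤ Y := by exact_mod_cast hXY
  have h0 : ⌊((X:ℚ) - v) / M⌋ ≤ ⌊((Y:ℚ) - v) / M⌋ := by
    apply Int.floor_le_floor
    gcongr
  rw [max_eq_left (by omega)] at h
  have h1 := Int.floor_le (((X:ℚ) - v) / M)
  have h2 := Int.lt_floor_add_one (((X:ℚ) - v) / M)
  have h3 := Int.floor_le (((Y:ℚ) - v) / M)
  have h4 := Int.lt_floor_add_one (((Y:ℚ) - v) / M)
  have h5 : (c : ℚ) = (⌊((Y:ℚ) - v) / M⌋ : ℚ) - ⌊((X:ℚ) - v) / M⌋ := by exact_mod_cast h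
  have h6 : ((Y:ℚ) - X) / M = ((Y:ℚ) - v) / M - ((X:ℚ) - v) / M := by ring
  have h7 : |(c : ℚ) - ((Y:ℚ) - X) / M| ≤ 1 := by
    rw [h5, h6, abs_le]; constructor <;> linarith
  have h8 : ((|(c : ℚ) - ((Y:ℚ) - X) / M| : ℚ) : ℝ) ≤ ((1:ℚ) : ℝ) := Rat.cast_le.2 h7
  push_cast at h8
  exact h8

/-- Count of multiples of `d` in a residue class. -/
def cnt (X Y d q r : ℕ) : ℝ :=
  (((Finset.Ioc X Y).filter (fun n => d ∣ n ∧ n ≡ r [MOD q])).card : ℝ)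

lemma cnt_nonneg (X Y d q r : ℕ) : 0 ≤ cnt X Y d q r := Nat.cast_nonneg _

lemma cnt_coprime (X Y d q r : ℕ) (hXY : X ≤ Y) (hd : 0 < d) (hq : 0 < q) (h : Nat.Coprime d q) :
    |cnt X Y d q r - ((Y:ℝ) - X) / q / d| ≤ 1 := by
  obtain ⟨v, hv1, hv2⟩ := Nat.chineseRemainder h 0 r
  have h1 : (Finset.Ioc X Y).filter (fun n => d ∣ n ∧ n ≡ r [MOD q]) =
      (Finset.Ioc X Y).filter (fun n => n ≡ v [MOD (d * q)]) := by
    apply Finset.filter_congr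
    intro n _
    rw [← Nat.modEq_and_modEq_iff_modEq_mul h]
    constructor
    · rintro ⟨a, b⟩
      exact ⟨((Nat.modEq_zero_iff_dvd.2 a).trans hv1.symm), b.trans hv2.symm⟩
    · rintro ⟨a, b⟩
      exact ⟨Nat.modEq_zero_iff_dvd.1 (a.trans hv1), b.trans hv2⟩
  have h2 := card_modEq X Y v (d * q) hXY (Nat.mul_pos hd hq)
  rw [cnt, h1]
  convert h2 using 3
  push_cast
  rw [div_div, mul_comm (q:ℝ)]

lemma cnt_not_coprime (X Y d q r : ℕ) (hr : Nat.Coprime r q) (h : ¬ Nat.Coprime d q) :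
    cnt X Y d q r = 0 := by
  rw [cnt, Nat.cast_eq_zero, Finset.card_eq_zero, Finset.filter_eq_empty_iff]
  rintro n _ ⟨h1, h2⟩
  apply h
  have h3 : Nat.gcd n q = 1 := by rw [h2.gcd_eq]; exact hr
  exact Nat.Coprime.coprime_dvd_left h1 h3

lemma cnt_le (X Y d q r : ℕ) (hXY : X ≤ Y) (hd : 0 < d) (hq : 0 < q) (hr : Nat.Coprime r q) :
    cnt X Y d q r ≤ ((Y:ℝ) - X) / q / d + 1 := by
  have hXY' : (X:ℝ) ≤ Y := by exact_mod_cast hXY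
  by_cases h : Nat.Coprime d q
  · have := (abs_le.1 (cnt_coprime X Y d q r hXY hd hq h)).2
    linarith
  · rw [cnt_not_coprime X Y d q r hr h]
    have : 0 ≤ ((Y:ℝ) - X) / q / d := by
      apply div_nonneg (div_nonneg (by linarith) (Nat.cast_nonneg _)) (Nat.cast_nonneg _)
    linarith

lemma sum_inv_le (n : ℕ) : ∑ m ∈ Finset.Ioc 0 n, (1:ℝ) / m ≤ 1 + Real.log n := by
  have h := harmonic_le_one_add_log n
  rw [harmonic_eq_sum_Icc] at h
  push_cast at h
  have : Finset.Ioc 0 n = Finset.Icc 1 n := by ext; simp [Nat.succ_le_iff]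
  rw [this]
  simpa [one_div] using h

/-- The main constant. -/
def cst (L : ℝ) (D q : ℕ) : ℝ :=
  ∑ d ∈ (Finset.Ioc 0 D).filter (fun d => Nat.Coprime d q), muR d * (L - Real.log d) ^ 2 / d

/-- The error term. -/
def ERR (N D : ℕ) (q H : ℝ) : ℝ :=
  D * Real.log N ^ 2 + Real.log (N / D) ^ 2 * (H / q * (1 + Real.log (N / D)) + N / D)

lemma sum_LL_class_eq (L : ℝ) (X Y N q r : ℕ) (hY : Y ≤ N) :
    ∑ n ∈ (Finset.Ioc X Y).filter (fun n => n ≡ r [MOD q]), LL L n =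
      ∑ d ∈ Finset.Ioc 0 N, muR d * (L - Real.log d) ^ 2 * cnt X Y d q r := by
  have h1 := sum_hyper_real (fun a _ => muR a * (L - Real.log a) ^ 2)
    (fun n => if n ≡ r [MOD q] then 1 else 0) X Y N hY
  have h2 : ∀ n, LL L n = ∑ p ∈ n.divisorsAntidiagonal, muR p.1 * (L - Real.log p.1) ^ 2 := by
    intro n
    rw [LL, ← Nat.sum_divisorsAntidiagonal (fun d _ => muR d * (L - Real.log d) ^ 2)]
  rw [Finset.sum_filter]
  calc _ = ∑ n ∈ Finset.Ioc X Y, (∑ p ∈ n.divisorsAntidiagonal, muR p.1 * (L - Real.log p.1) ^ 2) *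
        (if n ≡ r [MOD q] then 1 else 0) := by
        apply Finset.sum_congr rfl
        intro n _
        rw [h2, mul_ite, mul_one, mul_zero]
    _ = _ := h1
    _ = _ := by
        apply Finset.sum_congr rfl
        intro d hd
        rw [← Finset.mul_sum, sum_dvd_Ioc (fun n => if n ≡ r [MOD q] then (1:ℝ) else 0) X Y d
          (Finset.mem_Ioc.1 hd).1, ← Finset.sum_filter, Finset.filter_filter, cnt]
        simp

lemma tail_count (X Y N D q r : ℕ) (hXY : X ≤ Y) (hY : Y ≤ N) (hD : 0 < D) (hDN : D ≤ N)
    (hq : 0 < q) (hr : Nat.Coprime r q) :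
    ∑ d ∈ Finset.Ioc D N, cnt X Y d q r ≤
      ((Y:ℝ) - X) / q * (1 + Real.log (N / D)) + N / D := by
  have hXY' : (X:ℝ) ≤ Y := by exact_mod_cast hXY
  have hD' : (0:ℝ) < D := by exact_mod_cast hD
  have hsw : ∑ d ∈ Finset.Ioc D N, cnt X Y d q r ≤ ∑ m ∈ Finset.Ioc 0 (N / D), cnt X Y m q r := by
    have e1 : ∀ (s : Finset ℕ), ∑ d ∈ s, cnt X Y d q r =
        ∑ n ∈ (Finset.Ioc X Y).filter (fun n => n ≡ r [MOD q]), ((s.filter (fun d => d ∣ n)).card : ℝ) := by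
      intro s
      have : ∀ d, cnt X Y d q r = ∑ n ∈ (Finset.Ioc X Y).filter (fun n => n ≡ r [MOD q]),
          if d ∣ n then (1:ℝ) else 0 := by
        intro d
        rw [cnt, ← Finset.sum_filter, Finset.filter_filter]
        simp only [Finset.sum_const, nsmul_eq_mul, mul_one]
        congr 3
        ext n; exact and_comm
      simp_rw [this]
      rw [Finset.sum_comm]
      simp
    rw [e1, e1]
    apply Finset.sum_le_sum
    intro n hn
    rw [Finset.mem_filter, Finset.mem_Ioc] at hn
    have hn0 : 0 < n := by omega
    norm_cast
    apply Finset.card_le_card_of_injOn (fun d => n / d)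
    · intro d hd
      rw [Finset.mem_coe, Finset.mem_filter, Finset.mem_Ioc] at hd
      rw [Finset.mem_coe, Finset.mem_filter, Finset.mem_Ioc]
      refine ⟨⟨Nat.div_pos (Nat.le_of_dvd hn0 hd.2) (by omega), ?_⟩, Nat.div_dvd_of_dvd hd.2⟩
      calc n / d ≤ N / d := Nat.div_le_div_right (by omega)
        _ ≤ N / D := Nat.div_le_div_left (by omega) hD
    · intro d hd d' hd' h
      simp only [Finset.mem_coe, Finset.mem_filter, Finset.mem_Ioc] at hd hd' h
      have h1 := Nat.div_mul_cancel hd.2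
      have h2 := Nat.div_mul_cancel hd'.2
      rw [h] at h1
      have h3 : 0 < n / d' := Nat.div_pos (Nat.le_of_dvd hn0 hd'.2) (by omega)
      exact Nat.eq_of_mul_eq_mul_left h3 (h1.trans h2.symm)
  refine hsw.trans ?_
  calc ∑ m ∈ Finset.Ioc 0 (N / D), cnt X Y m q r
      ≤ ∑ m ∈ Finset.Ioc 0 (N / D), (((Y:ℝ) - X) / q * (1 / m) + 1) := by
        apply Finset.sum_le_sum
        intro m hm
        have := cnt_le X Y m q r hXY (Finset.mem_Ioc.1 hm).1 hq hr
        refine this.trans (le_of_eq ?_)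
        ring
    _ = ((Y:ℝ) - X) / q * ∑ m ∈ Finset.Ioc 0 (N / D), (1 / (m:ℝ)) + ((N / D : ℕ) : ℝ) := by
        rw [Finset.sum_add_distrib, ← Finset.mul_sum]; simp
    _ ≤ _ := by
        have h1 : ((N / D : ℕ) : ℝ) ≤ (N:ℝ) / D := Nat.cast_div_le
        have h2 : 0 < N / D := Nat.div_pos hDN hD
        have h3 : Real.log ((N / D : ℕ) : ℝ) ≤ Real.log ((N:ℝ) / D) :=
          Real.log_le_log (by exact_mod_cast h2) h1
        have h4 := sum_inv_le (N / D)
        have h5 : 0 ≤ ((Y:ℝ) - X) / q := div_nonneg (by linarith) (Nat.cast_nonneg _)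
        have : ((Y:ℝ) - X) / q * ∑ m ∈ Finset.Ioc 0 (N / D), (1 / (m:ℝ)) ≤
            ((Y:ℝ) - X) / q * (1 + Real.log (N / D)) := by
          apply mul_le_mul_of_nonneg_left _ h5
          linarith
        linarith

lemma sum_LL_class (X Y N D q r : ℕ) (hXY : X ≤ Y) (hY : Y ≤ N) (hD : 0 < D) (hDN : D ≤ N)
    (hq : 0 < q) (hr : Nat.Coprime r q) :
    |∑ n ∈ (Finset.Ioc X Y).filter (fun n => n ≡ r [MOD q]), LL (Real.log N) n -
      ((Y:ℝ) - X) / q * cst (Real.log N) D q| ≤ ERR N D q ((Y:ℝ) - X) := by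
  have hD' : (0:ℝ) < D := by exact_mod_cast hD
  have hN' : (0:ℝ) < N := by exact_mod_cast (lt_of_lt_of_le hD hDN)
  set L := Real.log N with hL
  set wt : ℕ → ℝ := fun d => muR d * (L - Real.log d) ^ 2 with hwt
  have hlog : ∀ d ∈ Finset.Ioc 0 N, 0 ≤ L - Real.log d := by
    intro d hd
    rw [Finset.mem_Ioc] at hd
    have : Real.log d ≤ L := Real.log_le_log (by exact_mod_cast hd.1) (by exact_mod_cast hd.2)
    linarith
  have hwtle : ∀ d, |wt d| ≤ (L - Real.log d) ^ 2 := by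
    intro d
    rw [hwt, abs_mul, abs_of_nonneg (sq_nonneg (L - Real.log d))]
    exact mul_le_of_le_one_left (sq_nonneg _) (abs_muR_le d)
  rw [sum_LL_class_eq L X Y N q r hY]
  have hsplit : ∑ d ∈ Finset.Ioc 0 N, wt d * cnt X Y d q r =
      ∑ d ∈ Finset.Ioc 0 D, wt d * cnt X Y d q r + ∑ d ∈ Finset.Ioc D N, wt d * cnt X Y d q r :=
    (Finset.sum_Ioc_consecutive _ (Nat.zero_le _) hDN).symm
  have hmain : ((Y:ℝ) - X) / q * cst L D q = ∑ d ∈ Finset.Ioc 0 D,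
      wt d * (if Nat.Coprime d q then ((Y:ℝ) - X) / q / d else 0) := by
    rw [cst, Finset.sum_filter, Finset.mul_sum]
    apply Finset.sum_congr rfl
    intro d _
    split_ifs
    · rw [hwt]; ring
    · simp
  have hdiff : |∑ d ∈ Finset.Ioc 0 D, wt d * cnt X Y d q r - ((Y:ℝ) - X) / q * cst L D q| ≤
      D * L ^ 2 := by
    rw [hmain, ← Finset.sum_sub_distrib]
    refine (Finset.abs_sum_le_sum_abs _ _).trans ?_
    have : ∀ d ∈ Finset.Ioc 0 D, |wt d * cnt X Y d q r -
        wt d * (if Nat.Coprime d q then ((Y:ℝ) - X) / q / d else 0)| ≤ L ^ 2 := by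
      intro d hd
      rw [Finset.mem_Ioc] at hd
      rw [← mul_sub, abs_mul]
      have h0 := hlog d (by rw [Finset.mem_Ioc]; omega)
      have h1 : |wt d| ≤ L ^ 2 := by
        refine (hwtle d).trans ?_
        have : 0 ≤ Real.log d := Real.log_natCast_nonneg d
        exact pow_le_pow_left₀ h0 (by linarith) 2
      have h2 : |cnt X Y d q r - (if Nat.Coprime d q then ((Y:ℝ) - X) / q / d else 0)| ≤ 1 := by
        split_ifs with hc
        · exact cnt_coprime X Y d q r hXY hd.1 hq hc
        · rw [cnt_not_coprime X Y d q r hr hc]; simp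
      calc _ ≤ L ^ 2 * 1 := mul_le_mul h1 h2 (abs_nonneg _) (sq_nonneg _)
        _ = _ := mul_one _
    refine (Finset.sum_le_sum this).trans ?_
    simp
  have htail : |∑ d ∈ Finset.Ioc D N, wt d * cnt X Y d q r| ≤
      Real.log (N / D) ^ 2 * (((Y:ℝ) - X) / q * (1 + Real.log (N / D)) + N / D) := by
    refine (Finset.abs_sum_le_sum_abs _ _).trans ?_
    have : ∀ d ∈ Finset.Ioc D N, |wt d * cnt X Y d q r| ≤ Real.log (N / D) ^ 2 * cnt X Y d q r := by
      intro d hd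
      rw [Finset.mem_Ioc] at hd
      rw [abs_mul, abs_of_nonneg (cnt_nonneg _ _ _ _ _)]
      apply mul_le_mul_of_nonneg_right _ (cnt_nonneg _ _ _ _ _)
      refine (hwtle d).trans (pow_le_pow_left₀ (hlog d (by rw [Finset.mem_Ioc]; omega)) ?_ 2)
      rw [Real.log_div hN'.ne' hD'.ne']
      have : Real.log D ≤ Real.log d := Real.log_le_log hD' (by exact_mod_cast hd.1.le)
      linarith
    refine (Finset.sum_le_sum this).trans ?_
    rw [← Finset.mul_sum]
    exact mul_le_mul_of_nonneg_left (tail_count X Y N D q r hXY hY hD hDN hq hr) (sq_nonneg _)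
  rw [hsplit, ERR]
  have : ∑ d ∈ Finset.Ioc 0 D, wt d * cnt X Y d q r + ∑ d ∈ Finset.Ioc D N, wt d * cnt X Y d q r -
      ((Y:ℝ) - X) / q * cst L D q = (∑ d ∈ Finset.Ioc 0 D, wt d * cnt X Y d q r -
      ((Y:ℝ) - X) / q * cst L D q) + ∑ d ∈ Finset.Ioc D N, wt d * cnt X Y d q r := by ring
  rw [this]
  exact (abs_add_le _ _).trans (add_le_add hdiff htail)

end UDP

namespace UDP
open ArithmeticFunction

/-- Natural number version of the logarithm. -/
def ell (N : ℕ) : ℕ := ⌈Real.log N⌉₊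

lemma log_le_ell (N : ℕ) : Real.log N ≤ ell N := Nat.le_ceil _

lemma ell_le (N : ℕ) : (ell N : ℝ) ≤ Real.log N + 1 :=
  (Nat.ceil_lt_add_one (Real.log_natCast_nonneg N)).le

lemma tendsto_log_nat : Tendsto (fun N : ℕ => Real.log N) atTop atTop :=
  Real.tendsto_log_atTop.comp tendsto_natCast_atTop_atTop

lemma ev_log_ge (c : ℝ) : ∀ᶠ N : ℕ in atTop, c ≤ Real.log N :=
  tendsto_log_nat.eventually_ge_atTop c

lemma ev_ell_pow (K : ℕ) (c : ℝ) : ∀ᶠ N : ℕ in atTop, c * (ell N : ℝ) ^ K ≤ N := by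
  have h1 := (Real.isLittleO_pow_log_id_atTop (n := K))
  have h2 := h1.bound (show (0:ℝ) < 1 / ((|c| + 1) * 2 ^ K) by positivity)
  have h3 := tendsto_natCast_atTop_atTop (R := ℝ) |>.eventually h2
  filter_upwards [h3, ev_log_ge 1] with N h h'
  simp only [id, Real.norm_eq_abs] at h
  rw [abs_of_nonneg (by positivity), Nat.abs_cast] at h
  have h4 : (ell N : ℝ) ≤ 2 * Real.log N := by linarith [ell_le N]
  calc c * (ell N : ℝ) ^ K ≤ (|c| + 1) * (2 * Real.log N) ^ K := by
        gcongr
        linarith [le_abs_self c]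
    _ = ((|c| + 1) * 2 ^ K) * Real.log N ^ K := by rw [mul_pow]; ring
    _ ≤ ((|c| + 1) * 2 ^ K) * (1 / ((|c| + 1) * 2 ^ K) * N) := by gcongr
    _ = N := by field_simp

lemma ev_loglog (E : ℕ) (c : ℝ) (hc : 0 < c) :
    ∀ᶠ N : ℕ in atTop, (1 + Real.log (2 * (ell N : ℝ) ^ E)) ^ 3 ≤ c * Real.log N := by
  have h1 := (Real.isLittleO_pow_log_id_atTop (n := 3))
  have h2 := h1.bound (show (0:ℝ) < c / ((2 * E + 2) ^ 3) by positivity)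
  have h3 := tendsto_log_nat.eventually h2
  have h4 := (Real.tendsto_log_atTop.comp tendsto_log_nat).eventually_ge_atTop 1
  filter_upwards [h3, h4, ev_log_ge 1] with N h h' h''
  simp only [id, Real.norm_eq_abs, Function.comp] at h h'
  rw [abs_of_nonneg (by positivity), abs_of_nonneg (by positivity)] at h
  set x := Real.log N with hx
  have hx0 : 0 < x := by linarith
  have h5 : (ell N : ℝ) ≤ 2 * x := by linarith [ell_le N]
  have h6 : (0:ℝ) < ell N := by linarith [log_le_ell N]
  have hlog2 : Real.log 2 ≤ 1 := by linarith [Real.log_two_lt_d9]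
  have h7 : Real.log (ell N : ℝ) ≤ 2 * Real.log x := by
    calc Real.log (ell N : ℝ) ≤ Real.log (2 * x) := Real.log_le_log h6 h5
      _ = Real.log 2 + Real.log x := Real.log_mul (by norm_num) hx0.ne'
      _ ≤ _ := by linarith
  have h8 : 1 + Real.log (2 * (ell N : ℝ) ^ E) ≤ (2 * E + 2) * Real.log x := by
    rw [Real.log_mul (by norm_num) (by positivity), Real.log_pow]
    nlinarith [Nat.cast_nonneg (α := ℝ) E]
  have h9 : 0 ≤ 1 + Real.log (2 * (ell N : ℝ) ^ E) := by
    have : 0 ≤ Real.log (2 * (ell N : ℝ) ^ E) := by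
      apply Real.log_nonneg
      have : (1:ℝ) ≤ (ell N : ℝ) ^ E := one_le_pow₀ (by linarith [log_le_ell N])
      linarith
    linarith
  calc _ ≤ ((2 * E + 2) * Real.log x) ^ 3 := pow_le_pow_left₀ h9 h8 3
    _ = (2 * E + 2) ^ 3 * Real.log x ^ 3 := by ring
    _ ≤ (2 * E + 2) ^ 3 * (c / ((2 * E + 2) ^ 3) * x) := by gcongr
    _ = _ := by field_simp

lemma div_ell_pos (N M : ℕ) (hM : 0 < M) (h : 2 * M ≤ N) :
    0 < N / M ∧ N / M ≤ N ∧ (N : ℝ) / ((N / M : ℕ) : ℝ) ≤ 2 * M := by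
  have h1 : 0 < N / M := Nat.div_pos (by omega) hM
  refine ⟨h1, Nat.div_le_self _ _, ?_⟩
  rw [div_le_iff₀ (by exact_mod_cast h1)]
  have h2 : N < M * (N / M) + M := by
    have := Nat.div_add_mod N M
    have := Nat.mod_lt N hM
    omega
  have : N ≤ 2 * M * (N / M) := by nlinarith
  exact_mod_cast this

lemma ERR_small (K : ℕ) (ε : ℝ) (hε : 0 < ε) : ∀ᶠ N : ℕ in atTop, ∀ (q H : ℝ),
    0 < q → q ≤ (ell N : ℝ) ^ K → (N : ℝ) ≤ H * (ell N : ℝ) ^ K →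
    0 < N / ell N ^ (2 * K + 4) ∧ N / ell N ^ (2 * K + 4) ≤ N ∧
    q * ERR N (N / ell N ^ (2 * K + 4)) q H ≤ ε * Real.log N * H := by
  filter_upwards [ev_ell_pow (2 * K + (2 * K + 4)) 2, ev_loglog (2 * K + 4) (ε / 3) (by positivity),
    ev_log_ge (3 / ε), ev_log_ge 1] with N h1 h2 h3 h4
  intro q H hq hqK hH
  set ℓ := ell N with hℓ
  set E := 2 * K + 4 with hE
  have hℓ1 : (1:ℝ) ≤ ℓ := by linarith [log_le_ell N]
  have hℓ0 : 0 < ℓ := by exact_mod_cast (show (0:ℝ) < ℓ by linarith)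
  have hL := log_le_ell N
  have hN : 2 * ℓ ^ E ≤ N := by
    have : (2:ℝ) * (ℓ:ℝ) ^ E ≤ N := by
      refine le_trans ?_ h1
      have : (ℓ:ℝ) ^ E ≤ (ℓ:ℝ) ^ (2 * K + E) := pow_le_pow_right₀ hℓ1 (by omega)
      linarith
    exact_mod_cast this
  obtain ⟨d1, d2, d3⟩ := div_ell_pos N (ℓ ^ E) (by positivity) hN
  refine ⟨d1, d2, ?_⟩
  set D := N / ℓ ^ E with hD
  have hN0 : (0:ℝ) < N := by
    have : 0 < N := by omega
    exact_mod_cast this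
  have hH0 : 0 < H := by
    by_contra hneg
    have : H * (ℓ:ℝ) ^ K ≤ 0 := mul_nonpos_of_nonpos_of_nonneg (not_lt.1 hneg) (by positivity)
    linarith
  have hD0 : (0:ℝ) < D := by exact_mod_cast d1
  push_cast at d3
  set lam := Real.log ((N:ℝ) / D) with hlam
  set L0 := Real.log (2 * (ℓ:ℝ) ^ E) with hL0
  have hlam0 : 0 ≤ lam := Real.log_nonneg (by
    rw [le_div_iff₀ hD0, one_mul]; exact_mod_cast d2)
  have hlamle : lam ≤ L0 := Real.log_le_log (by positivity) d3
  have t1 : q * (D * Real.log N ^ 2) ≤ H := by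
    have a1 : (D:ℝ) ≤ N / (ℓ:ℝ) ^ E := by
      have := Nat.cast_div_le (α := ℝ) (m := N) (n := ℓ ^ E)
      push_cast at this; exact this
    calc q * (D * Real.log N ^ 2) ≤ (ℓ:ℝ) ^ K * ((H * (ℓ:ℝ) ^ K) / (ℓ:ℝ) ^ E * (ℓ:ℝ) ^ 2) := by
          have : (D:ℝ) ≤ (H * (ℓ:ℝ) ^ K) / (ℓ:ℝ) ^ E := a1.trans (by gcongr)
          gcongr
      _ = H / (ℓ:ℝ) ^ 2 := by
          rw [hE]; field_simp; ring
      _ ≤ H := div_le_self hH0.le (one_le_pow₀ hℓ1)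
  have t2 : q * (N / D) ≤ H := by
    have : q * (N / D) * (ℓ:ℝ) ^ K ≤ H * (ℓ:ℝ) ^ K := by
      refine le_trans ?_ hH
      refine le_trans ?_ h1
      calc q * (N / D) * (ℓ:ℝ) ^ K ≤ (ℓ:ℝ) ^ K * (2 * (ℓ:ℝ) ^ E) * (ℓ:ℝ) ^ K := by gcongr
        _ = _ := by ring
    exact le_of_mul_le_mul_right this (by positivity)
  have e1 : q * ERR N D q H = q * (D * Real.log N ^ 2) + lam ^ 2 * (q * (N / D)) +
      lam ^ 2 * (1 + lam) * H := by
    rw [ERR, ← hlam]; field_simp; ring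
  rw [e1]
  have t3 : lam ^ 2 * (q * (N / D)) ≤ (1 + L0) ^ 3 * H := by
    apply mul_le_mul _ t2 (by positivity) (by have : 0 ≤ L0 := hlam0.trans hlamle; positivity)
    have : 0 ≤ L0 := hlam0.trans hlamle
    calc lam ^ 2 ≤ (1 + L0) ^ 2 := pow_le_pow_left₀ hlam0 (by linarith) 2
      _ ≤ _ := pow_le_pow_right₀ (by linarith) (by norm_num)
  have t4 : lam ^ 2 * (1 + lam) * H ≤ (1 + L0) ^ 3 * H := by
    apply mul_le_mul_of_nonneg_right _ hH0.le
    calc lam ^ 2 * (1 + lam) ≤ (1 + L0) ^ 2 * (1 + L0) := by gcongr; linarith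
      _ = _ := by ring
  have t5 : (1 + L0) ^ 3 * H ≤ (ε / 3 * Real.log N) * H := mul_le_mul_of_nonneg_right h2 hH0.le
  have t6 : H ≤ (ε / 3 * Real.log N) * H := by
    have : 1 ≤ ε / 3 * Real.log N := by
      calc 1 = ε / 3 * (3 / ε) := by field_simp
        _ ≤ _ := by gcongr
    nlinarith
  nlinarith

lemma psi_bound (N : ℕ) : ∑ n ∈ Finset.Ioc 0 N, Λ n ≤ 6 * N := by
  have h := Chebyshev.psi_le_const_mul_self (x := N) (Nat.cast_nonneg N)
  rw [Chebyshev.psi, Nat.floor_natCast] at h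
  have : Real.log 4 ≤ 2 := by
    have : Real.log 4 = 2 * Real.log 2 := by
      rw [show (4:ℝ) = 2 ^ 2 by norm_num, Real.log_pow]; norm_num
    linarith [Real.log_two_lt_d9]
  refine h.trans ?_
  gcongr
  linarith

lemma mertens (N : ℕ) (hN : 0 < N) : ∑ a ∈ Finset.Ioc 0 N, Λ a / a ≤ Real.log N + 6 := by
  have hN' : (0:ℝ) < N := by exact_mod_cast hN
  have h1 : ∑ n ∈ Finset.Ioc 0 N, Real.log n = ∑ a ∈ Finset.Ioc 0 N, Λ a * ((N / a : ℕ) : ℝ) := by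
    have := hyper (fun a _ => Λ a) 0 N N le_rfl
    simp only [Nat.zero_div, Finset.sum_const, Nat.card_Ioc, nsmul_eq_mul, Nat.sub_zero] at this
    rw [Finset.sum_congr rfl (fun n _ => (ArithmeticFunction.vonMangoldt_sum (n := n)).symm)]
    rw [Finset.sum_congr rfl (fun a _ => mul_comm (Λ a) _), ← this]
    apply Finset.sum_congr rfl
    intro n _
    rw [Nat.sum_divisorsAntidiagonal (fun d _ => Λ d)]
  have h2 : ∑ n ∈ Finset.Ioc 0 N, Real.log n ≤ N * Real.log N := by
    calc _ ≤ ∑ n ∈ Finset.Ioc 0 N, Real.log N := by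
          apply Finset.sum_le_sum
          intro n hn
          rw [Finset.mem_Ioc] at hn
          exact Real.log_le_log (by exact_mod_cast hn.1) (by exact_mod_cast hn.2)
      _ = _ := by simp
  have h3 : N * ∑ a ∈ Finset.Ioc 0 N, Λ a / a ≤
      ∑ a ∈ Finset.Ioc 0 N, Λ a * ((N / a : ℕ) : ℝ) + ∑ a ∈ Finset.Ioc 0 N, Λ a := by
    rw [Finset.mul_sum, ← Finset.sum_add_distrib]
    apply Finset.sum_le_sum
    intro a ha
    rw [Finset.mem_Ioc] at ha
    have ha' : (0:ℝ) < a := by exact_mod_cast ha.1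
    have : (N:ℝ) / a ≤ ((N / a : ℕ) : ℝ) + 1 := by
      rw [div_le_iff₀ ha']
      have h := Nat.div_add_mod N a
      have h' := Nat.mod_lt N ha.1
      have : N ≤ (N / a + 1) * a := by nlinarith
      exact_mod_cast this
    calc N * (Λ a / a) = Λ a * (N / a) := by ring
      _ ≤ Λ a * (((N / a : ℕ) : ℝ) + 1) := mul_le_mul_of_nonneg_left this vonMangoldt_nonneg
      _ = _ := by ring
  have h4 := psi_bound N
  refine le_of_mul_le_mul_left ?_ hN'
  linarith

lemma sum_LL_le (N : ℕ) (hN : 1 ≤ Real.log N) :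
    ∑ n ∈ Finset.Ioc 0 N, LL (Real.log N) n ≤ 60 * N * Real.log N := by
  have hN0 : 0 < N := by
    rcases Nat.eq_zero_or_pos N with h | h
    · rw [h] at hN; simp at hN; linarith
    · exact h
  have hN' : (0:ℝ) < N := by exact_mod_cast hN0
  set L := Real.log N with hL
  have hLN : L ≤ N := (Real.log_le_sub_one_of_pos hN').trans (by linarith)
  have h1 : ∑ n ∈ Finset.Ioc 0 N, (if n = 1 then L ^ 2 else 0) ≤ L ^ 2 := by
    rw [Finset.sum_ite_eq']
    split_ifs
    · exact le_rfl
    · positivity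
  have h2 : ∑ n ∈ Finset.Ioc 0 N, (2 * L - Real.log n) * Λ n ≤ 2 * L * (6 * N) := by
    calc _ ≤ ∑ n ∈ Finset.Ioc 0 N, 2 * L * Λ n := by
          apply Finset.sum_le_sum
          intro n _
          apply mul_le_mul_of_nonneg_right _ vonMangoldt_nonneg
          linarith [Real.log_natCast_nonneg n]
      _ = 2 * L * ∑ n ∈ Finset.Ioc 0 N, Λ n := by rw [Finset.mul_sum]
      _ ≤ _ := mul_le_mul_of_nonneg_left (psi_bound N) (by linarith)
  have h3 : ∑ n ∈ Finset.Ioc 0 N, VV n ≤ 6 * N * (L + 6) := by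
    have := hyper (fun a b => Λ a * Λ b) 0 N N le_rfl
    simp only [VV]
    rw [this]
    calc _ ≤ ∑ a ∈ Finset.Ioc 0 N, 6 * N * (Λ a / a) := by
          apply Finset.sum_le_sum
          intro a ha
          rw [← Finset.mul_sum, Nat.zero_div]
          have h5 := psi_bound (N / a)
          have h6 : ((N / a : ℕ) : ℝ) ≤ (N:ℝ) / a := Nat.cast_div_le
          calc Λ a * ∑ i ∈ Finset.Ioc 0 (N / a), Λ i ≤ Λ a * (6 * (N / a)) :=
                mul_le_mul_of_nonneg_left (h5.trans (by linarith)) vonMangoldt_nonneg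
            _ = _ := by ring
      _ = 6 * N * ∑ a ∈ Finset.Ioc 0 N, (Λ a / a) := by rw [Finset.mul_sum]
      _ ≤ _ := mul_le_mul_of_nonneg_left (mertens N hN0) (by positivity)
  have h4 : ∑ n ∈ Finset.Ioc 0 N, LL L n = ∑ n ∈ Finset.Ioc 0 N, (if n = 1 then L ^ 2 else 0) +
      ∑ n ∈ Finset.Ioc 0 N, (2 * L - Real.log n) * Λ n + ∑ n ∈ Finset.Ioc 0 N, VV n := by
    rw [← Finset.sum_add_distrib, ← Finset.sum_add_distrib]
    exact Finset.sum_congr rfl (fun n _ => selberg L n)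
  rw [h4]
  nlinarith

/-- Sum over coprime residue classes. -/
lemma sum_classes (s : Finset ℕ) (F : ℕ → ℝ) (q : ℕ) (hq : 0 < q) :
    ∑ r ∈ (Finset.range q).filter (fun r => Nat.Coprime q r),
      ∑ n ∈ s.filter (fun n => n ≡ r [MOD q]), F n = ∑ n ∈ s.filter (fun n => Nat.Coprime q n), F n := by
  have h := Finset.sum_fiberwise_of_maps_to (s := s.filter (fun n => Nat.Coprime q n))
    (t := (Finset.range q).filter (fun r => Nat.Coprime q r)) (g := fun n => n % q)
    (by
      intro n hn
      rw [Finset.mem_filter] at hn ⊢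
      refine ⟨Finset.mem_range.2 (Nat.mod_lt _ hq), ?_⟩
      rw [Nat.Coprime, Nat.gcd_comm, ← Nat.gcd_rec]
      exact hn.2) F
  rw [← h]
  apply Finset.sum_congr rfl
  intro r hr
  rw [Finset.mem_filter, Finset.mem_range] at hr
  rw [Finset.filter_filter]
  apply Finset.sum_congr _ (fun _ _ => rfl)
  apply Finset.filter_congr
  intro n _
  have e : n ≡ r [MOD q] ↔ n % q = r := by
    rw [Nat.ModEq, Nat.mod_eq_of_lt hr.1]
  rw [e]
  constructor
  · intro hh
    refine ⟨?_, hh⟩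
    have := hr.2
    rw [← hh, Nat.Coprime, Nat.gcd_comm, ← Nat.gcd_rec] at this
    exact this
  · exact fun hh => hh.2

lemma cst_bound (K : ℕ) : ∀ᶠ N : ℕ in atTop, ∀ q : ℕ, 0 < q → (q:ℝ) ≤ (ell N : ℝ) ^ K →
    |(Nat.totient q : ℝ) / q * cst (Real.log N) (N / ell N ^ (2 * K + 4)) q| ≤ 61 * Real.log N := by
  filter_upwards [ERR_small K 1 one_pos, ev_log_ge 1, ev_ell_pow 0 1] with N hE hL hN1
  intro q hq hqK
  have hℓ1 : (1:ℝ) ≤ ell N := by linarith [log_le_ell N]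
  have hN' : (0:ℝ) < N := by simp only [pow_zero, mul_one] at hN1; linarith
  have hq' : (0:ℝ) < q := by exact_mod_cast hq
  have hone : (1:ℝ) ≤ (ell N : ℝ) ^ K := one_le_pow₀ hℓ1
  obtain ⟨d1, d2, d3⟩ := hE q N hq' hqK (by nlinarith)
  set D := N / ell N ^ (2 * K + 4) with hD
  set L := Real.log N with hLdef
  set c := cst L D q with hc
  have hcl : ∀ r ∈ (Finset.range q).filter (fun r => Nat.Coprime q r),
      |∑ n ∈ (Finset.Ioc 0 N).filter (fun n => n ≡ r [MOD q]), LL L n - N / q * c| ≤ ERR N D q N := by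
    intro r hr
    have := sum_LL_class 0 N N D q r (Nat.zero_le _) le_rfl d1 d2 hq (Finset.mem_filter.1 hr).2.symm
    simpa using this
  have hsum : |∑ r ∈ (Finset.range q).filter (fun r => Nat.Coprime q r),
      ∑ n ∈ (Finset.Ioc 0 N).filter (fun n => n ≡ r [MOD q]), LL L n -
      Nat.totient q * (N / q * c)| ≤ Nat.totient q * ERR N D q N := by
    have e1 : (Nat.totient q : ℝ) * (N / q * c) =
        ∑ r ∈ (Finset.range q).filter (fun r => Nat.Coprime q r), (N / q * c) := by
      rw [Finset.sum_const, nsmul_eq_mul, Nat.totient_eq_card_coprime]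
    rw [e1, ← Finset.sum_sub_distrib]
    refine (Finset.abs_sum_le_sum_abs _ _).trans ((Finset.sum_le_sum hcl).trans ?_)
    rw [Finset.sum_const, nsmul_eq_mul, Nat.totient_eq_card_coprime]
  rw [sum_classes _ _ _ hq] at hsum
  have hpos : ∀ n ∈ Finset.Ioc 0 N, 0 ≤ LL L n := by
    intro n hn
    rw [Finset.mem_Ioc] at hn
    exact LL_nonneg L (by linarith) n (Real.log_le_log (by exact_mod_cast hn.1) (by exact_mod_cast hn.2))
  have hup : ∑ n ∈ (Finset.Ioc 0 N).filter (fun n => Nat.Coprime q n), LL L n ≤ 60 * N * L :=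
    (Finset.sum_le_sum_of_subset_of_nonneg (Finset.filter_subset _ _)
      (fun n hn _ => hpos n hn)).trans (sum_LL_le N hL)
  have hlow : 0 ≤ ∑ n ∈ (Finset.Ioc 0 N).filter (fun n => Nat.Coprime q n), LL L n :=
    Finset.sum_nonneg (fun n hn => hpos n (Finset.mem_filter.1 hn).1)
  have hphi : (Nat.totient q : ℝ) ≤ q := by exact_mod_cast Nat.totient_le q
  have hERR0 : 0 ≤ ERR N D q N := by
    have := hcl (1 % q) (by
      rw [Finset.mem_filter, Finset.mem_range]
      refine ⟨Nat.mod_lt _ hq, ?_⟩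
      rw [Nat.Coprime, Nat.gcd_comm, ← Nat.gcd_rec]; simp)
    exact (abs_nonneg _).trans this
  have hERR : (Nat.totient q : ℝ) * ERR N D q N ≤ L * N := by
    refine (mul_le_mul_of_nonneg_right hphi hERR0).trans (d3.trans (by linarith))
  have hkey : |(Nat.totient q : ℝ) / q * c * N| ≤ 61 * L * N := by
    have e2 : (Nat.totient q : ℝ) * (N / q * c) = (Nat.totient q : ℝ) / q * c * N := by ring
    rw [e2] at hsum
    rw [abs_le] at hsum ⊢
    constructor <;> nlinarith
  rw [abs_mul, abs_of_pos hN'] at hkey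
  exact le_of_mul_le_mul_right hkey hN'

/-- Brun-Titchmarsh type bound. -/
theorem brunT (K : ℕ) : ∀ᶠ N : ℕ in atTop, ∀ q r X Y : ℕ, 0 < q → (q:ℝ) ≤ (ell N : ℝ) ^ K →
    Nat.Coprime r q → X ≤ Y → Y ≤ N → (N:ℝ) ≤ ((Y:ℝ) - X) * (ell N : ℝ) ^ K →
    ∑ n ∈ (Finset.Ioc X Y).filter (fun n => n ≡ r [MOD q]), Λ n ≤
      62 * ((Y:ℝ) - X) / Nat.totient q := by
  filter_upwards [ERR_small K 1 one_pos, ev_log_ge 1, cst_bound K] with N hE hL hc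
  intro q r X Y hq hqK hr hXY hYN hH
  have hq' : (0:ℝ) < q := by exact_mod_cast hq
  obtain ⟨d1, d2, d3⟩ := hE q ((Y:ℝ) - X) hq' hqK hH
  have hc1 := hc q hq hqK
  have hXY' : (X:ℝ) ≤ Y := by exact_mod_cast hXY
  set D := N / ell N ^ (2 * K + 4) with hD
  set L := Real.log N with hLdef
  have hphi0 : (0:ℝ) < Nat.totient q := by exact_mod_cast Nat.totient_pos.2 hq
  have hphi : (Nat.totient q : ℝ) ≤ q := by exact_mod_cast Nat.totient_le q
  have h1 := (abs_le.1 (sum_LL_class X Y N D q r hXY hYN d1 d2 hq hr)).2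
  have h2 : L * ∑ n ∈ (Finset.Ioc X Y).filter (fun n => n ≡ r [MOD q]), Λ n ≤
      ∑ n ∈ (Finset.Ioc X Y).filter (fun n => n ≡ r [MOD q]), LL L n := by
    rw [Finset.mul_sum]
    apply Finset.sum_le_sum
    intro n hn
    rw [Finset.mem_filter, Finset.mem_Ioc] at hn
    apply LL_ge
    apply Real.log_le_log (by exact_mod_cast (by omega : 0 < n))
    exact_mod_cast (by omega : n ≤ N)
  set S := ∑ n ∈ (Finset.Ioc X Y).filter (fun n => n ≡ r [MOD q]), Λ n with hS
  set H := (Y:ℝ) - X with hHdef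
  have hH0 : 0 ≤ H := by rw [hHdef]; linarith
  rw [le_div_iff₀ hphi0]
  have h3 : (Nat.totient q : ℝ) * (H / q * cst L D q) ≤ 61 * L * H := by
    have := (abs_le.1 hc1).2
    calc (Nat.totient q : ℝ) * (H / q * cst L D q) = ((Nat.totient q : ℝ) / q * cst L D q) * H := by ring
      _ ≤ _ := mul_le_mul_of_nonneg_right this hH0
  have hERR0 : 0 ≤ ERR N D q H := (abs_nonneg _).trans (sum_LL_class X Y N D q r hXY hYN d1 d2 hq hr)
  have h4 : (Nat.totient q : ℝ) * ERR N D q H ≤ L * H := by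
    refine (mul_le_mul_of_nonneg_right hphi hERR0).trans (d3.trans (by linarith))
  have h5 : L * (S * Nat.totient q) ≤ L * (62 * H) := by
    have : Nat.totient q * (L * S) ≤ Nat.totient q * (H / q * cst L D q + ERR N D q H) :=
      mul_le_mul_of_nonneg_left (by linarith) hphi0.le
    nlinarith
  exact le_of_mul_le_mul_left h5 (by linarith)

end UDP

namespace UDP
open ArithmeticFunction

lemma sum_Ioc_eq_sub (f : ℕ → ℂ) {x y : ℕ} (h : x ≤ y) :
    ∑ b ∈ Finset.Ioc x y, f b = ∑ b ∈ Finset.Ioc 0 y, f b - ∑ b ∈ Finset.Ioc 0 x, f b := by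
  rw [← Finset.sum_Ioc_consecutive f (Nat.zero_le x) h]; ring

lemma norm_sum_Ioc_le (f : ℕ → ℂ) (M : ℝ) (hf : ∀ b, ‖f b‖ ≤ M) {x y : ℕ} (h : x ≤ y) :
    ‖∑ b ∈ Finset.Ioc x y, f b‖ ≤ M * ((y:ℝ) - x) := by
  refine (norm_sum_le _ _).trans ((Finset.sum_le_sum (fun b _ => hf b)).trans (le_of_eq ?_))
  rw [Finset.sum_const, nsmul_eq_mul, Nat.card_Ioc, Nat.cast_sub h, mul_comm]

lemma norm_sum_Ioc_sub_le (f : ℕ → ℂ) (M : ℝ) (hf : ∀ b, ‖f b‖ ≤ M) {x y x' y' : ℕ} (h : x ≤ y)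
    (h' : x' ≤ y') (hx : x ≤ x') (hy : y ≤ y') :
    ‖∑ b ∈ Finset.Ioc x y, f b - ∑ b ∈ Finset.Ioc x' y', f b‖ ≤
      M * (((x':ℝ) - x) + ((y':ℝ) - y)) := by
  have e1 : ∑ b ∈ Finset.Ioc x y, f b - ∑ b ∈ Finset.Ioc x' y', f b =
      ∑ b ∈ Finset.Ioc x x', f b - ∑ b ∈ Finset.Ioc y y', f b := by
    rw [sum_Ioc_eq_sub f h, sum_Ioc_eq_sub f h', sum_Ioc_eq_sub f hx, sum_Ioc_eq_sub f hy]; ring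
  rw [e1, mul_add]
  exact (norm_sub_le _ _).trans (add_le_add (norm_sum_Ioc_le f M hf hx) (norm_sum_Ioc_le f M hf hy))

lemma div_diff (X A a w N : ℕ) (hX : X ≤ N) (hA : 0 < A) (hw : 0 < w) (ha : A < a)
    (ha' : a ≤ A + A / w) :
    (((X / A : ℕ) : ℝ) - ((X / a : ℕ) : ℝ)) ≤ N / (A * w) + 1 := by
  have hA' : (0:ℝ) < A := by exact_mod_cast hA
  have hw' : (0:ℝ) < w := by exact_mod_cast hw
  have hapos : (0:ℝ) < a := by exact_mod_cast (by omega : 0 < a)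
  have h1 : ((X / A : ℕ) : ℝ) ≤ (X:ℝ) / A := Nat.cast_div_le
  have h2 : (X:ℝ) / a ≤ ((X / a : ℕ) : ℝ) + 1 := by
    rw [div_le_iff₀ hapos]
    have h := Nat.div_add_mod X a
    have h' := Nat.mod_lt X (by omega : a > 0)
    have : X ≤ (X / a + 1) * a := by nlinarith
    exact_mod_cast this
  have h3 : (a:ℝ) - A ≤ A / w := by
    have h : ((A / w : ℕ) : ℝ) ≤ (A:ℝ) / w := Nat.cast_div_le
    have h' : (a:ℝ) ≤ A + ((A / w : ℕ) : ℝ) := by exact_mod_cast ha'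
    linarith
  have hX' : (X:ℝ) ≤ N := by exact_mod_cast hX
  have h4 : (X:ℝ) / A - X / a ≤ N / (A * w) := by
    have e : (X:ℝ) / A - X / a = X * (a - A) / (A * a) := by field_simp
    rw [e, div_le_div_iff₀ (by positivity) (by positivity)]
    have haA : (A:ℝ) ≤ a := by exact_mod_cast ha.le
    have h5 : ((a:ℝ) - A) * w ≤ A := by rwa [le_div_iff₀ hw'] at h3
    calc X * ((a:ℝ) - A) * (A * w) = X * A * (((a:ℝ) - A) * w) := by ring
      _ ≤ N * A * A := by
          apply mul_le_mul _ h5 (mul_nonneg (by linarith) hw'.le) (by positivity)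
          gcongr
      _ ≤ N * A * a := by gcongr
      _ = N * (A * a) := by ring
  linarith

/-- Splitting a hyperbolic region in rectangular blocks. -/
theorem block (Ψ : ℕ → ℕ → ℂ) (M κ : ℝ) (hM : 0 ≤ M) (hκ : 0 ≤ κ) (hΨ : ∀ a b, ‖Ψ a b‖ ≤ M)
    (X Y N w A0 A1 : ℕ) (hXY : X ≤ Y) (hYN : Y ≤ N) (hw : 0 < w) (hA0 : w ≤ A0)
    (hA1 : A1 * w ≤ N)
    (hyp : ∀ A A', A0 ≤ A → A < A' → A' ≤ A1 → A' ≤ A + A / w →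
      ‖∑ a ∈ Finset.Ioc A A', ∑ b ∈ Finset.Ioc (X / A) (Y / A), Ψ a b‖ ≤ κ)
    (hA01 : A0 ≤ A1) :
    ‖∑ a ∈ Finset.Ioc A0 A1, ∑ b ∈ Finset.Ioc (X / a) (Y / a), Ψ a b‖ ≤
      (κ + 4 * M * N / (w:ℝ) ^ 2) * (1 + 4 * w * Real.log (A1 / A0)) := by
  have hw' : (0:ℝ) < w := by exact_mod_cast hw
  set E := 4 * M * N / (w:ℝ) ^ 2 with hE
  have hE0 : 0 ≤ E := by positivity
  have hblock : ∀ A A', A0 ≤ A → A < A' → A' ≤ A1 → A' ≤ A + A / w →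
      ‖∑ a ∈ Finset.Ioc A A', ∑ b ∈ Finset.Ioc (X / a) (Y / a), Ψ a b‖ ≤ κ + E := by
    intro A A' h1 h2 h3 h4
    have hA : 0 < A := by omega
    have hA' : (0:ℝ) < A := by exact_mod_cast hA
    have hd : ‖∑ a ∈ Finset.Ioc A A', ∑ b ∈ Finset.Ioc (X / a) (Y / a), Ψ a b -
        ∑ a ∈ Finset.Ioc A A', ∑ b ∈ Finset.Ioc (X / A) (Y / A), Ψ a b‖ ≤ E := by
      rw [← Finset.sum_sub_distrib]
      have : ∀ a ∈ Finset.Ioc A A', ‖∑ b ∈ Finset.Ioc (X / a) (Y / a), Ψ a b -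
          ∑ b ∈ Finset.Ioc (X / A) (Y / A), Ψ a b‖ ≤ M * (2 * (N / (A * w) + 1)) := by
        intro a ha
        rw [Finset.mem_Ioc] at ha
        refine (norm_sum_Ioc_sub_le (Ψ a) M (hΨ a) (Nat.div_le_div_right hXY)
          (Nat.div_le_div_right hXY) (Nat.div_le_div_left ha.1.le hA)
          (Nat.div_le_div_left ha.1.le hA)).trans ?_
        apply mul_le_mul_of_nonneg_left _ hM
        have d1 := div_diff X A a w N (hXY.trans hYN) hA hw ha.1 (ha.2.trans h4)
        have d2 := div_diff Y A a w N hYN hA hw ha.1 (ha.2.trans h4)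
        linarith
      refine (norm_sum_le _ _).trans ((Finset.sum_le_sum this).trans ?_)
      rw [Finset.sum_const, nsmul_eq_mul, Nat.card_Ioc]
      have hc : ((A' - A : ℕ) : ℝ) ≤ A / w := by
        have h : ((A / w : ℕ) : ℝ) ≤ (A:ℝ) / w := Nat.cast_div_le
        have h' : ((A' - A : ℕ) : ℝ) ≤ ((A / w : ℕ) : ℝ) := by
          exact_mod_cast (by omega : A' - A ≤ A / w)
        linarith
      have hAN : (A:ℝ) * w ≤ N := by
        have : A * w ≤ N := (Nat.mul_le_mul_right w (by omega)).trans hA1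
        exact_mod_cast this
      calc ((A' - A : ℕ) : ℝ) * (M * (2 * (N / (A * w) + 1)))
          ≤ (A / w) * (M * (2 * (N / (A * w) + N / (A * w)))) := by
            have : 1 ≤ (N:ℝ) / (A * w) := by rwa [le_div_iff₀ (by positivity), one_mul]
            gcongr
        _ = E := by rw [hE]; field_simp; ring
    have := hyp A A' h1 h2 h3 h4
    have h5 := norm_add_le (∑ a ∈ Finset.Ioc A A', ∑ b ∈ Finset.Ioc (X / a) (Y / a), Ψ a b -
        ∑ a ∈ Finset.Ioc A A', ∑ b ∈ Finset.Ioc (X / A) (Y / A), Ψ a b)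
        (∑ a ∈ Finset.Ioc A A', ∑ b ∈ Finset.Ioc (X / A) (Y / A), Ψ a b)
    rw [sub_add_cancel] at h5
    linarith
  have hmain : ∀ k A, A1 - A = k → A0 ≤ A → A ≤ A1 →
      ‖∑ a ∈ Finset.Ioc A A1, ∑ b ∈ Finset.Ioc (X / a) (Y / a), Ψ a b‖ ≤
      (κ + E) * (1 + 4 * w * Real.log (A1 / A)) := by
    intro k
    induction k using Nat.strong_induction_on with
    | _ k ih =>
      intro A hk h0 h1
      have hA : 0 < A := by omega
      have hAr : (0:ℝ) < A := by exact_mod_cast hA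
      have hA1r : (A:ℝ) ≤ A1 := by exact_mod_cast h1
      have hlog : 0 ≤ Real.log ((A1:ℝ) / A) := Real.log_nonneg (by rwa [le_div_iff₀ hAr, one_mul])
      have hprod : 0 ≤ 4 * w * Real.log ((A1:ℝ) / A) := by positivity
      rcases Nat.eq_or_lt_of_le h1 with heq | hlt
      · subst heq
        simp only [Finset.Ioc_self, Finset.sum_empty, norm_zero]
        exact mul_nonneg (by linarith) (by linarith)
      · have hAw : 1 ≤ A / w := Nat.div_pos (by omega) hw
        rcases le_or_gt A1 (A + A / w) with hle | hgt
        · refine (hblock A A1 h0 hlt le_rfl hle).trans ?_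
          nlinarith
        · have hb := hblock A (A + A / w) h0 (by omega) hgt.le le_rfl
          have hi := ih (A1 - (A + A / w)) (by omega) (A + A / w) rfl (by omega) hgt.le
          rw [← Finset.sum_Ioc_consecutive _ (by omega : A ≤ A + A / w) hgt.le]
          refine (norm_add_le _ _).trans ((add_le_add hb hi).trans ?_)
          set A' := A + A / w with hA'
          have hA'r : (0:ℝ) < A' := by exact_mod_cast (by omega : 0 < A')
          have hgrow : 1 ≤ 4 * w * Real.log ((A':ℝ) / A) := by
            have g1 : (1:ℝ) + 1 / (2 * w) ≤ (A':ℝ) / A := by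
              rw [le_div_iff₀ hAr]
              have g2 : A ≤ 2 * w * (A / w) := by
                have := Nat.div_add_mod A w
                have := Nat.mod_lt A hw
                nlinarith
              have g3 : (A:ℝ) ≤ 2 * w * ((A / w : ℕ) : ℝ) := by exact_mod_cast g2
              have g4 : (A':ℝ) = A + ((A / w : ℕ) : ℝ) := by rw [hA']; push_cast; ring
              rw [g4, add_mul, one_mul, div_mul_eq_mul_div, one_mul]
              have : (A:ℝ) / (2 * w) ≤ ((A / w : ℕ) : ℝ) := by
                rw [div_le_iff₀ (by positivity)]; linarith
              linarith
            have g5 : 1 - ((1:ℝ) + 1 / (2 * w))⁻¹ ≤ Real.log ((A':ℝ) / A) :=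
              (Real.one_sub_inv_le_log_of_pos (by positivity)).trans
                (Real.log_le_log (by positivity) g1)
            have g6 : 1 - ((1:ℝ) + 1 / (2 * w))⁻¹ = 1 / (2 * w + 1) := by
              field_simp; ring
            rw [g6] at g5
            have hw1 : (1:ℝ) ≤ w := by exact_mod_cast hw
            calc (1:ℝ) ≤ 4 * w * (1 / (2 * w + 1)) := by
                  rw [mul_one_div, le_div_iff₀ (by positivity)]; linarith
              _ ≤ _ := by gcongr
          have hsplit : Real.log ((A1:ℝ) / A) = Real.log ((A1:ℝ) / A') + Real.log ((A':ℝ) / A) := by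
            have hA1p : (0:ℝ) < A1 := by linarith
            rw [Real.log_div hA1p.ne' hAr.ne', Real.log_div hA1p.ne' hA'r.ne',
              Real.log_div hA'r.ne' hAr.ne']
            ring
          rw [hsplit]
          nlinarith
  exact hmain _ A0 rfl le_rfl hA01

end UDP

namespace UDP
open ArithmeticFunction

/-- Major arc condition. -/
def Maj (Q : ℝ) (N j : ℕ) (θ : ℝ) : Prop :=
  ∃ q : ℕ, 0 < q ∧ (q : ℝ) ≤ Q ∧ Near (q * θ) (Q / (N : ℝ) ^ j)

lemma Maj.mono {Q Q' : ℝ} {N j : ℕ} {θ : ℝ} (h : Maj Q N j θ) (hQ : Q ≤ Q') : Maj Q' N j θ := by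
  obtain ⟨q, h1, h2, h3⟩ := h
  exact ⟨q, h1, h2.trans hQ, h3.mono (by gcongr)⟩

lemma sum_Ioc_cast {E : Type*} [AddCommMonoid E] (F : ℤ → E) (A A' : ℕ) :
    ∑ a ∈ Finset.Ioc A A', F (a : ℤ) = ∑ a ∈ Finset.Ioc (A:ℤ) (A':ℤ), F a := by
  refine Finset.sum_bij' (fun a _ => (a:ℤ)) (fun a _ => a.toNat) ?_ ?_ ?_ ?_ ?_
  · intro a ha; simp only [Finset.mem_Ioc] at ha ⊢; omega
  · intro a ha; simp only [Finset.mem_Ioc] at ha ⊢; omega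
  · intro a ha; simp
  · intro a ha; simp only [Finset.mem_Ioc] at ha; simp; omega
  · intro a ha; rfl

lemma sum_Ioc_modEq {E : Type*} [AddCommMonoid E] (F : ℤ → E) (U V q s : ℕ) (hq : 0 < q) :
    ∑ a ∈ (Finset.Ioc U V).filter (fun a => a ≡ s [MOD q]), F (a : ℤ) =
      ∑ t ∈ Finset.Ioc (((U:ℤ) - s) / q) (((V:ℤ) - s) / q), F (q * t + s) := by
  have hq' : (0:ℤ) < q := by exact_mod_cast hq
  have key : ∀ t : ℤ, (((U:ℤ) - s) / q < t ∧ t ≤ ((V:ℤ) - s) / q) ↔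
      ((U:ℤ) < q * t + s ∧ q * t + s ≤ V) := by
    intro t
    rw [Int.le_ediv_iff_mul_le hq', Int.ediv_lt_iff_lt_mul hq', mul_comm t]
    constructor <;> rintro ⟨h1, h2⟩ <;> constructor <;> linarith
  have key2 : ∀ a : ℕ, a ≡ s [MOD q] → (q:ℤ) * (((a:ℤ) - s) / q) + s = a := by
    intro a h
    have := (Nat.modEq_iff_dvd.1 h.symm)
    have := Int.mul_ediv_cancel' this
    linarith
  symm
  refine Finset.sum_bij' (fun t _ => ((q:ℤ) * t + s).toNat) (fun a _ => ((a:ℤ) - s) / q) ?_ ?_ ?_ ?_ ?_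
  · intro t ht
    simp only [Finset.mem_Ioc, Finset.mem_filter] at ht ⊢
    have h := (key t).1 ht
    refine ⟨by omega, ?_⟩
    apply Nat.ModEq.symm
    rw [Nat.modEq_iff_dvd, Int.toNat_of_nonneg (by omega)]
    exact ⟨t, by ring⟩
  · intro a ha
    simp only [Finset.mem_Ioc, Finset.mem_filter] at ha ⊢
    rw [key, key2 a ha.2]
    omega
  · intro t ht
    simp only [Finset.mem_Ioc] at ht
    have h := (key t).1 ht
    rw [Int.toNat_of_nonneg (by omega)]
    rw [add_sub_cancel_right, Int.mul_ediv_cancel_left _ hq'.ne']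
  · intro a ha
    simp only [Finset.mem_filter] at ha
    simp only [key2 a ha.2, Int.toNat_natCast]
  · intro t ht
    simp only [Finset.mem_Ioc] at ht
    have h := (key t).1 ht
    rw [Int.toNat_of_nonneg (by omega)]

/-- splitting a sum into residue classes -/
lemma sum_residues {E : Type*} [AddCommMonoid E] (s : Finset ℕ) (F : ℕ → E) (q : ℕ) (hq : 0 < q) :
    ∑ a ∈ s, F a = ∑ r ∈ Finset.range q, ∑ a ∈ s.filter (fun a => a ≡ r [MOD q]), F a := by
  have h := Finset.sum_fiberwise_of_maps_to (s := s) (t := Finset.range q) (g := fun a => a % q)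
    (fun a _ => Finset.mem_range.2 (Nat.mod_lt _ hq)) F
  rw [← h]
  apply Finset.sum_congr rfl
  intro r hr
  apply Finset.sum_congr _ (fun _ _ => rfl)
  apply Finset.filter_congr
  intro a _
  rw [Nat.ModEq, Nat.mod_eq_of_lt (Finset.mem_range.1 hr)]

lemma ev_ell_ge (c : ℝ) : ∀ᶠ N : ℕ in atTop, c ≤ (ell N : ℝ) := by
  filter_upwards [ev_log_ge c] with N h using h.trans (log_le_ell N)

/-- Type I estimate. -/
lemma T1 (j K E : ℕ) : ∃ B : ℕ, ∀ᶠ N : ℕ in atTop, ∀ (θ : ℝ) (g : ℤ → ℝ) (q : ℕ) (ρ : ℕ → ℂ)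
    (d U V : ℕ), IsPoly (j + 1) θ g → ¬ Maj ((ell N : ℝ) ^ B) N (j + 1) θ → 0 < q →
    (q:ℝ) ≤ (ell N : ℝ) ^ K → (∀ m n, m ≡ n [MOD q] → ρ m = ρ n) → (∀ n, ‖ρ n‖ ≤ 1) →
    0 < d → (d:ℝ) ≤ (ell N : ℝ) ^ E → V ≤ N →
    ‖∑ m ∈ Finset.Ioc U V, ρ (d * m) * e (g ((d * m : ℕ) : ℤ))‖ ≤ N / (ell N : ℝ) ^ E := by
  obtain ⟨C, hC⟩ := weyl j
  refine ⟨(E + K + 1) * C + (E + K) * (j + 1), ?_⟩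
  filter_upwards [ev_ell_ge 2, ev_ell_pow ((E + K + 1) * C) 1, eventually_gt_atTop 0] with N hl hN hN0
  intro θ g q ρ d U V hg hM hq hqK hρ hρ1 hd hdE hV
  set l : ℝ := (ell N : ℝ) with hl'
  have hl0 : 0 < l := by linarith
  have hl1 : 1 ≤ l := by linarith
  set D : ℝ := l ^ (E + K + 1) with hD
  have hD2 : 2 ≤ D := by
    calc (2:ℝ) ≤ l ^ 1 := by simpa using hl
      _ ≤ D := pow_le_pow_right₀ hl1 (by omega)
  have hNr : (0:ℝ) < N := by exact_mod_cast hN0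
  have hq0 : (0:ℝ) < q := by exact_mod_cast hq
  have inner : ∀ s : ℕ, ‖∑ m ∈ (Finset.Ioc U V).filter (fun a => a ≡ s [MOD q]), e (g ((d * m : ℕ) : ℤ))‖ ≤ N / D := by
    intro s
    by_contra hcon
    push Not at hcon
    have h1 := sum_Ioc_modEq (fun a : ℤ => e (g (d * a))) U V q s hq
    push_cast at h1 hcon
    rw [h1] at hcon
    have hgp := hg.comp (d * q) (d * s)
    have w1 : ((V:ℤ) - s) / q - ((U:ℤ) - s) / q ≤ (N:ℤ) := by
      have hq' : (0:ℤ) < q := by exact_mod_cast hq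
      by_cases hUV : U ≤ V
      · have h2 : ((V:ℤ) - s) / q ≤ ((U:ℤ) - s) / q + (V - U) := by
          rw [← Int.add_mul_ediv_right _ _ hq'.ne']
          apply Int.ediv_le_ediv hq'
          have : (0:ℤ) ≤ V - U := by omega
          nlinarith
        omega
      · have h2 : ((V:ℤ) - s) / q ≤ ((U:ℤ) - s) / q := Int.ediv_le_ediv hq' (by omega)
        omega
    have w2 : N / D ≤ ‖∑ a ∈ Finset.Ioc (((U:ℤ) - s) / q) (((V:ℤ) - s) / q), e (g (d * q * a + d * s))‖ := by
      refine hcon.le.trans (le_of_eq ?_)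
      congr 1
      apply Finset.sum_congr rfl
      intro t _
      congr 2
      ring
    have w3 : D ^ C ≤ N := by rw [hD, ← pow_mul]; simpa using hN
    obtain ⟨q1, a1, a2, a3⟩ := hC D N _ _ (((U:ℤ) - s) / q) (((V:ℤ) - s) / q) hD2 hgp w1 w2 w3
    · apply hM
      refine ⟨q1 * (d * q) ^ (j + 1), by positivity, ?_, ?_⟩
      · push_cast
        calc (q1:ℝ) * (d * q) ^ (j + 1) ≤ D ^ C * (l ^ E * l ^ K) ^ (j + 1) := by gcongr
          _ = l ^ ((E + K + 1) * C + (E + K) * (j + 1)) := by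
            rw [hD, ← pow_mul, ← pow_add, ← pow_mul, ← pow_add]
      · have : ((q1 * (d * q) ^ (j + 1) : ℕ) : ℝ) * θ = q1 * ((((d * q : ℤ)) : ℝ) ^ (j + 1) * θ) := by
          push_cast; ring
        rw [this]
        refine a3.mono ?_
        gcongr
        rw [hD, ← pow_mul]
        exact pow_le_pow_right₀ hl1 (Nat.le_add_right _ _)
  rw [sum_residues _ _ q hq]
  calc _ ≤ ∑ r ∈ Finset.range q, ‖∑ a ∈ (Finset.Ioc U V).filter (fun a => a ≡ r [MOD q]), ρ (d * a) * e (g ((d * a : ℕ) : ℤ))‖ :=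
        norm_sum_le _ _
    _ ≤ ∑ r ∈ Finset.range q, (N / D : ℝ) := by
        apply Finset.sum_le_sum
        intro r _
        have : ∑ a ∈ (Finset.Ioc U V).filter (fun a => a ≡ r [MOD q]), ρ (d * a) * e (g ((d * a : ℕ) : ℤ)) =
            ρ (d * r) * ∑ a ∈ (Finset.Ioc U V).filter (fun a => a ≡ r [MOD q]), e (g ((d * a : ℕ) : ℤ)) := by
          rw [Finset.mul_sum]
          apply Finset.sum_congr rfl
          intro a ha
          rw [hρ (d * a) (d * r) (Nat.ModEq.mul_left d (Finset.mem_filter.1 ha).2)]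
        rw [this, norm_mul]
        calc _ ≤ 1 * (N / D : ℝ) := by
              apply mul_le_mul (hρ1 _) (inner r) (norm_nonneg _) zero_le_one
          _ = _ := one_mul _
    _ = q * (N / D) := by rw [Finset.sum_const, Finset.card_range, nsmul_eq_mul]
    _ ≤ l ^ K * (N / D) := by gcongr
    _ ≤ N / l ^ E := by
        rw [hD, ← mul_div_assoc, div_le_div_iff₀ (by positivity) (by positivity)]
        have : l ^ (E + K + 1) = l ^ E * l ^ K * l := by ring
        rw [this]
        have h3 : (0:ℝ) ≤ N * l ^ E * l ^ K := by positivity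
        nlinarith

lemma arith1 (H l : ℝ) (K : ℕ) (hl : 0 < l) :
    6 * H * l ^ K / (l ^ (K + 8) * l ^ (K + 8)) * (8 * l ^ (K + 8) * l) = 48 * H / l ^ 7 := by
  have hlK : l ^ K ≠ 0 := by positivity
  rw [pow_add]
  generalize l ^ K = u at *
  field_simp
  ring

lemma arith2 (H l : ℝ) (K : ℕ) (hl : 0 < l) :
    H * l ^ K / l ^ (2 * K + 10) = H / l ^ (K + 8) / l ^ 2 := by
  rw [div_div, ← pow_add, div_eq_div_iff (by positivity) (by positivity)]
  ring

lemma arith3 (l N PB D : ℝ) (k C m j : ℕ) (hl0 : 0 < l) (hN : 0 < N) (hDC : D ^ C = l ^ (k * C))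
    (hPB : N / l ^ m ≤ PB) (P B : ℝ) (h : PB = P * B) :
    D ^ C / (P ^ (j + 1) * B ^ (j + 1)) ≤ l ^ (k * C + m * (j + 1)) / N ^ (j + 1) := by
  rw [← mul_pow, ← h, hDC, pow_add l]
  have h2 : N ^ (j + 1) ≤ PB ^ (j + 1) * l ^ (m * (j + 1)) := by
    rw [pow_mul, ← mul_pow]
    rw [div_le_iff₀ (by positivity)] at hPB
    gcongr
  have hPB0 : (0:ℝ) < PB := lt_of_lt_of_le (by positivity) hPB
  rw [div_le_div_iff₀ (by positivity) (by positivity), mul_assoc (l ^ (k * C))]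
  have h3 : 0 < l ^ (k * C) := by positivity
  exact mul_le_mul_of_nonneg_left (by linarith) h3.le

lemma arith4 (H l : ℝ) (hl : 48 ≤ l) (hH : 0 < H) : 48 * H / l ^ 7 ≤ H / l ^ 5 := by
  have hl0 : 0 < l := by linarith
  rw [div_le_div_iff₀ (by positivity) (by positivity)]
  have : l ^ 7 = l ^ 5 * (l * l) := by ring
  rw [this]
  have h5 : 48 ≤ l * l := by nlinarith
  have h6 : 0 < H * l ^ 5 := by positivity
  nlinarith

lemma four_le_sq (l : ℝ) (hl : 48 ≤ l) : 4 ≤ l ^ 2 := by nlinarith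

lemma two_mul_le (a b : ℝ) (ha : 1 ≤ a) (hb : 2 ≤ b) : 2 * a ≤ a * b ∧ 2 ≤ a * b := by
  constructor <;> nlinarith

set_option maxHeartbeats 1600000 in
/-- Type II estimate. -/
lemma T2 (j K : ℕ) : ∃ B C1 : ℕ, ∀ᶠ N : ℕ in atTop, ∀ (θ : ℝ) (g : ℤ → ℝ) (q : ℕ) (ρ : ℕ → ℂ)
    (X Y A0 A1 : ℕ) (x y : ℕ → ℂ),
    IsPoly (j + 1) θ g → ¬ Maj ((ell N : ℝ) ^ B) N (j + 1) θ → 0 < q →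
    (q:ℝ) ≤ (ell N : ℝ) ^ K → (∀ m n, m ≡ n [MOD q] → ρ m = ρ n) → (∀ n, ‖ρ n‖ ≤ 1) →
    X ≤ Y → Y ≤ N → (N:ℝ) ≤ ((Y:ℝ) - X) * (ell N : ℝ) ^ K →
    (∀ a, ‖x a‖ ≤ 1) → (∀ b, ‖y b‖ ≤ 1) → (ell N) ^ C1 ≤ A0 → A1 * (ell N) ^ C1 ≤ N → A0 ≤ A1 →
    ‖∑ a ∈ Finset.Ioc A0 A1, ∑ b ∈ Finset.Ioc (X / a) (Y / a),
      x a * y b * (ρ (a * b) * e (g ((a * b : ℕ) : ℤ)))‖ ≤ ((Y:ℝ) - X) / (ell N : ℝ) ^ 5 := by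
  obtain ⟨C, hC⟩ := bilin j j
  refine ⟨(K + 8) * C + (2 * K + 10) * (j + 1), (K + 8) * C + 2 * K + 12, ?_⟩
  filter_upwards [ev_ell_ge 48, eventually_gt_atTop 0] with N hl hN0
  intro θ g q ρ X Y A0 A1 x y hg hM hq hqK hρ hρ1 hXY hYN hH hx hy hA0 hA1 hA01
  set H : ℝ := (Y:ℝ) - X with hHdef
  set l : ℝ := (ell N : ℝ) with hl'
  have hl0 : 0 < l := by linarith
  have hl1 : 1 ≤ l := by linarith
  have hNr : (0:ℝ) < N := by exact_mod_cast hN0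
  have hHp : 0 < H := by
    by_contra hcon
    push Not at hcon
    have : H * l ^ K ≤ 0 := mul_nonpos_of_nonpos_of_nonneg hcon (by positivity)
    linarith
  have hln : 1 ≤ ell N := by have : (1:ℝ) ≤ ((ell N : ℕ) : ℝ) := hl1; exact_mod_cast this
  set w : ℕ := ell N ^ (K + 8) with hw
  have hwr : (w:ℝ) = l ^ (K + 8) := by rw [hw]; push_cast; rfl
  have hw0 : 0 < w := by positivity
  have hw0r : (0:ℝ) < w := by exact_mod_cast hw0
  set D : ℝ := l ^ (K + 8) with hD
  have hD0 : 0 < D := by positivity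
  have hq0 : (0:ℝ) < q := by exact_mod_cast hq
  have hD2 : 2 ≤ D := by
    calc (2:ℝ) ≤ l ^ 1 := by rw [pow_one]; linarith
      _ ≤ D := pow_le_pow_right₀ hl1 (by omega)
  set Ψ : ℕ → ℕ → ℂ := fun a b => x a * y b * (ρ (a * b) * e (g ((a * b : ℕ) : ℤ))) with hΨ
  have hΨ1 : ∀ a b, ‖Ψ a b‖ ≤ 1 := by
    intro a b
    simp only [hΨ, norm_mul, norm_e, mul_one]
    exact mul_le_one₀ (mul_le_one₀ (hx a) (norm_nonneg _) (hy b)) (norm_nonneg _) (hρ1 _)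
  set κ : ℝ := 2 * q * H / (w * D) with hκ
  have hκ0 : 0 ≤ κ := by positivity
  have hC1w : l ^ ((K + 8) * C + K + 4) * w = l ^ ((K + 8) * C + 2 * K + 12) := by
    rw [hwr, ← pow_add]; congr 1; ring
  have hA0r : l ^ ((K + 8) * C + 2 * K + 12) ≤ A0 := by
    have : ((ell N ^ ((K + 8) * C + 2 * K + 12) : ℕ) : ℝ) ≤ A0 := by exact_mod_cast hA0
    simpa using this
  have hA1r : A1 * l ^ ((K + 8) * C + 2 * K + 12) ≤ N := by
    have : ((A1 * ell N ^ ((K + 8) * C + 2 * K + 12) : ℕ) : ℝ) ≤ N := by exact_mod_cast hA1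
    simpa using this
  have hwC1 : w ≤ ell N ^ ((K + 8) * C + 2 * K + 12) := by
    rw [hw]; refine pow_le_pow_right₀ hln ?_
    omega
  clear_value l D w κ H
  have hblock := block Ψ 1 κ zero_le_one hκ0 hΨ1 X Y N w A0 A1 hXY hYN hw0 (hwC1.trans hA0)
    ((Nat.mul_le_mul_left _ hwC1).trans hA1) ?_ hA01
  · refine hblock.trans ?_
    have hlog : Real.log (A1 / A0) ≤ l := by
      have hA0p : (1:ℝ) ≤ A0 := le_trans (one_le_pow₀ hl1) hA0r
      have hA1p : (1:ℝ) ≤ A1 := hA0p.trans (by exact_mod_cast hA01)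
      refine le_trans (Real.log_le_log (by positivity) ?_) (by rw [hl']; exact log_le_ell N)
      calc (A1:ℝ) / A0 ≤ A1 := div_le_self (by linarith) hA0p
        _ ≤ A1 * l ^ ((K + 8) * C + 2 * K + 12) := le_mul_of_one_le_right (by linarith) (one_le_pow₀ hl1)
        _ ≤ N := hA1r
    have h1 : (1 + 4 * w * Real.log (A1 / A0)) ≤ 8 * w * l := by
      have hw1 : (1:ℝ) ≤ w := by exact_mod_cast hw0
      have : (4 * w * Real.log (A1 / A0) : ℝ) ≤ 4 * w * l := by gcongr
      have := one_le_mul_of_one_le_of_one_le hw1 hl1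
      linarith
    have h2 : κ ≤ 2 * H * l ^ K / (l ^ (K + 8) * l ^ (K + 8)) := by
      rw [hκ, hwr, ← hD]
      gcongr ?_ / _
      have := mul_le_mul_of_nonneg_left hqK hHp.le
      linarith
    have h3 : 4 * 1 * N / (w:ℝ) ^ 2 ≤ 4 * H * l ^ K / (l ^ (K + 8) * l ^ (K + 8)) := by
      rw [hwr, hD, ← sq]
      gcongr ?_ / _
      linarith
    have h4 : κ + 4 * 1 * N / (w:ℝ) ^ 2 ≤ 6 * H * l ^ K / (l ^ (K + 8) * l ^ (K + 8)) := by
      refine (add_le_add h2 h3).trans (le_of_eq ?_)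
      ring
    calc _ ≤ 6 * H * l ^ K / (l ^ (K + 8) * l ^ (K + 8)) * (8 * w * l) := by
          apply mul_le_mul h4 h1 _ (by positivity)
          have : 0 ≤ Real.log (A1 / A0) := by
            apply Real.log_nonneg
            have hA0p : (0:ℝ) < A0 := lt_of_lt_of_le (by positivity) hA0r
            rw [le_div_iff₀ hA0p, one_mul]
            exact_mod_cast hA01
          positivity
      _ = 48 * H / l ^ 7 := by
          rw [hwr, hD]; exact arith1 H l K hl0
      _ ≤ H / l ^ 5 := arith4 H l hl hHp
  · intro A A' hAA0 hAA' hA'A1 hA'w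
    have hA0' : (0:ℝ) < A := lt_of_lt_of_le (by positivity) (hA0r.trans (by exact_mod_cast hAA0))
    have hApos : 0 < A := by exact_mod_cast hA0'
    set P := A / w with hP
    set B := Y / A - X / A with hB
    have hBXY : X / A ≤ Y / A := Nat.div_le_div_right hXY
    have hcB : X / A + B = Y / A := by omega
    -- bounds for P and B
    have hPu : (P:ℝ) ≤ A / w := Nat.cast_div_le
    have hPl : (A:ℝ) / w ≤ P + 1 := (Nat.lt_floor_add_one _).le.trans (by rw [Nat.floor_div_eq_div])
    have hYl : (Y:ℝ) / A ≤ (Y / A : ℕ) + 1 := (Nat.lt_floor_add_one _).le.trans (by rw [Nat.floor_div_eq_div])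
    have hXl : (X:ℝ) / A ≤ (X / A : ℕ) + 1 := (Nat.lt_floor_add_one _).le.trans (by rw [Nat.floor_div_eq_div])
    have hYu : ((Y / A : ℕ):ℝ) ≤ Y / A := Nat.cast_div_le
    have hXu : ((X / A : ℕ):ℝ) ≤ X / A := Nat.cast_div_le
    have hBr : (B:ℝ) = ((Y / A : ℕ):ℝ) - ((X / A : ℕ):ℝ) := by rw [hB, Nat.cast_sub hBXY]
    have hHA : H / A = Y / A - X / A := by rw [hHdef, sub_div]
    have hAw : l ^ ((K + 8) * C + K + 4) ≤ A / w := by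
      rw [le_div_iff₀ hw0r, hC1w]
      exact hA0r.trans (by exact_mod_cast hAA0)
    have hHA2 : l ^ ((K + 8) * C + K + 4) ≤ H / A := by
      rw [le_div_iff₀ hA0']
      have h1 : (A:ℝ) ≤ A1 := by exact_mod_cast (hAA'.le.trans hA'A1)
      have h2 : l ^ ((K + 8) * C + K + 4) * A * l ^ K ≤ H * l ^ K := by
        calc _ = l ^ ((K + 8) * C + 2 * K + 4) * A := by ring
          _ ≤ l ^ ((K + 8) * C + 2 * K + 12) * A1 := by
              gcongr
              norm_num
          _ ≤ N := by rw [mul_comm]; exact hA1r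
          _ ≤ _ := hH
      exact le_of_mul_le_mul_right h2 (by positivity)
    have hbig : 2 * l ^ ((K + 8) * C) ≤ l ^ ((K + 8) * C + K + 4) ∧ (2:ℝ) ≤ l ^ ((K + 8) * C + K + 4) := by
      have e1 : l ^ ((K + 8) * C + K + 4) = l ^ ((K + 8) * C) * l ^ (K + 4) := by ring
      have e2 : (2:ℝ) ≤ l ^ (K + 4) := by
        calc (2:ℝ) ≤ l ^ 1 := by rw [pow_one]; linarith
          _ ≤ _ := pow_le_pow_right₀ hl1 (by omega)
      have e3 : 1 ≤ l ^ ((K + 8) * C) := one_le_pow₀ hl1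
      rw [e1]
      exact two_mul_le _ _ e3 e2
    have hPhalf : (A:ℝ) / w / 2 ≤ P := by linarith [hbig.2]
    have hBhalf : H / A / 2 ≤ B := by rw [hBr]; linarith [hbig.2]
    have hB2 : (B:ℝ) ≤ 2 * (H / A) := by rw [hBr]; linarith [hbig.2]
    have hDC : D ^ C = l ^ ((K + 8) * C) := by rw [hD, ← pow_mul]
    have hDP : D ^ C ≤ P := by rw [hDC]; linarith [hbig.1]
    have hDB : D ^ C ≤ B := by rw [hDC]; linarith [hbig.1]
    -- each residue
    have each : ∀ s : ℕ, ∑ a ∈ Finset.Ioc A A', ‖∑ b ∈ Finset.Ioc (X / A) (Y / A),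
        y b * ρ (s * b) * e (g ((a * b : ℕ) : ℤ))‖ ≤ P * B / D := by
      intro s
      by_contra hcon
      push Not at hcon
      have hc1 : ∑ a ∈ Finset.Ioc A A', ‖∑ b ∈ Finset.Ioc (X / A) (Y / A),
          y b * ρ (s * b) * e (g ((a * b : ℕ) : ℤ))‖ = ∑ a ∈ Finset.Ioc (A:ℤ) (A':ℤ),
          ‖∑ b ∈ Finset.Ioc ((X / A : ℕ):ℤ) ((X / A : ℕ) + B), (y b.toNat * ρ (s * b.toNat)) *
            e (g (a * b))‖ := by
        have : (((X / A : ℕ):ℤ) + B) = ((Y / A : ℕ) : ℤ) := by rw [← hcB]; push_cast; ring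
        rw [this, ← sum_Ioc_cast]
        apply Finset.sum_congr rfl
        intro a _
        rw [← sum_Ioc_cast]
        simp
      rw [hc1] at hcon
      have w1 : ∀ a : ℤ, IsPoly (j + 1) (θ * (a:ℝ) ^ (j + 1)) (fun b => g (a * b)) := fun a =>
        (hg.comp a 0).congr (by ring) (fun n => by simp)
      have w2 : (A':ℤ) - A ≤ P := by rw [hP]; omega
      have w3 : ∀ b : ℤ, ‖y b.toNat * ρ (s * b.toNat)‖ ≤ 1 := by
        intro b
        rw [norm_mul]
        exact mul_le_one₀ (hy _) (norm_nonneg _) (hρ1 _)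
      obtain ⟨q1, a1, a2, a3⟩ := hC D P B θ (fun a b => g (a * b)) A A' (X / A : ℕ)
        (fun b => y b.toNat * ρ (s * b.toNat)) hD2 w1 w2 w3 hcon.le hDP hDB
      apply hM
      refine ⟨q1, a1, ?_, ?_⟩
      · refine a2.trans ?_
        rw [hDC]
        exact pow_le_pow_right₀ hl1 (Nat.le_add_right _ _)
      · refine a3.mono ?_
        have hPB : N / l ^ (2 * K + 10) ≤ P * B := by
          calc N / l ^ (2 * K + 10) ≤ H * l ^ K / l ^ (2 * K + 10) := by gcongr
            _ = H / l ^ (K + 8) / l ^ 2 := arith2 H l K hl0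
            _ ≤ H / l ^ (K + 8) / 4 := by
              gcongr
              exact four_le_sq l hl
            _ = (A / w / 2) * (H / A / 2) := by rw [hwr, hD]; field_simp; ring
            _ ≤ P * B := by gcongr
        exact arith3 l N (P * B) D (K + 8) C (2 * K + 10) j hl0 hNr hDC hPB P B rfl
    have hPBle : (P:ℝ) * B ≤ 2 * H / w := by
      calc (P:ℝ) * B ≤ (A / w) * (2 * (H / A)) := by gcongr
        _ = 2 * H / w := by field_simp
    calc _ ≤ ∑ a ∈ Finset.Ioc A A', ‖∑ b ∈ Finset.Ioc (X / A) (Y / A), Ψ a b‖ := norm_sum_le _ _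
      _ ≤ ∑ a ∈ Finset.Ioc A A', ‖∑ b ∈ Finset.Ioc (X / A) (Y / A), y b * ρ (a % q * b) * e (g ((a * b : ℕ) : ℤ))‖ := by
          apply Finset.sum_le_sum
          intro a _
          have : ∑ b ∈ Finset.Ioc (X / A) (Y / A), Ψ a b = x a * ∑ b ∈ Finset.Ioc (X / A) (Y / A), y b * ρ (a % q * b) * e (g ((a * b : ℕ) : ℤ)) := by
            rw [Finset.mul_sum]
            apply Finset.sum_congr rfl
            intro b _
            rw [hρ (a % q * b) (a * b) (Nat.ModEq.mul_right b (Nat.mod_modEq a q)), hΨ]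
            ring
          rw [this, norm_mul]
          exact mul_le_of_le_one_left (norm_nonneg _) (hx a)
      _ ≤ ∑ a ∈ Finset.Ioc A A', ∑ s ∈ Finset.range q, ‖∑ b ∈ Finset.Ioc (X / A) (Y / A), y b * ρ (s * b) * e (g ((a * b : ℕ) : ℤ))‖ := by
          apply Finset.sum_le_sum
          intro a _
          exact Finset.single_le_sum (f := fun s => ‖∑ b ∈ Finset.Ioc (X / A) (Y / A), y b * ρ (s * b) * e (g ((a * b : ℕ) : ℤ))‖)
            (fun s _ => norm_nonneg _) (Finset.mem_range.2 (Nat.mod_lt a hq))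
      _ = ∑ s ∈ Finset.range q, ∑ a ∈ Finset.Ioc A A', ‖∑ b ∈ Finset.Ioc (X / A) (Y / A), y b * ρ (s * b) * e (g ((a * b : ℕ) : ℤ))‖ :=
          Finset.sum_comm
      _ ≤ ∑ s ∈ Finset.range q, (P * B / D : ℝ) := Finset.sum_le_sum (fun s _ => each s)
      _ = q * (P * B / D) := by rw [Finset.sum_const, Finset.card_range, nsmul_eq_mul]
      _ ≤ q * ((2 * H / w) / D) := by gcongr
      _ = κ := by rw [hκ]; field_simp

end UDP

namespace UDP
open ArithmeticFunction

lemma ev_div (P : ℕ → Prop) (E : ℕ) (h : ∀ᶠ M in atTop, P M) :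
    ∀ᶠ N : ℕ in atTop, ∀ a : ℕ, N ≤ (N / a) ^ E → P (N / a) := by
  obtain ⟨M0, hM0⟩ := eventually_atTop.1 h
  filter_upwards [eventually_gt_atTop (M0 ^ E)] with N hN a ha
  apply hM0
  by_contra hc
  push Not at hc
  have : (N / a) ^ E ≤ M0 ^ E := Nat.pow_le_pow_left hc.le E
  omega

lemma div_bounds (X Y a : ℕ) (ha : 0 < a) :
    ((Y:ℝ) - X) / a - 1 ≤ ((Y / a : ℕ):ℝ) - ((X / a : ℕ):ℝ) ∧
    ((Y / a : ℕ):ℝ) - ((X / a : ℕ):ℝ) ≤ ((Y:ℝ) - X) / a + 1 := by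
  have hYl : (Y:ℝ) / a ≤ (Y / a : ℕ) + 1 := (Nat.lt_floor_add_one _).le.trans (by rw [Nat.floor_div_eq_div])
  have hXl : (X:ℝ) / a ≤ (X / a : ℕ) + 1 := (Nat.lt_floor_add_one _).le.trans (by rw [Nat.floor_div_eq_div])
  have hYu : ((Y / a : ℕ):ℝ) ≤ Y / a := Nat.cast_div_le
  have hXu : ((X / a : ℕ):ℝ) ≤ X / a := Nat.cast_div_le
  rw [sub_div]
  constructor <;> linarith

lemma inner_brun (K E : ℕ) : ∀ᶠ N : ℕ in atTop, ∀ a q r X Y : ℕ, 0 < a → N ≤ (N / a) ^ E →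
    0 < q → (q:ℝ) ≤ (ell N : ℝ) ^ K → Nat.Coprime r q → X ≤ Y → Y ≤ N →
    (N:ℝ) ≤ ((Y:ℝ) - X) * (ell N : ℝ) ^ K →
    ∑ n ∈ (Finset.Ioc (X / a) (Y / a)).filter (fun n => n ≡ r [MOD q]), Λ n ≤
      124 * (((Y:ℝ) - X) / a) / Nat.totient q := by
  have hev : ∀ᶠ M : ℕ in atTop, ((E:ℝ) + 1 ≤ (ell M : ℝ)) ∧ (2 ≤ (ell M : ℝ)) ∧
      (2 * (ell M : ℝ) ^ (2 * K) ≤ M) ∧ 0 < M ∧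
      (∀ q r X Y : ℕ, 0 < q → (q:ℝ) ≤ (ell M : ℝ) ^ (2 * K + 1) →
    Nat.Coprime r q → X ≤ Y → Y ≤ M → (M:ℝ) ≤ ((Y:ℝ) - X) * (ell M : ℝ) ^ (2 * K + 1) →
    ∑ n ∈ (Finset.Ioc X Y).filter (fun n => n ≡ r [MOD q]), Λ n ≤
      62 * ((Y:ℝ) - X) / Nat.totient q) := by
    filter_upwards [ev_ell_ge ((E:ℝ) + 1), ev_ell_ge 2, ev_ell_pow (2 * K) 2, eventually_gt_atTop 0,
      brunT (2 * K + 1)] with M h1 h2 h3 h4 h5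
    exact ⟨h1, h2, h3, h4, h5⟩
  filter_upwards [ev_div _ E hev, eventually_gt_atTop 0] with N hN hN0
  intro a q r X Y ha hE hq hqK hr hXY hYN hH
  obtain ⟨h1, h2, h3, hM0, hb⟩ := hN a hE
  have hMN : ((N / a : ℕ) : ℝ) ≤ N / a := Nat.cast_div_le
  have hYM : Y / a ≤ N / a := Nat.div_le_div_right hYN
  generalize N / a = M at *
  have ha' : (0:ℝ) < a := by exact_mod_cast ha
  have hNr : (0:ℝ) < N := by exact_mod_cast hN0
  have hMr : (0:ℝ) < M := by exact_mod_cast hM0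
  have hell : (ell N : ℝ) ≤ (ell M : ℝ) ^ 2 := by
    have e1 : Real.log N ≤ E * Real.log M := by
      rw [← Real.log_pow]
      exact Real.log_le_log hNr (by exact_mod_cast hE)
    have e2 : (E:ℝ) * Real.log M ≤ E * ell M := by gcongr; exact log_le_ell M
    have e3 := ell_le N
    nlinarith
  have hellK : (ell N : ℝ) ^ K ≤ (ell M : ℝ) ^ (2 * K) := by
    rw [pow_mul]; gcongr
  have hellK1 : 2 * (ell M : ℝ) ^ (2 * K) ≤ (ell M : ℝ) ^ (2 * K + 1) := by
    rw [pow_succ, mul_comm]; gcongr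
  have hlp : 0 < (ell M : ℝ) ^ (2 * K) := by positivity
  set H := (Y:ℝ) - X with hHd
  have hH0 : 0 ≤ H := by rw [hHd]; have : (X:ℝ) ≤ Y := by exact_mod_cast hXY
                         linarith
  have hHa : (M:ℝ) ≤ H / a * (ell M : ℝ) ^ (2 * K) := by
    calc (M:ℝ) ≤ N / a := hMN
      _ ≤ H * (ell N : ℝ) ^ K / a := by gcongr
      _ ≤ H * (ell M : ℝ) ^ (2 * K) / a := by gcongr
      _ = _ := by ring
  have hHa2 : 2 ≤ H / a := by
    have : 2 * (ell M : ℝ) ^ (2 * K) ≤ H / a * (ell M : ℝ) ^ (2 * K) := h3.trans hHa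
    exact le_of_mul_le_mul_right this hlp
  obtain ⟨d1, d2⟩ := div_bounds X Y a ha
  rw [← hHd] at d1 d2
  have := hb q r (X / a) (Y / a) hq (hqK.trans (hellK.trans (by linarith))) hr
    (Nat.div_le_div_right hXY) hYM ?_
  · refine this.trans ?_
    gcongr ?_ / _
    linarith
  · calc (M:ℝ) ≤ H / a * (ell M : ℝ) ^ (2 * K) := hHa
      _ ≤ (2 * (((Y / a : ℕ):ℝ) - ((X / a : ℕ):ℝ))) * (ell M : ℝ) ^ (2 * K) := by
          gcongr; linarith
      _ = (((Y / a : ℕ):ℝ) - ((X / a : ℕ):ℝ)) * (2 * (ell M : ℝ) ^ (2 * K)) := by ring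
      _ ≤ _ := by
          apply mul_le_mul_of_nonneg_left hellK1
          linarith

lemma swap_le (f : ℕ → ℕ → ℝ) (hf : ∀ a b, 0 ≤ f a b) (X Y N A1 : ℕ) (hA1 : 0 < A1) (hY : Y ≤ N) :
    ∑ a ∈ Finset.Ioc A1 N, ∑ b ∈ Finset.Ioc (X / a) (Y / a), f a b ≤
      ∑ b ∈ Finset.Ioc 0 (N / A1), ∑ a ∈ Finset.Ioc (X / b) (Y / b), f a b := by
  rw [Finset.sum_comm' (t' := Finset.Ioc 0 (N / A1))
    (s' := fun b => (Finset.Ioc (X / b) (Y / b)).filter (fun a => A1 < a))]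
  · apply Finset.sum_le_sum
    intro b _
    exact Finset.sum_le_sum_of_subset_of_nonneg (Finset.filter_subset _ _) (fun a _ _ => hf a b)
  · intro a b
    simp only [Finset.mem_Ioc, Finset.mem_filter]
    constructor
    · rintro ⟨⟨h1, h2⟩, h3, h4⟩
      have ha : 0 < a := by omega
      have hb : 0 < b := lt_of_le_of_lt (Nat.zero_le _) h3
      rw [Nat.div_lt_iff_lt_mul ha] at h3
      rw [Nat.le_div_iff_mul_le ha] at h4
      rw [Nat.div_lt_iff_lt_mul hb, Nat.le_div_iff_mul_le hb, Nat.le_div_iff_mul_le hA1]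
      refine ⟨⟨⟨by linarith, by linarith⟩, h1⟩, hb, ?_⟩
      calc b * A1 ≤ b * a := Nat.mul_le_mul_left _ h1.le
        _ ≤ N := h4.trans hY
    · rintro ⟨⟨⟨h1, h2⟩, h3⟩, hb, h5⟩
      have ha : 0 < a := by omega
      rw [Nat.div_lt_iff_lt_mul hb] at h1
      rw [Nat.le_div_iff_mul_le hb] at h2
      rw [Nat.div_lt_iff_lt_mul ha, Nat.le_div_iff_mul_le ha]
      refine ⟨⟨h3, ?_⟩, by linarith, by linarith⟩
      exact (Nat.le_mul_of_pos_right a hb).trans (h2.trans hY)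

lemma pow_div_mono (N E a A0 : ℕ) (ha : 0 < a) (h : a ≤ A0) (hN : N ≤ (N / A0) ^ E) :
    N ≤ (N / a) ^ E :=
  hN.trans (Nat.pow_le_pow_left (Nat.div_le_div_left h ha) E)

lemma edge (K E : ℕ) : ∀ᶠ N : ℕ in atTop, ∀ A0 X Y : ℕ, 0 < A0 → N ≤ (N / A0) ^ E →
    X ≤ Y → Y ≤ N → (N:ℝ) ≤ ((Y:ℝ) - X) * (ell N : ℝ) ^ K →
    ∑ a ∈ Finset.Ioc 0 A0, ∑ b ∈ Finset.Ioc (X / a) (Y / a), Λ a * Λ b ≤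
      124 * ((Y:ℝ) - X) * (Real.log A0 + 6) := by
  filter_upwards [inner_brun K E, ev_ell_ge 1] with N hN hl
  intro A0 X Y hA0 hE hXY hYN hH
  have hH0 : (0:ℝ) ≤ (Y:ℝ) - X := by
    have : (X:ℝ) ≤ Y := by exact_mod_cast hXY
    linarith
  calc _ ≤ ∑ a ∈ Finset.Ioc 0 A0, (124 * ((Y:ℝ) - X)) * (Λ a / a) := by
        apply Finset.sum_le_sum
        intro a ha
        rw [Finset.mem_Ioc] at ha
        rw [← Finset.mul_sum]
        have := hN a 1 0 X Y ha.1 (pow_div_mono N E a A0 ha.1 ha.2 hE) one_pos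
          (by simpa using one_le_pow₀ hl) (by simp) hXY hYN hH
        rw [Finset.filter_true_of_mem (fun n _ => Nat.modEq_one)] at this
        simp only [Nat.totient_one, Nat.cast_one, div_one] at this
        calc Λ a * ∑ b ∈ Finset.Ioc (X / a) (Y / a), Λ b ≤ Λ a * (124 * (((Y:ℝ) - X) / a)) :=
              mul_le_mul_of_nonneg_left this vonMangoldt_nonneg
          _ = _ := by ring
    _ = (124 * ((Y:ℝ) - X)) * ∑ a ∈ Finset.Ioc 0 A0, Λ a / a := by rw [Finset.mul_sum]
    _ ≤ _ := mul_le_mul_of_nonneg_left (mertens A0 hA0) (by positivity)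

lemma norm_dsum_le (f : ℕ → ℕ → ℂ) (g : ℕ → ℕ → ℝ) (h : ∀ a b, ‖f a b‖ ≤ g a b) (s : Finset ℕ)
    (t : ℕ → Finset ℕ) : ‖∑ a ∈ s, ∑ b ∈ t a, f a b‖ ≤ ∑ a ∈ s, ∑ b ∈ t a, g a b :=
  (norm_sum_le _ _).trans (Finset.sum_le_sum fun a _ => (norm_sum_le _ _).trans
    (Finset.sum_le_sum fun b _ => h a b))

lemma VV_split (K E : ℕ) : ∀ᶠ N : ℕ in atTop, ∀ (A0 A1 X Y : ℕ) (G : ℕ → ℂ), 0 < A0 → A0 ≤ A1 →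
    A1 ≤ N → N ≤ (N / A0) ^ E → N ≤ (N / (N / A1)) ^ E →
    X ≤ Y → Y ≤ N → (N:ℝ) ≤ ((Y:ℝ) - X) * (ell N : ℝ) ^ K → (∀ n, ‖G n‖ ≤ 1) →
    ‖∑ n ∈ Finset.Ioc X Y, (VV n : ℂ) * G n‖ ≤
      ‖∑ a ∈ Finset.Ioc A0 A1, ∑ b ∈ Finset.Ioc (X / a) (Y / a), (Λ a : ℂ) * Λ b * G (a * b)‖ +
      124 * ((Y:ℝ) - X) * (Real.log A0 + 6) + 124 * ((Y:ℝ) - X) * (Real.log (N / A1 : ℕ) + 6) := by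
  filter_upwards [edge K E] with N hN
  intro A0 A1 X Y G hA0 hA01 hA1N hE0 hE1 hXY hYN hH hG
  rw [sum_VV_mul G X Y N hYN, ← Finset.sum_Ioc_consecutive _ (Nat.zero_le A0) (hA01.trans hA1N),
    ← Finset.sum_Ioc_consecutive _ hA01 hA1N]
  have hb : ∀ a b : ℕ, ‖(Λ a : ℂ) * Λ b * G (a * b)‖ ≤ Λ a * Λ b := by
    intro a b
    rw [norm_mul, norm_mul, Complex.norm_real, Complex.norm_real, Real.norm_of_nonneg vonMangoldt_nonneg,
      Real.norm_of_nonneg vonMangoldt_nonneg]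
    exact mul_le_of_le_one_right (mul_nonneg vonMangoldt_nonneg vonMangoldt_nonneg) (hG _)
  have h1 := (norm_dsum_le _ _ hb (Finset.Ioc 0 A0) (fun a => Finset.Ioc (X / a) (Y / a))).trans
    (hN A0 X Y hA0 hE0 hXY hYN hH)
  have h2 := (norm_dsum_le _ _ hb (Finset.Ioc A1 N) (fun a => Finset.Ioc (X / a) (Y / a))).trans
    (swap_le _ (fun a b => mul_nonneg vonMangoldt_nonneg vonMangoldt_nonneg) X Y N A1 (by omega) hYN)
  have h3 : 0 < N / A1 := Nat.div_pos hA1N (by omega)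
  have h4 := hN (N / A1) X Y h3 hE1 hXY hYN hH
  have h4' : ∑ b ∈ Finset.Ioc 0 (N / A1), ∑ a ∈ Finset.Ioc (X / b) (Y / b), Λ a * Λ b ≤ 
      124 * ((Y:ℝ) - X) * (Real.log (N / A1 : ℕ) + 6) := by
    refine le_trans (le_of_eq ?_) h4
    apply Finset.sum_congr rfl; intro b _; apply Finset.sum_congr rfl; intro a _; ring
  have h5 := norm_add_le (∑ a ∈ Finset.Ioc 0 A0, ∑ b ∈ Finset.Ioc (X / a) (Y / a), (Λ a : ℂ) * Λ b * G (a * b))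
    (∑ a ∈ Finset.Ioc A0 A1, ∑ b ∈ Finset.Ioc (X / a) (Y / a), (Λ a : ℂ) * Λ b * G (a * b) +
      ∑ a ∈ Finset.Ioc A1 N, ∑ b ∈ Finset.Ioc (X / a) (Y / a), (Λ a : ℂ) * Λ b * G (a * b))
  have h6 := norm_add_le (∑ a ∈ Finset.Ioc A0 A1, ∑ b ∈ Finset.Ioc (X / a) (Y / a), (Λ a : ℂ) * Λ b * G (a * b))
      (∑ a ∈ Finset.Ioc A1 N, ∑ b ∈ Finset.Ioc (X / a) (Y / a), (Λ a : ℂ) * Λ b * G (a * b))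
  linarith

lemma from_selberg (K : ℕ) (ε0 : ℝ) (hε0 : 0 < ε0) : ∀ᶠ N : ℕ in atTop, ∀ (X Y : ℕ) (G : ℕ → ℂ),
    X ≤ Y → Y ≤ N → ε0 * N ≤ X → (N:ℝ) ≤ ((Y:ℝ) - X) * (ell N : ℝ) ^ K → (∀ n, ‖G n‖ ≤ 1) →
    Real.log N * ‖∑ n ∈ Finset.Ioc X Y, (Λ n : ℂ) * G n‖ ≤
      ‖∑ n ∈ Finset.Ioc X Y, (LL (Real.log N) n : ℂ) * G n‖ +
      ‖∑ n ∈ Finset.Ioc X Y, (VV n : ℂ) * G n‖ + |Real.log ε0| * (62 * ((Y:ℝ) - X)) := by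
  filter_upwards [brunT K, ev_ell_ge 1, eventually_gt_atTop 0] with N hN hl hN0
  intro X Y G hXY hYN hε hH hG
  have hNr : (0:ℝ) < N := by exact_mod_cast hN0
  have hX0 : (0:ℝ) < X := lt_of_lt_of_le (by positivity) hε
  have hX : 0 < X := by exact_mod_cast hX0
  have hid : (Real.log N : ℂ) * ∑ n ∈ Finset.Ioc X Y, (Λ n : ℂ) * G n =
      ∑ n ∈ Finset.Ioc X Y, (LL (Real.log N) n : ℂ) * G n - ∑ n ∈ Finset.Ioc X Y, (VV n : ℂ) * G n
      - ∑ n ∈ Finset.Ioc X Y, (((Real.log N - Real.log n) * Λ n : ℝ) : ℂ) * G n := by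
    rw [Finset.mul_sum, ← Finset.sum_sub_distrib, ← Finset.sum_sub_distrib]
    apply Finset.sum_congr rfl
    intro n hn
    rw [Finset.mem_Ioc] at hn
    have := selberg (Real.log N) n
    rw [if_neg (by omega)] at this
    rw [this]
    push_cast
    ring
  have h3 : ‖∑ n ∈ Finset.Ioc X Y, (((Real.log N - Real.log n) * Λ n : ℝ) : ℂ) * G n‖ ≤
      |Real.log ε0| * (62 * ((Y:ℝ) - X)) := by
    have hb := hN 1 0 X Y one_pos (by simpa using one_le_pow₀ hl) (by simp) hXY hYN hH
    rw [Finset.filter_true_of_mem (fun n _ => Nat.modEq_one)] at hb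
    simp only [Nat.totient_one, Nat.cast_one, div_one] at hb
    calc _ ≤ ∑ n ∈ Finset.Ioc X Y, |Real.log ε0| * Λ n := by
          refine (norm_sum_le _ _).trans (Finset.sum_le_sum ?_)
          intro n hn
          rw [Finset.mem_Ioc] at hn
          have hn0 : (0:ℝ) < n := by exact_mod_cast (by omega : 0 < n)
          have e1 : Real.log n ≤ Real.log N := Real.log_le_log hn0 (by exact_mod_cast hn.2.trans hYN)
          have e2 : Real.log N + Real.log ε0 ≤ Real.log n := by
            rw [← Real.log_mul hNr.ne' hε0.ne']
            apply Real.log_le_log (by positivity)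
            have : (X:ℝ) ≤ n := by exact_mod_cast hn.1.le
            linarith
          rw [norm_mul, Complex.norm_real, Real.norm_eq_abs, abs_mul, abs_of_nonneg (vonMangoldt_nonneg (n := n)),
            abs_of_nonneg (by linarith)]
          have e3 : Real.log N - Real.log n ≤ |Real.log ε0| := by
            have := neg_abs_le (Real.log ε0)
            linarith
          calc _ ≤ (Real.log N - Real.log n) * Λ n * 1 := by
                apply mul_le_mul_of_nonneg_left (hG n)
                exact mul_nonneg (by linarith) vonMangoldt_nonneg
            _ ≤ _ := by
                rw [mul_one]
                exact mul_le_mul_of_nonneg_right e3 vonMangoldt_nonneg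
      _ = |Real.log ε0| * ∑ n ∈ Finset.Ioc X Y, Λ n := by rw [Finset.mul_sum]
      _ ≤ _ := mul_le_mul_of_nonneg_left hb (abs_nonneg _)
  have h4 : Real.log N * ‖∑ n ∈ Finset.Ioc X Y, (Λ n : ℂ) * G n‖ =
      ‖(Real.log N : ℂ) * ∑ n ∈ Finset.Ioc X Y, (Λ n : ℂ) * G n‖ := by
    rw [norm_mul, Complex.norm_real, Real.norm_of_nonneg (Real.log_natCast_nonneg N)]
  rw [h4, hid]
  have h5 := norm_sub_le (∑ n ∈ Finset.Ioc X Y, (LL (Real.log N) n : ℂ) * G n - ∑ n ∈ Finset.Ioc X Y, (VV n : ℂ) * G n)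
    (∑ n ∈ Finset.Ioc X Y, (((Real.log N - Real.log n) * Λ n : ℝ) : ℂ) * G n)
  have h6 := norm_sub_le (∑ n ∈ Finset.Ioc X Y, (LL (Real.log N) n : ℂ) * G n) (∑ n ∈ Finset.Ioc X Y, (VV n : ℂ) * G n)
  linarith

/-- tail of the LL sum -/
lemma LL_tail (X Y N A1 : ℕ) (G : ℕ → ℂ) (hA1 : 0 < A1) (hA1N : A1 ≤ N) (hXY : X ≤ Y) (hYN : Y ≤ N)
    (hG : ∀ n, ‖G n‖ ≤ 1) :
    ‖∑ a ∈ Finset.Ioc A1 N, ∑ b ∈ Finset.Ioc (X / a) (Y / a),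
        ((muR a * (Real.log N - Real.log a) ^ 2 : ℝ) : ℂ) * G (a * b)‖ ≤
      (Real.log (N / A1)) ^ 2 * (((Y:ℝ) - X) * (1 + Real.log (N / A1)) + N / A1) := by
  have hA1r : (0:ℝ) < A1 := by exact_mod_cast hA1
  have hNr : (0:ℝ) < N := lt_of_lt_of_le hA1r (by exact_mod_cast hA1N)
  have hH0 : (0:ℝ) ≤ (Y:ℝ) - X := by
    have : (X:ℝ) ≤ Y := by exact_mod_cast hXY
    linarith
  calc _ ≤ ∑ a ∈ Finset.Ioc A1 N, ∑ b ∈ Finset.Ioc (X / a) (Y / a), (Real.log (N / A1)) ^ 2 * 1 := by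
        refine (norm_sum_le _ _).trans (Finset.sum_le_sum ?_)
        intro a ha
        rw [Finset.mem_Ioc] at ha
        refine (norm_sum_le _ _).trans (Finset.sum_le_sum ?_)
        intro b _
        have ha0 : (A1:ℝ) ≤ a := by exact_mod_cast ha.1.le
        have haN : (a:ℝ) ≤ N := by exact_mod_cast ha.2
        have e1 : Real.log a ≤ Real.log N := Real.log_le_log (by linarith) haN
        have e2 : Real.log A1 ≤ Real.log a := Real.log_le_log hA1r ha0
        rw [norm_mul, Complex.norm_real, Real.norm_eq_abs, abs_mul, abs_of_nonneg (sq_nonneg (Real.log N - Real.log a))]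
        apply mul_le_mul _ (hG _) (norm_nonneg _) (sq_nonneg _)
        calc _ ≤ 1 * (Real.log N - Real.log a) ^ 2 :=
              mul_le_mul_of_nonneg_right (abs_muR_le a) (sq_nonneg _)
          _ ≤ _ := by
              rw [one_mul, Real.log_div hNr.ne' hA1r.ne']
              apply pow_le_pow_left₀ (by linarith)
              linarith
    _ = (Real.log (N / A1)) ^ 2 * ∑ a ∈ Finset.Ioc A1 N, ∑ b ∈ Finset.Ioc (X / a) (Y / a), 1 := by
        simp_rw [Finset.mul_sum]
    _ ≤ _ := by
        apply mul_le_mul_of_nonneg_left _ (sq_nonneg _)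
        refine (swap_le (fun _ _ => 1) (fun _ _ => zero_le_one) X Y N A1 hA1 hYN).trans ?_
        have h1 : ∀ b ∈ Finset.Ioc 0 (N / A1), ∑ a ∈ Finset.Ioc (X / b) (Y / b), (1:ℝ) ≤ ((Y:ℝ) - X) * (1 / b) + 1 := by
          intro b hb
          rw [Finset.mem_Ioc] at hb
          have := (div_bounds X Y b hb.1).2
          rw [Finset.sum_const, Nat.card_Ioc, nsmul_eq_mul, mul_one, Nat.cast_sub (Nat.div_le_div_right hXY)]
          refine this.trans (le_of_eq ?_)
          ring
        refine (Finset.sum_le_sum h1).trans ?_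
        rw [Finset.sum_add_distrib, ← Finset.mul_sum, Finset.sum_const, Nat.card_Ioc, nsmul_eq_mul]
        have h2 : ((N / A1 : ℕ):ℝ) ≤ N / A1 := Nat.cast_div_le
        have h3 : (0:ℝ) < (N / A1 : ℕ) := by exact_mod_cast Nat.div_pos hA1N hA1
        have h4 := sum_inv_le (N / A1)
        have h5 := Real.log_le_log h3 h2
        apply add_le_add
        · exact mul_le_mul_of_nonneg_left (by linarith) hH0
        · simpa using h2

lemma sq_div_ge (N A : ℕ) (hA : 0 < A) (h : 4 * A * A ≤ N) : N ≤ (N / A) ^ 2 := by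
  have h1 : 2 * A ≤ N := by nlinarith
  have h2 : N < A * (N / A) + A := by
    have := Nat.div_add_mod N A
    have := Nat.mod_lt N hA
    omega
  have h3 : 2 ≤ N / A := (Nat.le_div_iff_mul_le hA).2 h1
  have h4 : N ≤ 2 * (A * (N / A)) := by nlinarith
  have h5 : N * N ≤ (2 * (A * (N / A))) * (2 * (A * (N / A))) := Nat.mul_le_mul h4 h4
  have h6 : (2 * (A * (N / A))) * (2 * (A * (N / A))) = (4 * A * A) * (N / A) ^ 2 := by ring
  rw [h6] at h5
  have h7 : (4 * A * A) * (N / A) ^ 2 ≤ N * (N / A) ^ 2 := Nat.mul_le_mul_right _ h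
  have h8 : 0 < N := by omega
  exact Nat.le_of_mul_le_mul_left (h5.trans h7) h8

set_option maxHeartbeats 1000000 in
theorem minor (j K : ℕ) (ε ε0 : ℝ) (hε : 0 < ε) (hε0 : 0 < ε0) : ∃ B : ℕ, ∀ᶠ N : ℕ in atTop,
    ∀ (θ : ℝ) (g : ℤ → ℝ) (q : ℕ) (ρ : ℕ → ℂ) (X Y : ℕ),
    IsPoly (j + 1) θ g → ¬ Maj ((ell N : ℝ) ^ B) N (j + 1) θ → 0 < q →
    (q:ℝ) ≤ (ell N : ℝ) ^ K → (∀ m n, m ≡ n [MOD q] → ρ m = ρ n) → (∀ n, ‖ρ n‖ ≤ 1) →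
    X ≤ Y → Y ≤ N → ε0 * N ≤ X → (N:ℝ) ≤ ((Y:ℝ) - X) * (ell N : ℝ) ^ K →
    ‖∑ n ∈ Finset.Ioc X Y, (Λ n : ℂ) * (ρ n * e (g (n:ℤ)))‖ ≤ ε * ((Y:ℝ) - X) := by
  obtain ⟨B2, C1, hT2⟩ := T2 j K
  obtain ⟨B1, hT1⟩ := T1 j K (C1 + K + 3)
  refine ⟨max B1 B2, ?_⟩
  set c : ℝ := 2000 + 62 * |Real.log ε0| with hc
  have hc0 : 0 < c := by positivity
  filter_upwards [hT1, hT2, VV_split K 2, from_selberg K ε0 hε0, ev_loglog C1 (ε / c) (by positivity),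
    ev_ell_ge 2, ev_ell_pow (2 * C1) 32, ev_ell_pow (C1 + K) 2, ev_log_ge 1] with N h1 h2 hV hS hlog hl hN1 hN2 hL
  intro θ g q ρ X Y hg hM hq hqK hρ hρ1 hXY hYN hX hH
  set G : ℕ → ℂ := fun n => ρ n * e (g (n:ℤ)) with hG
  have hG1 : ∀ n, ‖G n‖ ≤ 1 := by
    intro n; simp only [hG, norm_mul, norm_e, mul_one]; exact hρ1 n
  set H : ℝ := (Y:ℝ) - X with hHd
  set L := Real.log N with hLd
  have hlL : L ≤ ell N := log_le_ell N
  have hll : (1:ℝ) ≤ ell N := by linarith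
  have hln : 1 ≤ ell N := by exact_mod_cast hll
  have hM1 : ¬ Maj ((ell N : ℝ) ^ B1) N (j + 1) θ := fun h =>
    hM (h.mono (pow_le_pow_right₀ hll (le_max_left _ _)))
  have hM2 : ¬ Maj ((ell N : ℝ) ^ B2) N (j + 1) θ := fun h =>
    hM (h.mono (pow_le_pow_right₀ hll (le_max_right _ _)))
  set A0 : ℕ := ell N ^ C1 with hA0
  have hA0p : 0 < A0 := by positivity
  have hA0r : (A0:ℝ) = (ell N : ℝ) ^ C1 := by rw [hA0]; push_cast; rfl
  have hA032 : 32 * A0 * A0 ≤ N := by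
    have : (32:ℝ) * A0 * A0 ≤ N := by
      rw [hA0r, mul_assoc, ← pow_add]; rw [show C1 + C1 = 2 * C1 by ring]; exact hN1
    exact_mod_cast this
  have hA0N : 2 * A0 ≤ N := by nlinarith
  obtain ⟨f1, f2, f3⟩ := div_ell_pos N A0 hA0p hA0N
  set A1 : ℕ := N / A0 with hA1
  have hA1A0 : A1 * A0 ≤ N := Nat.div_mul_le_self N A0
  have hA01 : A0 ≤ A1 := (Nat.le_div_iff_mul_le hA0p).2 (by nlinarith)
  have hA1r : (0:ℝ) < A1 := by exact_mod_cast f1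
  have hNr : (0:ℝ) < N := lt_of_lt_of_le hA1r (by exact_mod_cast f2)
  have hA0r1 : (1:ℝ) ≤ A0 := by exact_mod_cast hA0p
  have hNA1 : N / A1 ≤ 2 * A0 := by
    have : ((N / A1 : ℕ) : ℝ) ≤ 2 * A0 := le_trans Nat.cast_div_le f3
    exact_mod_cast this
  have hNA1p : 0 < N / A1 := Nat.div_pos f2 f1
  set u : ℝ := 1 + Real.log (2 * (ell N : ℝ) ^ C1) with hu
  have hu1 : 1 ≤ u := by
    rw [hu, ← hA0r]
    have : 0 ≤ Real.log (2 * A0) := Real.log_nonneg (by linarith)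
    linarith
  have hu3 : u ≤ u ^ 3 := by
    calc u = u ^ 1 := (pow_one u).symm
      _ ≤ u ^ 3 := pow_le_pow_right₀ hu1 (by norm_num)
  have hlogA0 : Real.log A0 ≤ u := by
    rw [hu, ← hA0r]
    have := Real.log_le_log (by linarith : (0:ℝ) < A0) (by linarith : (A0:ℝ) ≤ 2 * A0)
    linarith
  have hlogNA1n : Real.log (N / A1 : ℕ) ≤ u := by
    rw [hu, ← hA0r]
    have := Real.log_le_log (by exact_mod_cast hNA1p : (0:ℝ) < (N / A1 : ℕ)) (by exact_mod_cast hNA1 : ((N / A1 : ℕ):ℝ) ≤ 2 * A0)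
    linarith
  have hNA1one : (1:ℝ) ≤ N / A1 := by rw [le_div_iff₀ hA1r, one_mul]; exact_mod_cast f2
  have hlogNA1 : Real.log (N / A1) ≤ u - 1 := by
    rw [hu, ← hA0r]
    have := Real.log_le_log (by linarith) f3
    linarith
  have hlogNA10 : 0 ≤ Real.log (N / A1) := Real.log_nonneg hNA1one
  have hHp : 0 < H := by
    by_contra hcon
    push Not at hcon
    have : H * (ell N : ℝ) ^ K ≤ 0 := mul_nonpos_of_nonpos_of_nonneg hcon (by positivity)
    linarith
  have hA0H : 2 * (A0:ℝ) ≤ H := by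
    have : (2 * (A0:ℝ)) * (ell N : ℝ) ^ K ≤ H * (ell N : ℝ) ^ K := by
      rw [hA0r]
      calc _ = 2 * (ell N : ℝ) ^ (C1 + K) := by ring
        _ ≤ _ := hN2.trans hH
    exact le_of_mul_le_mul_right this (by positivity)
  have hlp : (0:ℝ) < ell N := by linarith
  -- VV
  have hVV : ‖∑ n ∈ Finset.Ioc X Y, (VV n : ℂ) * G n‖ ≤ H + 124 * H * (u + 6) + 124 * H * (u + 6) := by
    refine (hV A0 A1 X Y G hA0p hA01 f2 (sq_div_ge N A0 hA0p (by nlinarith))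
      (sq_div_ge N (N / A1) hNA1p ?_) hXY hYN hH hG1).trans ?_
    · calc 4 * (N / A1) * (N / A1) ≤ 4 * (2 * A0) * (2 * A0) := by gcongr
        _ ≤ N := by linarith
    · apply add_le_add (add_le_add _ _) _
      · have hle : ∀ n, n ≤ N → ‖(Λ n : ℂ) / ell N‖ ≤ 1 := by
          intro n hn
          rw [norm_div, Complex.norm_real, Real.norm_of_nonneg vonMangoldt_nonneg, Complex.norm_natCast,
            div_le_one hlp]
          refine vonMangoldt_le_log.trans ?_
          rcases Nat.eq_zero_or_pos n with h | h
          · rw [h]; simp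
          · exact (Real.log_le_log (by exact_mod_cast h) (by exact_mod_cast hn)).trans hlL
        have := h2 θ g q ρ X Y A0 A1 (fun n => if n ≤ N then (Λ n : ℂ) / ell N else 0)
          (fun n => if n ≤ N then (Λ n : ℂ) / ell N else 0) hg hM2 hq hqK hρ hρ1 hXY hYN hH
          (fun n => by by_cases h : n ≤ N <;> simp only [h, if_true, if_false, hle, norm_zero, zero_le_one])
          (fun n => by by_cases h : n ≤ N <;> simp only [h, if_true, if_false, hle, norm_zero, zero_le_one]) le_rfl hA1A0 hA01
        have heq : ∑ a ∈ Finset.Ioc A0 A1, ∑ b ∈ Finset.Ioc (X / a) (Y / a), (Λ a : ℂ) * Λ b * G (a * b) =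
            (ell N : ℂ) ^ 2 * ∑ a ∈ Finset.Ioc A0 A1, ∑ b ∈ Finset.Ioc (X / a) (Y / a),
              (if a ≤ N then (Λ a : ℂ) / ell N else 0) * (if b ≤ N then (Λ b : ℂ) / ell N else 0) *
              (ρ (a * b) * e (g ((a * b : ℕ) : ℤ))) := by
          simp_rw [Finset.mul_sum]
          apply Finset.sum_congr rfl
          intro a ha
          apply Finset.sum_congr rfl
          intro b hb
          rw [Finset.mem_Ioc] at ha hb
          have hbN : b ≤ N := hb.2.trans ((Nat.div_le_self _ _).trans hYN)
          rw [if_pos (ha.2.trans f2), if_pos hbN]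
          have : (ell N : ℂ) ≠ 0 := by exact_mod_cast hlp.ne'
          simp only [hG]
          field_simp
        rw [heq, norm_mul, norm_pow, Complex.norm_natCast]
        calc _ ≤ (ell N : ℝ) ^ 2 * (H / (ell N : ℝ) ^ 5) := mul_le_mul_of_nonneg_left this (by positivity)
          _ = H / (ell N : ℝ) ^ 3 := by field_simp
          _ ≤ H := div_le_self hHp.le (one_le_pow₀ hll)
      · gcongr
      · gcongr
  -- LL
  have hLL : ‖∑ n ∈ Finset.Ioc X Y, (LL L n : ℂ) * G n‖ ≤ H + H + 2 * u ^ 3 * H := by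
    rw [sum_LL_mul L G X Y N hYN, ← Finset.sum_Ioc_consecutive _ (Nat.zero_le A0) (hA01.trans f2),
      ← Finset.sum_Ioc_consecutive _ hA01 f2, ← add_assoc]
    have hwt : ∀ a : ℕ, 0 < a → a ≤ N → |muR a * (L - Real.log a) ^ 2| ≤ (ell N : ℝ) ^ 2 := by
      intro a ha haN
      have e1 : 0 ≤ Real.log a := Real.log_natCast_nonneg a
      have e2 : Real.log a ≤ L := Real.log_le_log (by exact_mod_cast ha) (by exact_mod_cast haN)
      rw [abs_mul, abs_of_nonneg (sq_nonneg (L - Real.log a))]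
      calc _ ≤ 1 * (L - Real.log a) ^ 2 := mul_le_mul_of_nonneg_right (abs_muR_le a) (sq_nonneg _)
        _ ≤ _ := by
          rw [one_mul]
          exact pow_le_pow_left₀ (by linarith) (by linarith) 2
    refine (norm_add_le _ _).trans (add_le_add ((norm_add_le _ _).trans (add_le_add ?_ ?_)) ?_)
    · calc _ ≤ ∑ a ∈ Finset.Ioc 0 A0, (ell N : ℝ) ^ 2 * (N / (ell N : ℝ) ^ (C1 + K + 3)) := by
            refine (norm_sum_le _ _).trans (Finset.sum_le_sum ?_)
            intro a ha
            rw [Finset.mem_Ioc] at ha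
            rw [← Finset.mul_sum, norm_mul, Complex.norm_real, Real.norm_eq_abs]
            have haE : (a:ℝ) ≤ (ell N : ℝ) ^ (C1 + K + 3) := by
              have : (a:ℝ) ≤ A0 := by exact_mod_cast ha.2
              rw [hA0r] at this
              exact this.trans (pow_le_pow_right₀ hll (by omega))
            have := h1 θ g q ρ a (X / a) (Y / a) hg hM1 hq hqK hρ hρ1 ha.1 haE
              ((Nat.div_le_self _ _).trans hYN)
            exact mul_le_mul (hwt a ha.1 (ha.2.trans (hA01.trans f2))) this (norm_nonneg _) (by positivity)
        _ = (ell N : ℝ) ^ C1 * ((ell N : ℝ) ^ 2 * (N / (ell N : ℝ) ^ (C1 + K + 3))) := by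
            rw [Finset.sum_const, Nat.card_Ioc, nsmul_eq_mul, tsub_zero, hA0r]
        _ ≤ (ell N : ℝ) ^ C1 * ((ell N : ℝ) ^ 2 * (H * (ell N : ℝ) ^ K / (ell N : ℝ) ^ (C1 + K + 3))) := by
            gcongr
        _ = H / ell N := by
            rw [pow_add, pow_add]
            field_simp
        _ ≤ H := div_le_self hHp.le hll
    · have := h2 θ g q ρ X Y A0 A1 (fun a => if 0 < a ∧ a ≤ N then ((muR a * (L - Real.log a) ^ 2 : ℝ) : ℂ) / (ell N : ℂ) ^ 2 else 0)
          (fun n => 1) hg hM2 hq hqK hρ hρ1 hXY hYN hH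
          (fun a => by
            by_cases h : 0 < a ∧ a ≤ N
            · simp only [h]
              rw [if_pos (by simp), norm_div, Complex.norm_real, Real.norm_eq_abs, norm_pow, Complex.norm_natCast,
                div_le_one (by positivity)]
              exact hwt a h.1 h.2
            · simp only [h, if_false, norm_zero, zero_le_one])
          (fun n => by simp) le_rfl hA1A0 hA01
      have heq : ∑ a ∈ Finset.Ioc A0 A1, ∑ b ∈ Finset.Ioc (X / a) (Y / a), ((muR a * (L - Real.log a) ^ 2 : ℝ) : ℂ) * G (a * b) =
            (ell N : ℂ) ^ 2 * ∑ a ∈ Finset.Ioc A0 A1, ∑ b ∈ Finset.Ioc (X / a) (Y / a),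
              (if 0 < a ∧ a ≤ N then ((muR a * (L - Real.log a) ^ 2 : ℝ) : ℂ) / (ell N : ℂ) ^ 2 else 0) * 1 *
              (ρ (a * b) * e (g ((a * b : ℕ) : ℤ))) := by
          simp_rw [Finset.mul_sum]
          apply Finset.sum_congr rfl
          intro a ha
          apply Finset.sum_congr rfl
          intro b hb
          rw [Finset.mem_Ioc] at ha hb
          rw [if_pos ⟨by omega, ha.2.trans f2⟩]
          have : (ell N : ℂ) ≠ 0 := by exact_mod_cast hlp.ne'
          simp only [hG]
          field_simp
      rw [heq, norm_mul, norm_pow, Complex.norm_natCast]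
      calc _ ≤ (ell N : ℝ) ^ 2 * (H / (ell N : ℝ) ^ 5) := mul_le_mul_of_nonneg_left this (by positivity)
          _ = H / (ell N : ℝ) ^ 3 := by field_simp
          _ ≤ H := div_le_self hHp.le (one_le_pow₀ hll)
    · refine (LL_tail X Y N A1 G f1 f2 hXY hYN hG1).trans ?_
      calc _ ≤ u ^ 2 * (H * u + H) := by
            gcongr
            · linarith
            · linarith
            · rw [hA0r] at hA0H
              rw [hA0r] at f3
              linarith
        _ ≤ u ^ 2 * (H * u + H * u) := by
            gcongr
            exact le_mul_of_one_le_right hHp.le hu1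
        _ = _ := by ring
  have hfin := hS X Y G hXY hYN hX hH hG1
  have hL0 : 0 < L := by linarith
  have hfin2 : L * ‖∑ n ∈ Finset.Ioc X Y, (Λ n : ℂ) * G n‖ ≤ L * (ε * H) := by
    refine hfin.trans ?_
    have e0 : 1 ≤ u ^ 3 := hu1.trans hu3
    have e1 : H ≤ u ^ 3 * H := le_mul_of_one_le_left hHp.le e0
    have e2 : u * H ≤ u ^ 3 * H := mul_le_mul_of_nonneg_right hu3 hHp.le
    have e3 : c * (u ^ 3 * H) ≤ c * (ε / c * L * H) := by gcongr
    have e4 : c * (ε / c * L * H) = L * (ε * H) := by field_simp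
    have e5 : |Real.log ε0| * (62 * H) ≤ 62 * |Real.log ε0| * (u ^ 3 * H) := by
      have := mul_le_mul_of_nonneg_left e1 (abs_nonneg (Real.log ε0))
      linarith
    have e6 : c * (u ^ 3 * H) = 2000 * (u ^ 3 * H) + 62 * |Real.log ε0| * (u ^ 3 * H) := by rw [hc]; ring
    linarith
  exact le_of_mul_le_mul_left hfin2 hL0

end UDP

namespace UDP
open ArithmeticFunction

lemma crt_sum {E : Type*} [AddCommMonoid E] (F : ℕ → E) (P Q c d : ℕ) (hP : 0 < P) (hQ : 0 < Q)
    (hPQ : Nat.Coprime P Q) (c1 : c ≡ 1 [MOD P]) (c2 : c ≡ 0 [MOD Q]) (d1 : d ≡ 0 [MOD P])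
    (d2 : d ≡ 1 [MOD Q]) :
    ∑ r ∈ Finset.range (P * Q), F r =
      ∑ y ∈ Finset.range Q, ∑ x ∈ Finset.range P, F ((c * x + d * y) % (P * Q)) := by
  have kP : ∀ x y, c * x + d * y ≡ x [MOD P] := fun x y => by
    simpa using (c1.mul_right x).add (d1.mul_right y)
  have kQ : ∀ x y, c * x + d * y ≡ y [MOD Q] := fun x y => by
    simpa using (c2.mul_right x).add (d2.mul_right y)
  rw [← Finset.sum_product']
  symm
  refine Finset.sum_nbij' (fun z => (c * z.2 + d * z.1) % (P * Q)) (fun r => (r % Q, r % P)) ?_ ?_ ?_ ?_ ?_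
  · intro z _
    exact Finset.mem_range.2 (Nat.mod_lt _ (by positivity))
  · intro r _
    simp only [Finset.mem_product, Finset.mem_range]
    exact ⟨Nat.mod_lt _ hQ, Nat.mod_lt _ hP⟩
  · rintro ⟨y, x⟩ h
    simp only [Finset.mem_product, Finset.mem_range] at h
    ext
    · simp only
      rw [Nat.mod_mod_of_dvd _ (Dvd.intro_left P rfl), kQ x y, Nat.mod_eq_of_lt h.1]
    · simp only
      rw [Nat.mod_mod_of_dvd _ (Dvd.intro Q rfl), kP x y, Nat.mod_eq_of_lt h.2]
  · intro r h
    rw [Finset.mem_range] at h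
    simp only
    have : c * (r % P) + d * (r % Q) ≡ r [MOD P * Q] := by
      rw [← Nat.modEq_and_modEq_iff_modEq_mul hPQ]
      exact ⟨(kP _ _).trans (Nat.mod_modEq _ _), (kQ _ _).trans (Nat.mod_modEq _ _)⟩
    rw [this, Nat.mod_eq_of_lt h]
  · intro z _; rfl

lemma sum_range_cast {E : Type*} [AddCommMonoid E] (F : ℤ → E) (P : ℕ) :
    ∑ a ∈ Finset.range P, F (a : ℤ) = ∑ a ∈ Finset.Ioc (-1:ℤ) (-1 + P), F a := by
  refine Finset.sum_bij' (fun a _ => (a:ℤ)) (fun a _ => a.toNat) ?_ ?_ ?_ ?_ ?_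
  · intro a ha; simp only [Finset.mem_Ioc, Finset.mem_range] at ha ⊢; omega
  · intro a ha; simp only [Finset.mem_Ioc, Finset.mem_range] at ha ⊢; omega
  · intro a ha; simp
  · intro a ha; simp only [Finset.mem_Ioc] at ha; simp; omega
  · intro a ha; rfl

lemma prime_pow_big (n Z : ℕ) (h : Nat.factorial Z < n) :
    ∃ p : ℕ, p.Prime ∧ Z < p ^ (n.factorization p) := by
  by_contra hc
  push Not at hc
  have hn : n ≠ 0 := by omega
  have : n ∣ Nat.factorial Z := by
    rw [Nat.dvd_iff_prime_pow_dvd_dvd]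
    intro p k hp hk
    have h1 : k ≤ n.factorization p := (hp.pow_dvd_iff_le_factorization hn).1 hk
    have h2 : p ^ k ≤ Z := (Nat.pow_le_pow_right hp.pos h1).trans (hc p hp)
    exact Nat.dvd_factorial (pow_pos hp.pos k) h2
  have := Nat.le_of_dvd (Nat.factorial_pos Z) this
  omega

lemma totient_pow_ge (p E : ℕ) (hp : p.Prime) : p ^ E ≤ 2 * Nat.totient (p ^ E) := by
  rcases Nat.eq_zero_or_pos E with h | h
  · subst h; simp
  · rw [Nat.totient_prime_pow hp h]
    have h2 := hp.two_le
    obtain ⟨m, rfl⟩ : ∃ m, E = m + 1 := ⟨E - 1, by omega⟩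
    simp only [Nat.add_sub_cancel]
    rw [pow_succ]
    have : p ≤ 2 * (p - 1) := by omega
    calc p ^ m * p ≤ p ^ m * (2 * (p - 1)) := Nat.mul_le_mul_left _ this
      _ = _ := by ring

/-- arithmetic heart: the approximation forces the prime power to divide -/
lemma pp_contra (k pe : ℕ) (c : ℤ) (q' : ℕ) (hq' : 0 < q') (hcop : IsCoprime c (pe:ℤ)) (P : ℕ) (Q : ℝ)
    (hpe : 0 < pe) (hP : pe ≤ P) (hQ : Q < pe) (hq'Q : (q':ℝ) ≤ Q)
    (hn : Near (q' * ((c:ℝ) / pe)) (Q / ((P:ℝ) ^ (k + 1) * (P:ℝ) ^ (k + 1)))) : False := by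
  obtain ⟨m, hm⟩ := hn
  have hpe' : (0:ℝ) < pe := by exact_mod_cast hpe
  have hPr : (pe:ℝ) ≤ P := by exact_mod_cast hP
  have hP1 : (1:ℝ) ≤ P := by exact_mod_cast (by omega : 1 ≤ P)
  have hQ0 : 0 < Q := lt_of_lt_of_le (by exact_mod_cast hq') hq'Q
  have h1 : |(q':ℝ) * c - m * pe| < 1 := by
    have e1 : (q':ℝ) * c - m * pe = pe * (q' * ((c:ℝ) / pe) - m) := by field_simp
    rw [e1, abs_mul, abs_of_pos hpe']
    have e2 : (P:ℝ) * P ≤ (P:ℝ) ^ (k + 1) * (P:ℝ) ^ (k + 1) := by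
      have : (P:ℝ) ≤ (P:ℝ) ^ (k + 1) := le_self_pow₀ hP1 (by omega)
      gcongr
    calc (pe:ℝ) * |q' * ((c:ℝ) / pe) - m| ≤ pe * (Q / ((P:ℝ) ^ (k + 1) * (P:ℝ) ^ (k + 1))) := by gcongr
      _ ≤ P * (Q / (P * P)) := by gcongr
      _ = Q / P := by field_simp
      _ < 1 := by rw [div_lt_one (by linarith)]; linarith
  have h2 : (q':ℤ) * c - m * pe = 0 := by
    have : |((q':ℤ) * c - m * pe : ℤ)| < 1 := by
      have h3 : ((|((q':ℤ) * c - m * pe : ℤ)| : ℤ) : ℝ) < ((1:ℤ):ℝ) := by push_cast; exact h1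
      exact_mod_cast h3
    exact Int.abs_lt_one_iff.1 this
  have h3 : (pe:ℤ) ∣ q' * c := ⟨m, by linarith⟩
  have h4 : (pe:ℤ) ∣ q' := hcop.symm.dvd_of_dvd_mul_right h3
  have h5 : pe ∣ q' := by exact_mod_cast h4
  have h6 := Nat.le_of_dvd hq' h5
  have : (pe:ℝ) ≤ q' := by exact_mod_cast h6
  linarith

set_option maxHeartbeats 1000000 in
theorem lemmaM (k : ℕ) (ε : ℝ) (hε : 0 < ε) : ∃ T : ℕ, ∀ (θ : ℝ) (g : ℤ → ℝ) (q qk : ℕ) (a : ℤ)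
    (u v : ℕ → ℂ), IsPoly (k + 1) θ g → θ = a / qk → IsCoprime a (qk:ℤ) → qk ∣ q → 0 < q →
    T ≤ qk → (∀ m n : ℤ, m ≡ n [ZMOD q] → e (g m) = e (g n)) → (∀ r, ‖u r‖ ≤ 1) → (∀ r, ‖v r‖ ≤ 1) →
    (∀ r, ¬ Nat.Coprime r q → u r = 0) → (∀ r, ¬ Nat.Coprime r q → v r = 0) →
    ‖∑ r ∈ Finset.range q, ∑ s ∈ Finset.range q, u r * v s * e (g ((r * s : ℕ) : ℤ))‖ ≤
      ε * (Nat.totient q : ℝ) ^ 2 := by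
  obtain ⟨C, hC⟩ := bilin k k
  set D : ℝ := 2 + 4 / ε with hD
  have hD2 : 2 ≤ D := by have : 0 < 4 / ε := by positivity
                         linarith
  have hD4 : 4 / D ≤ ε := by
    rw [div_le_iff₀ (by linarith), hD]
    have : ε * (2 + 4 / ε) = 2 * ε + 4 := by field_simp
    linarith
  set Z : ℕ := ⌈D ^ C⌉₊ with hZ
  refine ⟨Nat.factorial Z + 1, ?_⟩
  intro θ g q qk a u v hg hθ hcop hqk hq hT hper hu hv hu0 hv0
  obtain ⟨p, hp, hpZ⟩ := prime_pow_big qk Z (by omega)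
  have hqk0 : qk ≠ 0 := by rintro rfl; omega
  set P := p ^ (q.factorization p) with hP
  set Q := q / p ^ (q.factorization p) with hQ
  set pe := p ^ (qk.factorization p) with hpe
  set t := qk / p ^ (qk.factorization p) with ht
  have hPQ : P * Q = q := Nat.ordProj_mul_ordCompl_eq_self q p
  have hpt : pe * t = qk := Nat.ordProj_mul_ordCompl_eq_self qk p
  have hPpos : 0 < P := pow_pos hp.pos _
  have hpepos : 0 < pe := pow_pos hp.pos _
  have hQpos : 0 < Q := Nat.pos_of_ne_zero (by intro h; rw [h] at hPQ; omega)
  have hcopPQ : Nat.Coprime P Q := Nat.Coprime.pow_left _ (Nat.coprime_ordCompl hp hq.ne')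
  have htQ : t ∣ Q := Nat.ordCompl_dvd_ordCompl_of_dvd hqk p
  have hpeP : pe ∣ P := Nat.ordProj_dvd_ordProj_of_dvd hq.ne' hqk p
  have hcopt : Nat.Coprime pe t := Nat.Coprime.pow_left _ (Nat.coprime_ordCompl hp hqk0)
  obtain ⟨c, c1, c2⟩ := Nat.chineseRemainder hcopPQ 1 0
  obtain ⟨d, d1, d2⟩ := Nat.chineseRemainder hcopPQ 0 1
  have htc : t ∣ c := htQ.trans ((Nat.modEq_zero_iff_dvd).1 c2)
  obtain ⟨c', hc'⟩ : t ∣ c ^ (k + 1) := htc.trans (dvd_pow_self c (by omega))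
  have ht0 : 0 < t := Nat.pos_of_ne_zero (by intro h; rw [h] at hpt; omega)
  have hcpe : Nat.Coprime c' pe := by
    have h1 : Nat.Coprime c P := by
      have := c1.gcd_eq
      rw [Nat.Coprime, this]; simp
    have h2 : Nat.Coprime (c ^ (k + 1)) pe := Nat.Coprime.pow_left _ (h1.coprime_dvd_right hpeP)
    exact h2.coprime_dvd_left (Dvd.intro_left t hc'.symm)
  have hape : IsCoprime a (pe:ℤ) := hcop.of_isCoprime_of_dvd_right (by exact_mod_cast Dvd.intro t hpt)
  have hcop2 : IsCoprime ((c':ℤ) * a) (pe:ℤ) := IsCoprime.mul_left (Nat.isCoprime_iff_coprime.2 hcpe) hape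
  have hξ : ((c:ℤ):ℝ) ^ (k + 1) * θ = (((c':ℤ) * a : ℤ) : ℝ) / pe := by
    have e1 : (c:ℝ) ^ (k + 1) = t * c' := by exact_mod_cast hc'
    have e2 : (qk:ℝ) = pe * t := by exact_mod_cast hpt.symm
    have e3 : (t:ℝ) ≠ 0 := by exact_mod_cast ht0.ne'
    have e4 : (pe:ℝ) ≠ 0 := by exact_mod_cast hpepos.ne'
    push_cast
    rw [hθ, e1, e2]
    field_simp
  have hDZ : D ^ C ≤ Z := Nat.le_ceil _
  have hZpe : (Z:ℝ) < pe := by exact_mod_cast hpZ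
  have hPr : (pe:ℝ) ≤ P := by exact_mod_cast Nat.le_of_dvd hPpos hpeP
  -- key congruence
  have hcd : ∀ x y x' y' : ℕ, (c * x + d * y) * (c * x' + d * y') ≡ c * (x * x') + d * (y * y') [MOD (P * Q)] := by
    intro x y x' y'
    have kP : ∀ x y, c * x + d * y ≡ x [MOD P] := fun x y => by
      simpa using (c1.mul_right x).add (d1.mul_right y)
    have kQ : ∀ x y, c * x + d * y ≡ y [MOD Q] := fun x y => by
      simpa using (c2.mul_right x).add (d2.mul_right y)
    rw [← Nat.modEq_and_modEq_iff_modEq_mul hcopPQ]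
    exact ⟨((kP _ _).mul (kP _ _)).trans (kP _ _).symm, ((kQ _ _).mul (kQ _ _)).trans (kQ _ _).symm⟩
  have hper' : ∀ m n : ℤ, m ≡ n [ZMOD ((P * Q : ℕ) : ℤ)] → e (g m) = e (g n) := by
    rw [hPQ]; exact hper
  -- inner bound
  have inner : ∀ y y' : ℕ, ‖∑ x ∈ Finset.range P, ∑ x' ∈ Finset.range P,
      u ((c * x + d * y) % (P * Q)) * v ((c * x' + d * y') % (P * Q)) *
        e (g (((c * x + d * y) % (P * Q) * ((c * x' + d * y') % (P * Q)) : ℕ) : ℤ))‖ ≤ P * P / D := by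
    intro y y'
    by_contra hcon
    push Not at hcon
    have h1 : ‖∑ x ∈ Finset.range P, ∑ x' ∈ Finset.range P,
      u ((c * x + d * y) % (P * Q)) * v ((c * x' + d * y') % (P * Q)) *
        e (g (((c * x + d * y) % (P * Q) * ((c * x' + d * y') % (P * Q)) : ℕ) : ℤ))‖ ≤
        ∑ x ∈ Finset.range P, ‖∑ x' ∈ Finset.range P, v ((c * x' + d * y') % (P * Q)) *
          e (g ((c:ℤ) * ((x:ℤ) * (x':ℤ)) + (d * (y * y') : ℕ)))‖ := by
      refine (norm_sum_le _ _).trans (Finset.sum_le_sum ?_)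
      intro x _
      have : ∑ x' ∈ Finset.range P,
          u ((c * x + d * y) % (P * Q)) * v ((c * x' + d * y') % (P * Q)) *
          e (g (((c * x + d * y) % (P * Q) * ((c * x' + d * y') % (P * Q)) : ℕ) : ℤ)) =
          u ((c * x + d * y) % (P * Q)) * ∑ x' ∈ Finset.range P, v ((c * x' + d * y') % (P * Q)) *
          e (g ((c:ℤ) * ((x:ℤ) * (x':ℤ)) + (d * (y * y') : ℕ))) := by
        rw [Finset.mul_sum]
        apply Finset.sum_congr rfl
        intro x' _
        have h2 : (c * x + d * y) % (P * Q) * ((c * x' + d * y') % (P * Q)) ≡ c * (x * x') + d * (y * y') [MOD (P * Q)] :=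
          ((Nat.mod_modEq _ _).mul (Nat.mod_modEq _ _)).trans (hcd x y x' y')
        have h3 := hper' _ _ ((Int.natCast_modEq_iff).2 h2)
        rw [h3]
        push_cast
        ring
      rw [this, norm_mul]
      exact mul_le_of_le_one_left (norm_nonneg _) (hu _)
    have h2 := hcon.le.trans h1
    have h3 : ∑ x ∈ Finset.range P, ‖∑ x' ∈ Finset.range P, v ((c * x' + d * y') % (P * Q)) *
          e (g ((c:ℤ) * ((x:ℤ) * (x':ℤ)) + (d * (y * y') : ℕ)))‖ =
        ∑ x ∈ Finset.Ioc (-1:ℤ) (-1 + P), ‖∑ x' ∈ Finset.Ioc (-1:ℤ) (-1 + P),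
          v ((c * x'.toNat + d * y') % (P * Q)) * e (g ((c:ℤ) * (x * x') + (d * (y * y') : ℕ)))‖ := by
      rw [← sum_range_cast]
      apply Finset.sum_congr rfl
      intro x _
      rw [← sum_range_cast]
      simp
    rw [h3] at h2
    have w1 : ∀ x : ℤ, IsPoly (k + 1) ((((c:ℤ):ℝ) ^ (k + 1) * θ) * (x:ℝ) ^ (k + 1))
        (fun x' => g ((c:ℤ) * (x * x') + (d * (y * y') : ℕ))) := by
      intro x
      refine (hg.comp (c * x) (d * (y * y') : ℕ)).congr (by push_cast; ring) (fun n => ?_)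
      rw [mul_assoc]
    obtain ⟨q', a1, a2, a3⟩ := hC D P P _ (fun x x' => g ((c:ℤ) * (x * x') + (d * (y * y') : ℕ))) (-1) (-1 + P) (-1)
      (fun x' => v ((c * x'.toNat + d * y') % (P * Q))) hD2 w1 (by omega) (fun b => hv _) h2
      (by linarith) (by linarith)
    rw [hξ] at a3
    exact pp_contra k pe ((c':ℤ) * a) q' a1 hcop2 P (D ^ C) hpepos (Nat.le_of_dvd hPpos hpeP) (by linarith) a2 a3
  -- zero unless y coprime
  have hcopy : ∀ x y : ℕ, ¬ Nat.Coprime Q y → ¬ Nat.Coprime ((c * x + d * y) % (P * Q)) q := by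
    intro x y hy hcon
    apply hy
    have kQ : c * x + d * y ≡ y [MOD Q] := by
      simpa using (c2.mul_right x).add (d2.mul_right y)
    have h1 : (c * x + d * y) % (P * Q) ≡ y [MOD Q] := by
      refine Nat.ModEq.trans ?_ kQ
      exact (Nat.mod_modEq _ _).of_mul_left P
    have h2 : Nat.Coprime ((c * x + d * y) % (P * Q)) Q := hcon.coprime_dvd_right (Dvd.intro_left P hPQ)
    rw [Nat.Coprime, h1.gcd_eq] at h2
    exact Nat.Coprime.symm h2
  have hmain : ‖∑ r ∈ Finset.range q, ∑ s ∈ Finset.range q, u r * v s * e (g ((r * s : ℕ) : ℤ))‖ ≤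
      ∑ y ∈ (Finset.range Q).filter (Nat.Coprime Q), ∑ y' ∈ (Finset.range Q).filter (Nat.Coprime Q), (P * P / D : ℝ) := by
    have e1 : ∑ r ∈ Finset.range q, ∑ s ∈ Finset.range q, u r * v s * e (g ((r * s : ℕ) : ℤ)) =
        ∑ y ∈ Finset.range Q, ∑ y' ∈ Finset.range Q, ∑ x ∈ Finset.range P, ∑ x' ∈ Finset.range P,
          u ((c * x + d * y) % (P * Q)) * v ((c * x' + d * y') % (P * Q)) *
        e (g (((c * x + d * y) % (P * Q) * ((c * x' + d * y') % (P * Q)) : ℕ) : ℤ)) := by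
      rw [← hPQ, crt_sum _ P Q c d hPpos hQpos hcopPQ c1 c2 d1 d2]
      apply Finset.sum_congr rfl
      intro y _
      symm
      rw [Finset.sum_comm]
      apply Finset.sum_congr rfl
      intro x _
      rw [crt_sum _ P Q c d hPpos hQpos hcopPQ c1 c2 d1 d2]
    rw [e1]
    refine (norm_sum_le _ _).trans ?_
    rw [Finset.sum_filter]
    apply Finset.sum_le_sum
    intro y _
    split_ifs with hy
    · refine (norm_sum_le _ _).trans ?_
      rw [Finset.sum_filter]
      apply Finset.sum_le_sum
      intro y' _
      split_ifs with hy'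
      · exact inner y y'
      · rw [norm_le_zero_iff]
        apply Finset.sum_eq_zero
        intro x _
        apply Finset.sum_eq_zero
        intro x' _
        rw [hv0 _ (hcopy x' y' hy')]
        ring
    · rw [norm_le_zero_iff]
      apply Finset.sum_eq_zero
      intro y' _
      apply Finset.sum_eq_zero
      intro x _
      apply Finset.sum_eq_zero
      intro x' _
      rw [hu0 _ (hcopy x y hy)]
      ring
  refine hmain.trans ?_
  rw [Finset.sum_const, Finset.sum_const, nsmul_eq_mul, nsmul_eq_mul, ← Nat.totient_eq_card_coprime]
  have hφ : (Nat.totient q : ℝ) = Nat.totient P * Nat.totient Q := by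
    rw [← hPQ, Nat.totient_mul hcopPQ]; push_cast; rfl
  have hφP : (P:ℝ) ≤ 2 * Nat.totient P := by exact_mod_cast totient_pow_ge p _ hp
  rw [hφ]
  calc (Nat.totient Q : ℝ) * (Nat.totient Q * (P * P / D)) ≤
      (Nat.totient Q : ℝ) * (Nat.totient Q * ((2 * Nat.totient P) * (2 * Nat.totient P) / D)) := by gcongr
    _ = 4 / D * ((Nat.totient P : ℝ) * Nat.totient Q) ^ 2 := by ring
    _ ≤ _ := by gcongr

end UDP

namespace UDP
open ArithmeticFunction

/-- coprime-restricted periodic phase -/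
def GC (g : ℤ → ℝ) (q n : ℕ) : ℂ := if Nat.Coprime n q then e (g (n:ℤ)) else 0

lemma GC_norm (g : ℤ → ℝ) (q n : ℕ) : ‖GC g q n‖ ≤ 1 := by
  unfold GC
  split_ifs
  · rw [norm_e]
  · simp

lemma GC_per (g : ℤ → ℝ) (q : ℕ) (hper : ∀ m n : ℤ, m ≡ n [ZMOD q] → e (g m) = e (g n))
    (m n : ℕ) (h : m ≡ n [MOD q]) : GC g q m = GC g q n := by
  unfold GC
  have h1 : Nat.Coprime m q ↔ Nat.Coprime n q := by
    rw [Nat.Coprime, Nat.Coprime, h.gcd_eq]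
  have h2 := hper m n (Int.natCast_modEq_iff.2 h)
  by_cases hc : Nat.Coprime n q
  · rw [if_pos hc, if_pos (h1.2 hc), h2]
  · rw [if_neg hc, if_neg (fun hh => hc (h1.1 hh))]

lemma GC_mul (g : ℤ → ℝ) (q r s : ℕ) : GC g q (r * s) =
    (if Nat.Coprime r q then 1 else 0) * (if Nat.Coprime s q then 1 else 0) * e (g ((r * s : ℕ) : ℤ)) := by
  unfold GC
  by_cases h1 : Nat.Coprime r q
  · by_cases h2 : Nat.Coprime s q
    · rw [if_pos (Nat.Coprime.mul_left h1 h2), if_pos h1, if_pos h2]; ring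
    · rw [if_neg (fun h => h2 (Nat.Coprime.coprime_mul_left h)), if_neg h2]; ring
  · rw [if_neg (fun h => h1 (Nat.Coprime.coprime_mul_right h)), if_neg h1]; ring

/-- the bound supplied by lemmaM -/
def BM (g : ℤ → ℝ) (q : ℕ) (ε : ℝ) : Prop :=
  ∀ u v : ℕ → ℂ, (∀ r, ‖u r‖ ≤ 1) → (∀ r, ‖v r‖ ≤ 1) →
    (∀ r, ¬ Nat.Coprime r q → u r = 0) → (∀ r, ¬ Nat.Coprime r q → v r = 0) →
    ‖∑ r ∈ Finset.range q, ∑ s ∈ Finset.range q, u r * v s * e (g ((r * s : ℕ) : ℤ))‖ ≤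
      ε * (Nat.totient q : ℝ) ^ 2

lemma M1 (g : ℤ → ℝ) (q : ℕ) (ε : ℝ) (hq : 0 < q)
    (hper : ∀ m n : ℤ, m ≡ n [ZMOD q] → e (g m) = e (g n)) (hB : BM g q ε) :
    ‖∑ r ∈ Finset.range q, GC g q r‖ ≤ ε * Nat.totient q := by
  have h1 := hB (fun r => if Nat.Coprime r q then 1 else 0) (fun r => if Nat.Coprime r q then 1 else 0)
    (fun r => by split_ifs <;> simp) (fun r => by split_ifs <;> simp)
    (fun r h => by rw [if_neg h]) (fun r h => by rw [if_neg h])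
  simp only [← GC_mul] at h1
  have h2 : ∑ r ∈ Finset.range q, ∑ s ∈ Finset.range q, GC g q (r * s) =
      (Nat.totient q : ℂ) * ∑ s ∈ Finset.range q, GC g q s := by
    have h3 : ∀ r ∈ Finset.range q, ∑ s ∈ Finset.range q, GC g q (r * s) =
        if Nat.Coprime q r then ∑ s ∈ Finset.range q, GC g q s else 0 := by
      intro r _
      split_ifs with hr
      · have hinj : Set.InjOn (fun s => r * s % q) (Finset.range q : Set ℕ) := by
          intro s hs t ht hst
          simp only [Finset.coe_range, Set.mem_Iio] at hs ht
          have : r * s ≡ r * t [MOD q] := hst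
          have := Nat.ModEq.cancel_left_of_coprime hr this
          rw [Nat.ModEq, Nat.mod_eq_of_lt hs, Nat.mod_eq_of_lt ht] at this
          exact this
        have himg : (Finset.range q).image (fun s => r * s % q) = Finset.range q := by
          apply Finset.eq_of_subset_of_card_le
          · intro x hx
            simp only [Finset.mem_image] at hx
            obtain ⟨s, _, rfl⟩ := hx
            exact Finset.mem_range.2 (Nat.mod_lt _ hq)
          · rw [Finset.card_image_of_injOn hinj]
        conv_rhs => rw [← himg]
        rw [Finset.sum_image hinj]
        apply Finset.sum_congr rfl
        intro s _
        exact GC_per g q hper _ _ (Nat.mod_modEq _ _).symm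
      · apply Finset.sum_eq_zero
        intro s _
        rw [GC_mul, if_neg (fun h => hr (Nat.Coprime.symm h))]
        ring
    rw [Finset.sum_congr rfl h3, ← Finset.sum_filter, Finset.sum_const, nsmul_eq_mul, ← Nat.totient_eq_card_coprime]
  rw [h2, norm_mul, Complex.norm_natCast] at h1
  have hφ : (0:ℝ) < Nat.totient q := by exact_mod_cast Nat.totient_pos.2 hq
  refine le_of_mul_le_mul_left (h1.trans (le_of_eq ?_)) hφ
  ring

lemma bil_class (g : ℤ → ℝ) (q : ℕ) (ε : ℝ) (hq : 0 < q)
    (hper : ∀ m n : ℤ, m ≡ n [ZMOD q] → e (g m) = e (g n)) (hB : BM g q ε) (S1 S2 : Finset ℕ) (W1 W2 : ℝ)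
    (hW1 : 0 < W1) (hW2 : 0 < W2)
    (h1 : ∀ r, Nat.Coprime r q → ∑ n ∈ S1.filter (fun n => n ≡ r [MOD q]), Λ n ≤ W1)
    (h2 : ∀ r, Nat.Coprime r q → ∑ n ∈ S2.filter (fun n => n ≡ r [MOD q]), Λ n ≤ W2) :
    ‖∑ a ∈ S1, ∑ b ∈ S2, (Λ a : ℂ) * Λ b * GC g q (a * b)‖ ≤ ε * (W1 * W2) * (Nat.totient q : ℝ) ^ 2 := by
  set U : Finset ℕ → ℝ → ℕ → ℂ := fun S W r => if Nat.Coprime r q then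
    ((∑ n ∈ S.filter (fun n => n ≡ r [MOD q]), Λ n : ℝ) : ℂ) / W else 0 with hU
  have hU1 : ∀ (S : Finset ℕ) (W : ℝ), 0 < W → (∀ r, Nat.Coprime r q → ∑ n ∈ S.filter (fun n => n ≡ r [MOD q]), Λ n ≤ W) →
      ∀ r, ‖U S W r‖ ≤ 1 := by
    intro S W hW h r
    simp only [hU]
    split_ifs with hr
    · rw [norm_div, Complex.norm_real, Complex.norm_real, Real.norm_of_nonneg hW.le,
        Real.norm_of_nonneg (Finset.sum_nonneg fun _ _ => vonMangoldt_nonneg), div_le_one hW]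
      exact h r hr
    · simp
  have hU0 : ∀ (S : Finset ℕ) (W : ℝ) r, ¬ Nat.Coprime r q → U S W r = 0 := by
    intro S W r hr
    simp only [hU]
    rw [if_neg hr]
  have h3 := hB (U S1 W1) (U S2 W2) (hU1 _ _ hW1 h1) (hU1 _ _ hW2 h2) (hU0 _ _) (hU0 _ _)
  have h4 : ∑ a ∈ S1, ∑ b ∈ S2, (Λ a : ℂ) * Λ b * GC g q (a * b) = (W1 * W2 : ℂ) *
      ∑ r ∈ Finset.range q, ∑ s ∈ Finset.range q, U S1 W1 r * U S2 W2 s * e (g ((r * s : ℕ) : ℤ)) := by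
    rw [sum_residues S1 _ q hq, Finset.mul_sum]
    apply Finset.sum_congr rfl
    intro r _
    have h5 : ∀ a ∈ S1.filter (fun n => n ≡ r [MOD q]), ∑ b ∈ S2, (Λ a : ℂ) * Λ b * GC g q (a * b) =
        ∑ s ∈ Finset.range q, ∑ b ∈ S2.filter (fun n => n ≡ s [MOD q]), (Λ a : ℂ) * Λ b * GC g q (r * s) := by
      intro a ha
      rw [sum_residues S2 _ q hq]
      apply Finset.sum_congr rfl
      intro s _
      apply Finset.sum_congr rfl
      intro b hb
      rw [GC_per g q hper _ _ ((Finset.mem_filter.1 ha).2.mul (Finset.mem_filter.1 hb).2)]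
    rw [Finset.sum_congr rfl h5, Finset.sum_comm, Finset.mul_sum]
    apply Finset.sum_congr rfl
    intro s _
    have c1 : (W1:ℂ) ≠ 0 := by exact_mod_cast hW1.ne'
    have c2 : (W2:ℂ) ≠ 0 := by exact_mod_cast hW2.ne'
    have h6 : ∑ a ∈ S1.filter (fun n => n ≡ r [MOD q]), ∑ b ∈ S2.filter (fun n => n ≡ s [MOD q]),
        (Λ a : ℂ) * Λ b * GC g q (r * s) =
        (∑ a ∈ S1.filter (fun n => n ≡ r [MOD q]), (Λ a : ℂ)) *
        (∑ b ∈ S2.filter (fun n => n ≡ s [MOD q]), (Λ b : ℂ)) * GC g q (r * s) := by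
      rw [Finset.sum_mul_sum, Finset.sum_mul]
      apply Finset.sum_congr rfl
      intro a _
      rw [Finset.sum_mul]
    rw [h6, GC_mul]
    simp only [hU]
    by_cases k1 : Nat.Coprime r q
    · by_cases k2 : Nat.Coprime s q
      · rw [if_pos k1, if_pos k2, if_pos k1, if_pos k2]
        push_cast
        field_simp
      · rw [if_neg k2, if_neg k2]; ring
    · rw [if_neg k1, if_neg k1]; ring
  rw [h4, norm_mul, norm_mul, Complex.norm_real, Complex.norm_real, Real.norm_of_nonneg hW1.le, Real.norm_of_nonneg hW2.le]
  calc _ ≤ W1 * W2 * (ε * (Nat.totient q : ℝ) ^ 2) := by gcongr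
    _ = _ := by ring

lemma ev_root (P : ℕ → Prop) (E : ℕ) (h : ∀ᶠ M in atTop, P M) :
    ∀ᶠ N : ℕ in atTop, ∀ A : ℕ, N ≤ A ^ E → P A := by
  obtain ⟨M0, hM0⟩ := eventually_atTop.1 h
  filter_upwards [eventually_gt_atTop (M0 ^ E)] with N hN
  intro A hA
  apply hM0
  by_contra hcon
  push Not at hcon
  have := Nat.pow_le_pow_left hcon.le E
  omega

lemma block_brun (K E : ℕ) : ∀ᶠ N : ℕ in atTop, ∀ A A' q r : ℕ, N ≤ A ^ E →
    0 < q → (q:ℝ) ≤ (ell N : ℝ) ^ K → Nat.Coprime r q → 2 * ell N ^ (K + 4) ≤ A →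
    A' ≤ A + A / ell N ^ (K + 4) →
    ∑ n ∈ (Finset.Ioc A A').filter (fun n => n ≡ r [MOD q]), Λ n ≤
      62 * ((A:ℝ) / (ell N : ℝ) ^ (K + 4)) / Nat.totient q := by
  have hev : ∀ᶠ M : ℕ in atTop, ((E:ℝ) + 1 ≤ (ell M : ℝ)) ∧ (2 ≤ (ell M : ℝ)) ∧ 0 < M ∧
      (∀ q r X Y : ℕ, 0 < q → (q:ℝ) ≤ (ell M : ℝ) ^ (2 * K + 10) →
    Nat.Coprime r q → X ≤ Y → Y ≤ M → (M:ℝ) ≤ ((Y:ℝ) - X) * (ell M : ℝ) ^ (2 * K + 10) →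
    ∑ n ∈ (Finset.Ioc X Y).filter (fun n => n ≡ r [MOD q]), Λ n ≤
      62 * ((Y:ℝ) - X) / Nat.totient q) := by
    filter_upwards [ev_ell_ge ((E:ℝ) + 1), ev_ell_ge 2, eventually_gt_atTop 0,
      brunT (2 * K + 10)] with M h1 h2 h4 h5
    exact ⟨h1, h2, h4, h5⟩
  filter_upwards [ev_root _ E hev, eventually_gt_atTop 0, ev_ell_ge 1] with N hN hN0 hl1
  intro A A' q r hAE hq hqK hr hwA hA'
  obtain ⟨h1, h2, hM0, hb⟩ := hN (2 * A) (hAE.trans (Nat.pow_le_pow_left (by omega) E))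
  have hNr : (0:ℝ) < N := by exact_mod_cast hN0
  have hell : (ell N : ℝ) ≤ (ell (2 * A) : ℝ) ^ 2 := by
    have e1 : Real.log N ≤ E * Real.log (2 * A : ℕ) := by
      rw [← Real.log_pow]
      exact Real.log_le_log hNr (by exact_mod_cast (hAE.trans (Nat.pow_le_pow_left (by omega) E)))
    have e2 : (E:ℝ) * Real.log (2 * A : ℕ) ≤ E * ell (2 * A) := by gcongr; exact log_le_ell _
    have e3 := ell_le N
    nlinarith
  set l : ℝ := (ell (2 * A) : ℝ) with hl
  have hpw : ∀ m : ℕ, (ell N : ℝ) ^ m ≤ l ^ (2 * m) := fun m => by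
    rw [pow_mul]; exact pow_le_pow_left₀ (by positivity) hell m
  have hl1' : (1:ℝ) ≤ l := by linarith
  set w : ℕ := ell N ^ (K + 4) with hw
  have hwp : 0 < w := by
    have : 0 < ell N := by exact_mod_cast (lt_of_lt_of_le one_pos hl1)
    positivity
  have hwr : (w:ℝ) = (ell N : ℝ) ^ (K + 4) := by rw [hw]; push_cast; rfl
  have hwr0 : (0:ℝ) < w := by exact_mod_cast hwp
  have hd1 : ((A / w : ℕ) : ℝ) ≤ A / w := Nat.cast_div_le
  have hd2 : (A:ℝ) / w - 1 ≤ (A / w : ℕ) := by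
    have := Nat.lt_floor_add_one ((A:ℝ) / w)
    rw [Nat.floor_div_eq_div] at this
    linarith
  have hd3 : (2:ℝ) ≤ A / w := by rw [le_div_iff₀ hwr0]; exact_mod_cast hwA
  have hbig : ((2 * A : ℕ) : ℝ) ≤ (((A + A / w : ℕ) : ℝ) - A) * l ^ (2 * K + 10) := by
    have e1 : ((A + A / w : ℕ) : ℝ) - A = (A / w : ℕ) := by push_cast; ring
    rw [e1]
    have e2 : (4:ℝ) * w ≤ l ^ (2 * K + 10) := by
      calc (4:ℝ) * w ≤ l ^ 2 * l ^ (2 * (K + 4)) := by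
            rw [hwr]
            exact mul_le_mul (by nlinarith) (hpw _) (by positivity) (by positivity)
        _ = _ := by rw [← pow_add]; congr 1; ring
    calc ((2 * A : ℕ) : ℝ) = (A / w / 2) * (4 * w) := by push_cast; field_simp; ring
      _ ≤ (A / w : ℕ) * (4 * w) := by gcongr; linarith
      _ ≤ _ := by gcongr
  have hfin := hb q r A (A + A / w) hq ((hqK.trans (hpw K)).trans (pow_le_pow_right₀ hl1' (by omega))) hr
    (Nat.le_add_right _ _) (by have := Nat.div_le_self A w; omega) hbig
  calc _ ≤ ∑ n ∈ (Finset.Ioc A (A + A / w)).filter (fun n => n ≡ r [MOD q]), Λ n := by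
        apply Finset.sum_le_sum_of_subset_of_nonneg
        · apply Finset.filter_subset_filter
          exact Finset.Ioc_subset_Ioc_right hA'
        · intro _ _ _; exact vonMangoldt_nonneg
    _ ≤ _ := hfin
    _ ≤ _ := by
      rw [← hwr]
      have e1 : ((A + A / w : ℕ) : ℝ) - A = (A / w : ℕ) := by push_cast; ring
      rw [e1]
      gcongr

lemma noncop (N q : ℕ) (hN : 0 < N) (hq : 0 < q) :
    ∑ n ∈ (Finset.Ioc 0 N).filter (fun n => ¬ Nat.Coprime n q), Λ n ≤ 2 * Real.log N * Real.log q := by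
  set M := Nat.log 2 N with hM
  have h1 : ∑ n ∈ (Finset.Ioc 0 N).filter (fun n => ¬ Nat.Coprime n q), Λ n ≤ ∑ d ∈ (q ^ M).divisors, Λ d := by
    rw [← Finset.sum_filter_ne_zero]
    apply Finset.sum_le_sum_of_subset_of_nonneg
    · intro n hn
      simp only [Finset.mem_filter, Finset.mem_Ioc] at hn
      obtain ⟨⟨⟨h0, hnN⟩, hc⟩, hne⟩ := hn
      rw [Nat.mem_divisors]
      refine ⟨?_, by positivity⟩
      rw [Ne, vonMangoldt_eq_zero_iff, not_not] at hne
      obtain ⟨p, m, hp, hm, rfl⟩ := (isPrimePow_nat_iff _).1 hne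
      have hpq : p ∣ q := by
        by_contra hcon
        exact hc (Nat.Coprime.pow_left m ((Nat.Prime.coprime_iff_not_dvd hp).2 hcon))
      have hmM : m ≤ M := by
        rw [hM]
        exact Nat.le_log_of_pow_le (by norm_num) ((Nat.pow_le_pow_left hp.two_le m).trans hnN)
      exact (pow_dvd_pow_of_dvd hpq m).trans (pow_dvd_pow q hmM)
    · intro _ _ _; exact vonMangoldt_nonneg
  rw [vonMangoldt_sum] at h1
  refine h1.trans ?_
  push_cast
  rw [Real.log_pow]
  have h2 : (M:ℝ) * Real.log 2 ≤ Real.log N := by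
    rw [← Real.log_pow]
    apply Real.log_le_log (by positivity)
    have := Nat.pow_log_le_self 2 hN.ne'
    exact_mod_cast this
  have h3 : (M:ℝ) ≤ 2 * Real.log N := by
    have := Real.log_two_gt_d9
    have hM0 : (0:ℝ) ≤ M := Nat.cast_nonneg _
    nlinarith
  exact mul_le_mul_of_nonneg_right h3 (Real.log_natCast_nonneg q)

end UDP

namespace UDP
open ArithmeticFunction

lemma major_LL (K : ℕ) (ε : ℝ) (hε : 0 < ε) : ∀ᶠ N : ℕ in atTop, ∀ (g : ℤ → ℝ) (q X Y : ℕ),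
    0 < q → (q:ℝ) ≤ (ell N : ℝ) ^ K →
    (∀ m n : ℤ, m ≡ n [ZMOD q] → e (g m) = e (g n)) → BM g q ε → X ≤ Y → Y ≤ N →
    (N:ℝ) ≤ ((Y:ℝ) - X) * (ell N : ℝ) ^ K →
    ‖∑ n ∈ Finset.Ioc X Y, (LL (Real.log N) n : ℂ) * GC g q n‖ ≤ 62 * ε * Real.log N * ((Y:ℝ) - X) := by
  filter_upwards [ERR_small K ε hε, cst_bound K] with N hE hc
  intro g q X Y hq hqK hper hB hXY hYN hH
  have hq' : (0:ℝ) < q := by exact_mod_cast hq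
  obtain ⟨d1, d2, d3⟩ := hE q ((Y:ℝ) - X) hq' hqK hH
  have hc1 := hc q hq hqK
  set D := N / ell N ^ (2 * K + 4) with hD
  have hM1 := M1 g q ε hq hper hB
  have hH0 : (0:ℝ) ≤ (Y:ℝ) - X := by
    have : (X:ℝ) ≤ Y := by exact_mod_cast hXY
    linarith
  set H := (Y:ℝ) - X with hHd
  set L := Real.log N with hLd
  set c := cst L D q with hcd
  set Sr : ℕ → ℝ := fun r => ∑ n ∈ (Finset.Ioc X Y).filter (fun n => n ≡ r [MOD q]), LL L n with hSr
  have e1 : ∑ n ∈ Finset.Ioc X Y, (LL L n : ℂ) * GC g q n =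
      ((H / q * c : ℝ) : ℂ) * ∑ r ∈ Finset.range q, GC g q r +
      ∑ r ∈ Finset.range q, ((Sr r - H / q * c : ℝ) : ℂ) * GC g q r := by
    rw [sum_residues _ _ q hq, Finset.mul_sum, ← Finset.sum_add_distrib]
    apply Finset.sum_congr rfl
    intro r _
    have : ∑ n ∈ (Finset.Ioc X Y).filter (fun n => n ≡ r [MOD q]), (LL L n : ℂ) * GC g q n =
        (Sr r : ℂ) * GC g q r := by
      simp only [hSr]
      push_cast
      rw [Finset.sum_mul]
      apply Finset.sum_congr rfl
      intro n hn
      rw [GC_per g q hper n r (Finset.mem_filter.1 hn).2]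
    rw [this]
    push_cast
    ring
  rw [e1]
  have hERR0 : 0 ≤ ERR N D q H := (abs_nonneg _).trans (sum_LL_class X Y N D q 1 hXY hYN d1 d2 hq (by simp))
  have p1 : ‖((H / q * c : ℝ) : ℂ) * ∑ r ∈ Finset.range q, GC g q r‖ ≤ 61 * ε * L * H := by
    rw [norm_mul, Complex.norm_real, Real.norm_eq_abs]
    calc _ ≤ |H / q * c| * (ε * Nat.totient q) := by gcongr
      _ = (H * ε) * |(Nat.totient q : ℝ) / q * c| := by
        rw [abs_mul, abs_mul, abs_of_nonneg (by positivity : 0 ≤ H / q),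
          abs_of_nonneg (by positivity : 0 ≤ (Nat.totient q : ℝ) / q)]
        ring
      _ ≤ (H * ε) * (61 * L) := by gcongr
      _ = _ := by ring
  have p2 : ‖∑ r ∈ Finset.range q, ((Sr r - H / q * c : ℝ) : ℂ) * GC g q r‖ ≤ ε * L * H := by
    refine le_trans ?_ d3
    calc _ ≤ ∑ r ∈ Finset.range q, ERR N D q H := by
          refine (norm_sum_le _ _).trans (Finset.sum_le_sum ?_)
          intro r _
          rw [norm_mul, Complex.norm_real, Real.norm_eq_abs]
          by_cases hr : Nat.Coprime r q
          · have := sum_LL_class X Y N D q r hXY hYN d1 d2 hq hr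
            calc _ ≤ ERR N D q H * 1 := mul_le_mul this (GC_norm g q r) (norm_nonneg _) hERR0
              _ = _ := mul_one _
          · unfold GC
            rw [if_neg hr]
            simpa using hERR0
      _ = _ := by rw [Finset.sum_const, Finset.card_range, nsmul_eq_mul]
  refine (norm_add_le _ _).trans ((add_le_add p1 p2).trans (le_of_eq ?_))
  ring

lemma arithB (ε H l L NN : ℝ) (K : ℕ) (x : ℝ) (hε : 0 < ε) (hH : 0 < H) (hl : 1 ≤ l) (hL : 1 ≤ L)
    (hx0 : 0 ≤ x) (hx : x ≤ L) (hN : NN ≤ H * l ^ K) (hl2 : 20 ≤ ε * l) :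
    (7688 * ε * H / l ^ (K + 4) + 4 * l ^ 2 * NN / (l ^ (K + 4)) ^ 2) * (1 + 4 * l ^ (K + 4) * x) ≤
      38441 * ε * H * L := by
  have hlp : 0 < l := by linarith
  set w := l ^ (K + 4) with hw
  have hw1 : 1 ≤ w := one_le_pow₀ hl
  have hwp : 0 < w := by linarith
  have h1 : 1 + 4 * w * x ≤ 5 * w * L := by
    have a1 : w * x ≤ w * L := by gcongr
    have a2 : 1 ≤ w * L := by nlinarith
    linarith
  have h2 : 4 * l ^ 2 * NN / w ^ 2 ≤ ε / 5 * H / w := by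
    have b1 : 4 * l ^ 2 * NN ≤ 4 * l ^ 2 * (H * l ^ K) := by gcongr
    have b2 : 4 * l ^ 2 * (H * l ^ K) * l ^ 2 = 4 * H * w := by rw [hw]; ring
    rw [div_le_div_iff₀ (by positivity) hwp]
    have b3 : 4 ≤ ε / 5 * l := by linarith
    have b4 : 4 ≤ ε / 5 * l ^ 2 := by
      have : l ≤ l ^ 2 := by nlinarith
      have := mul_le_mul_of_nonneg_left this (by positivity : 0 ≤ ε / 5)
      linarith
    have b5 : 4 * H * w ≤ (ε / 5 * l ^ 2) * H * w := by gcongr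
    have b6 : (4 * l ^ 2 * NN) * l ^ 2 ≤ (ε / 5 * H * w) * l ^ 2 := by
      calc _ ≤ 4 * l ^ 2 * (H * l ^ K) * l ^ 2 := by gcongr
        _ = 4 * H * w := b2
        _ ≤ _ := b5
        _ = _ := by ring
    have b7 := le_of_mul_le_mul_right b6 (by positivity)
    calc _ ≤ (ε / 5 * H * w) * w := by gcongr
      _ = _ := by ring
  calc _ ≤ (7688 * ε * H / w + ε / 5 * H / w) * (5 * w * L) := by gcongr
    _ = 38441 * ε * H * L := by field_simp; norm_num

lemma divdiv (N A0 A1 : ℕ) (h : A1 = N / A0) (h0 : 0 < A0) (h1 : 0 < A1) : N / A1 ≤ 2 * A0 := by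
  have h2 : N < A0 * (N / A0 + 1) := Nat.lt_mul_div_succ N h0
  rw [← h] at h2
  have h3 : N < (2 * A0 + 1) * A1 := by nlinarith
  exact Nat.le_of_lt_succ ((Nat.div_lt_iff_lt_mul h1).2 h3)

lemma four_sq (N t : ℝ) (h1 : t ^ 3 ≤ N) (ht : 1 ≤ t) (h64 : 64 ≤ N) : 4 * t ^ 2 ≤ N := by
  by_cases h : 4 ≤ t
  · calc 4 * t ^ 2 ≤ t * t ^ 2 := by gcongr
      _ = t ^ 3 := by ring
      _ ≤ _ := h1
  · push Not at h
    nlinarith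

set_option maxHeartbeats 1000000 in
theorem major (j K : ℕ) (ε ε0 : ℝ) (hε : 0 < ε) (hε0 : 0 < ε0) : ∃ T : ℕ, ∀ᶠ N : ℕ in atTop,
    ∀ (θ : ℝ) (g : ℤ → ℝ) (q qk : ℕ) (a : ℤ) (X Y : ℕ),
    IsPoly (j + 1) θ g → θ = a / qk → IsCoprime a (qk:ℤ) → qk ∣ q → 0 < q → T ≤ qk →
    (∀ m n : ℤ, m ≡ n [ZMOD q] → e (g m) = e (g n)) → (q:ℝ) ≤ (ell N : ℝ) ^ K →
    X ≤ Y → Y ≤ N → ε0 * N ≤ X → (N:ℝ) ≤ ((Y:ℝ) - X) * (ell N : ℝ) ^ K →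
    ‖∑ n ∈ Finset.Ioc X Y, (Λ n : ℂ) * e (g (n:ℤ))‖ ≤ ε * ((Y:ℝ) - X) := by
  set ε1 : ℝ := ε / 50000 with hε1
  have hε1p : 0 < ε1 := by positivity
  obtain ⟨T, hT⟩ := lemmaM j ε1 hε1p
  refine ⟨T, ?_⟩
  set E : ℕ := 3 + ⌈1 / ε1⌉₊ with hE
  have hEε : 1 / (E:ℝ) ≤ ε1 := by
    have h1 := Nat.le_ceil (1 / ε1)
    have h2 : 1 / ε1 ≤ E := by rw [hE]; push_cast; linarith
    rw [div_le_iff₀ (by rw [hE]; positivity)]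
    rw [div_le_iff₀ hε1p] at h2
    linarith
  have hE3 : 3 ≤ E := by omega
  have hEne : E ≠ 0 := by omega
  have hErp : (0:ℝ) < E := by exact_mod_cast (by omega : 0 < E)
  set c0 : ℝ := 10000 + 62 * |Real.log ε0| with hc0
  filter_upwards [major_LL K ε1 hε1p, block_brun K E, inner_brun K E, VV_split K E, from_selberg K ε0 hε0,
    ev_ell_ge 2, ev_ell_ge (20 / ε1), ev_ell_pow ((K + 4) * E) (2 ^ E), ev_log_ge (1 + c0 / ε1),
    ev_ell_pow (2 * K + 1) (2 / ε1), eventually_ge_atTop 64] with N hLL hBB hIB hV hS hl hl20 hNw hL hNq hN64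
  intro θ g q qk a X Y hg hθ hcop hdvd hq hTq hper hqK hXY hYN hX hH
  have hB : BM g q ε1 := fun u v h1 h2 h3 h4 => hT θ g q qk a u v hg hθ hcop hdvd hq hTq hper h1 h2 h3 h4
  have hLL' := hLL g q X Y hq hqK hper hB hXY hYN hH
  have hS' := hS X Y (GC g q) hXY hYN hX hH (GC_norm g q)
  have hc0p : 0 < c0 := by positivity
  have hc0ε : 0 < c0 / ε1 := by positivity
  set L := Real.log N with hLd
  have hL1 : 1 ≤ L := by linarith
  have hlL : L ≤ ell N := log_le_ell N
  have hll : (1:ℝ) ≤ ell N := by linarith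
  have hlp : (0:ℝ) < ell N := by linarith
  have hN0 : 0 < N := by omega
  have hNr : (0:ℝ) < N := by exact_mod_cast hN0
  set H : ℝ := (Y:ℝ) - X with hHd
  have hHp : 0 < H := by
    by_contra hcon
    push Not at hcon
    have : H * (ell N : ℝ) ^ K ≤ 0 := mul_nonpos_of_nonpos_of_nonneg hcon (by positivity)
    linarith
  have hφ : (0:ℝ) < Nat.totient q := by exact_mod_cast Nat.totient_pos.2 hq
  -- choice of A0
  set t : ℝ := (N:ℝ) ^ ((1:ℝ) / E) with ht
  have htE : t ^ E = N := by
    rw [ht, ← Real.rpow_natCast, ← Real.rpow_mul hNr.le, one_div_mul_cancel hErp.ne', Real.rpow_one]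
  have ht1 : 1 ≤ t := Real.one_le_rpow (by exact_mod_cast hN0) (by positivity)
  set A0 : ℕ := ⌈t⌉₊ with hA0
  have hA0t : t ≤ A0 := Nat.le_ceil t
  have hA02t : (A0:ℝ) ≤ 2 * t := by
    have := Nat.ceil_lt_add_one (by linarith : 0 ≤ t)
    linarith
  have hNA0 : N ≤ A0 ^ E := by
    have : (N:ℝ) ≤ (A0:ℝ) ^ E := by rw [← htE]; exact pow_le_pow_left₀ (by linarith) hA0t E
    exact_mod_cast this
  have hA0r1 : (1:ℝ) ≤ A0 := by linarith
  have hA0p : 0 < A0 := by exact_mod_cast (lt_of_lt_of_le one_pos hA0r1)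
  have hA0sq : A0 * A0 ≤ N := by
    have h1 : t ^ 3 ≤ N := by rw [← htE]; exact pow_le_pow_right₀ ht1 hE3
    have h4 : 4 * t ^ 2 ≤ N := by
      exact four_sq N t h1 ht1 (by exact_mod_cast hN64)
    have : (A0:ℝ) * A0 ≤ N := by
      calc (A0:ℝ) * A0 ≤ (2 * t) * (2 * t) := by gcongr
        _ = 4 * t ^ 2 := by ring
        _ ≤ N := h4
    exact_mod_cast this
  have hlogA0 : Real.log A0 ≤ ε1 * L + 1 := by
    have h1 : Real.log A0 ≤ Real.log (2 * t) := Real.log_le_log (by linarith) hA02t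
    rw [Real.log_mul (by norm_num) (by linarith), ht, Real.log_rpow hNr] at h1
    have h2 := Real.log_two_lt_d9
    have h3 : 1 / (E:ℝ) * L ≤ ε1 * L := by gcongr
    linarith
  have hw2 : 2 * ell N ^ (K + 4) ≤ A0 := by
    have : (2 * ell N ^ (K + 4)) ^ E ≤ A0 ^ E := by
      refine le_trans ?_ hNA0
      have : (((2 * ell N ^ (K + 4)) ^ E : ℕ) : ℝ) ≤ N := by
        push_cast
        rw [mul_pow, ← pow_mul]
        exact hNw
      exact_mod_cast this
    exact (Nat.pow_le_pow_iff_left hEne).1 this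
  set w : ℕ := ell N ^ (K + 4) with hw
  have hwp : 0 < w := by
    have : 0 < ell N := by exact_mod_cast hlp
    positivity
  have hwr : (w:ℝ) = (ell N : ℝ) ^ (K + 4) := by rw [hw]; push_cast; rfl
  set A1 : ℕ := N / A0 with hA1
  have hA01 : A0 ≤ A1 := (Nat.le_div_iff_mul_le hA0p).2 hA0sq
  have hA1p : 0 < A1 := lt_of_lt_of_le hA0p hA01
  have hA1N : A1 ≤ N := Nat.div_le_self _ _
  have hA1A0 : A1 * A0 ≤ N := Nat.div_mul_le_self N A0
  have hA1r : (0:ℝ) < A1 := by exact_mod_cast hA1p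
  have hA1one : (1:ℝ) ≤ A1 := by exact_mod_cast hA1p
  have hpowA1 : N ≤ (N / A0) ^ E := hNA0.trans (Nat.pow_le_pow_left hA01 E)
  have hNA1p : 0 < N / A1 := Nat.div_pos hA1N hA1p
  have hpowNA1 : N ≤ (N / (N / A1)) ^ E := by
    refine hpowA1.trans (Nat.pow_le_pow_left ?_ E)
    rw [Nat.le_div_iff_mul_le hNA1p]
    exact Nat.mul_div_le N A1
  have hlogNA1 : Real.log (N / A1 : ℕ) ≤ ε1 * L + 2 := by
    have h2 : N / A1 ≤ 2 * A0 := divdiv N A0 A1 hA1 hA0p hA1p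
    have h3 : Real.log (N / A1 : ℕ) ≤ Real.log (2 * A0) :=
      Real.log_le_log (by exact_mod_cast hNA1p) (by exact_mod_cast h2)
    rw [Real.log_mul (by norm_num) (by linarith)] at h3
    have h4 := Real.log_two_lt_d9
    linarith
  -- middle part
  set Ψ : ℕ → ℕ → ℂ := fun a b => if a ≤ N ∧ b ≤ N then (Λ a : ℂ) * Λ b * GC g q (a * b) else 0 with hΨ
  have hΛ : ∀ n, n ≤ N → Λ n ≤ ell N := by
    intro n hn
    refine vonMangoldt_le_log.trans ?_
    rcases Nat.eq_zero_or_pos n with h | h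
    · rw [h]; simp
    · exact (Real.log_le_log (by exact_mod_cast h) (by exact_mod_cast hn)).trans hlL
  have hΨ1 : ∀ a b, ‖Ψ a b‖ ≤ (ell N : ℝ) ^ 2 := by
    intro a b
    simp only [hΨ]
    split_ifs with h
    · rw [norm_mul, norm_mul, Complex.norm_real, Complex.norm_real, Real.norm_of_nonneg vonMangoldt_nonneg,
        Real.norm_of_nonneg vonMangoldt_nonneg]
      calc _ ≤ (ell N : ℝ) * ell N * 1 := by
            have := vonMangoldt_nonneg (n := a)
            have := vonMangoldt_nonneg (n := b)
            gcongr
            · exact hΛ a h.1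
            · exact hΛ b h.2
            · exact GC_norm _ _ _
        _ = _ := by ring
    · simp only [norm_zero]; positivity
  have hmid : ‖∑ a ∈ Finset.Ioc A0 A1, ∑ b ∈ Finset.Ioc (X / a) (Y / a), Ψ a b‖ ≤ 38441 * ε1 * H * L := by
    have hyp : ∀ A A', A0 ≤ A → A < A' → A' ≤ A1 → A' ≤ A + A / w →
      ‖∑ a ∈ Finset.Ioc A A', ∑ b ∈ Finset.Ioc (X / A) (Y / A), Ψ a b‖ ≤ 7688 * ε1 * H / (ell N : ℝ) ^ (K + 4) := by
      intro A A' hA hAA' hA' hAw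
      have hAp : 0 < A := lt_of_lt_of_le hA0p hA
      have hAr : (0:ℝ) < A := by exact_mod_cast hAp
      have heq : ∑ a ∈ Finset.Ioc A A', ∑ b ∈ Finset.Ioc (X / A) (Y / A), Ψ a b =
          ∑ a ∈ Finset.Ioc A A', ∑ b ∈ Finset.Ioc (X / A) (Y / A), (Λ a : ℂ) * Λ b * GC g q (a * b) := by
        apply Finset.sum_congr rfl
        intro a ha
        apply Finset.sum_congr rfl
        intro b hb
        rw [Finset.mem_Ioc] at ha hb
        simp only [hΨ]
        rw [if_pos ⟨ha.2.trans (hA'.trans hA1N), hb.2.trans ((Nat.div_le_self _ _).trans hYN)⟩]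
      rw [heq]
      have hNA : N ≤ (N / A) ^ E := by
        refine hNA0.trans (Nat.pow_le_pow_left ?_ E)
        rw [Nat.le_div_iff_mul_le hAp]
        calc A0 * A ≤ A0 * A1 := Nat.mul_le_mul_left _ (by omega)
          _ = A1 * A0 := Nat.mul_comm _ _
          _ ≤ N := hA1A0
      have := bil_class g q ε1 hq hper hB (Finset.Ioc A A') (Finset.Ioc (X / A) (Y / A))
        (62 * ((A:ℝ) / (ell N : ℝ) ^ (K + 4)) / Nat.totient q) (124 * (H / A) / Nat.totient q)
        (by positivity) (by positivity)
        (fun r hr => hBB A A' q r (hNA0.trans (Nat.pow_le_pow_left hA E)) hq hqK hr (hw2.trans hA) hAw)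
        (fun r hr => hIB A q r X Y hAp hNA hq hqK hr hXY hYN hH)
      refine this.trans (le_of_eq ?_)
      field_simp
      norm_num
    have hb := block Ψ ((ell N : ℝ) ^ 2) (7688 * ε1 * H / (ell N : ℝ) ^ (K + 4)) (by positivity) (by positivity) hΨ1
      X Y N w A0 A1 hXY hYN hwp (by omega) (by
        calc A1 * w ≤ A1 * A0 := Nat.mul_le_mul_left _ (by omega)
          _ ≤ N := hA1A0) hyp hA01
    refine hb.trans ?_
    rw [hwr]
    apply arithB ε1 H (ell N) L N K _ hε1p hHp hll hL1 _ _ hH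
    · rw [div_le_iff₀ hε1p] at hl20; linarith
    · apply Real.log_nonneg
      rw [le_div_iff₀ (by linarith), one_mul]
      exact_mod_cast hA01
    · apply Real.log_le_log (by positivity)
      rw [div_le_iff₀ (by linarith)]
      have : (A1:ℝ) ≤ N := by exact_mod_cast hA1N
      exact this.trans (le_mul_of_one_le_right hNr.le hA0r1)
  have hVV := hV A0 A1 X Y (GC g q) hA0p hA01 hA1N hpowA1 hpowNA1 hXY hYN hH (GC_norm g q)
  have heq2 : ∑ a ∈ Finset.Ioc A0 A1, ∑ b ∈ Finset.Ioc (X / a) (Y / a), (Λ a : ℂ) * Λ b * GC g q (a * b) =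
      ∑ a ∈ Finset.Ioc A0 A1, ∑ b ∈ Finset.Ioc (X / a) (Y / a), Ψ a b := by
    apply Finset.sum_congr rfl
    intro a ha
    apply Finset.sum_congr rfl
    intro b hb
    rw [Finset.mem_Ioc] at ha hb
    simp only [hΨ]
    rw [if_pos ⟨ha.2.trans hA1N, hb.2.trans ((Nat.div_le_self _ _).trans hYN)⟩]
  rw [heq2] at hVV
  -- combine
  have hc0L : c0 ≤ ε1 * L := by
    have : c0 / ε1 ≤ L := by linarith
    rw [div_le_iff₀ hε1p] at this
    linarith
  have hG : ‖∑ n ∈ Finset.Ioc X Y, (Λ n : ℂ) * GC g q n‖ ≤ 40000 * ε1 * H := by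
    have hL0 : 0 < L := by linarith
    refine le_of_mul_le_mul_left (hS'.trans ?_) hL0
    have f1 : 124 * H * (Real.log A0 + 6) ≤ 124 * H * (ε1 * L + 1 + 6) := by gcongr
    have f2 : 124 * H * (Real.log (N / A1 : ℕ) + 6) ≤ 124 * H * (ε1 * L + 2 + 6) := by gcongr
    have f3 : c0 * H ≤ ε1 * L * H := by gcongr
    have f4 : c0 * H = 10000 * H + |Real.log ε0| * (62 * H) := by rw [hc0]; ring
    have f5 : 0 ≤ ε1 * L * H := by positivity
    linarith
  -- remove coprimality
  have hrem : ‖∑ n ∈ Finset.Ioc X Y, (Λ n : ℂ) * (e (g (n:ℤ)) - GC g q n)‖ ≤ ε1 * H := by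
    have k1 : ‖∑ n ∈ Finset.Ioc X Y, (Λ n : ℂ) * (e (g (n:ℤ)) - GC g q n)‖ ≤
        ∑ n ∈ (Finset.Ioc 0 N).filter (fun n => ¬ Nat.Coprime n q), Λ n := by
      refine (norm_sum_le _ _).trans ?_
      rw [Finset.sum_filter]
      calc _ ≤ ∑ n ∈ Finset.Ioc X Y, (if ¬ Nat.Coprime n q then Λ n else 0) := by
            apply Finset.sum_le_sum
            intro n _
            unfold GC
            split_ifs with h
            · simp
            · rw [sub_zero, norm_mul, norm_e, mul_one, Complex.norm_real, Real.norm_of_nonneg vonMangoldt_nonneg]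
        _ ≤ _ := by
            apply Finset.sum_le_sum_of_subset_of_nonneg
            · exact Finset.Ioc_subset_Ioc (Nat.zero_le _) hYN
            · intro _ _ _
              split_ifs
              · exact le_rfl
              · exact vonMangoldt_nonneg
    refine k1.trans ((noncop N q hN0 hq).trans ?_)
    have k2 : Real.log q ≤ (ell N : ℝ) ^ K := (Real.log_le_self (by positivity)).trans hqK
    have k3 : 2 * L * Real.log q ≤ 2 * ell N * (ell N : ℝ) ^ K := by
      have := Real.log_natCast_nonneg q
      gcongr
    refine k3.trans ?_
    have k4 : (2 / ε1 * (ell N : ℝ) ^ (K + 1)) * (ell N : ℝ) ^ K ≤ H * (ell N : ℝ) ^ K := by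
      calc _ = 2 / ε1 * (ell N : ℝ) ^ (2 * K + 1) := by rw [mul_assoc, ← pow_add]; congr 2; ring
        _ ≤ _ := hNq.trans hH
    have k5 := le_of_mul_le_mul_right k4 (by positivity)
    calc 2 * ell N * (ell N : ℝ) ^ K = ε1 * (2 / ε1 * (ell N : ℝ) ^ (K + 1)) := by field_simp; ring
      _ ≤ _ := by gcongr
  have hsplit : ∑ n ∈ Finset.Ioc X Y, (Λ n : ℂ) * e (g (n:ℤ)) =
      ∑ n ∈ Finset.Ioc X Y, (Λ n : ℂ) * GC g q n +
      ∑ n ∈ Finset.Ioc X Y, (Λ n : ℂ) * (e (g (n:ℤ)) - GC g q n) := by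
    rw [← Finset.sum_add_distrib]
    apply Finset.sum_congr rfl
    intro n _
    ring
  rw [hsplit]
  refine (norm_add_le _ _).trans ((add_le_add hG hrem).trans ?_)
  have : ε = 50000 * ε1 := by rw [hε1]; ring
  rw [this]
  have : 0 ≤ ε1 * H := by positivity
  linarith

end UDP

namespace UDP
open ArithmeticFunction

lemma strips (F : ℕ → ℂ) (W : ℕ → ℝ) (N h : ℕ) (M : ℝ) (hh : 0 < h) (hM : 0 ≤ M) (hW : ∀ n, 0 ≤ W n)
    (hF : ∀ n, n ≤ N → ‖F n‖ ≤ M) (m : ℕ) : ∀ X : ℕ, N ≤ X + m * h → X ≤ N →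
    (∀ X', X ≤ X' → X' + h ≤ N → ‖∑ n ∈ Finset.Ioc X' (X' + h), F n‖ ≤ ∑ n ∈ Finset.Ioc X' (X' + h), W n) →
    ‖∑ n ∈ Finset.Ioc X N, F n‖ ≤ ∑ n ∈ Finset.Ioc X N, W n + M * h := by
  induction m with
  | zero =>
    intro X h1 h2 _
    have : X = N := by omega
    subst this
    simp
    positivity
  | succ m ih =>
    intro X h1 h2 hyp
    by_cases hX : X + h ≤ N
    · have h3 := ih (X + h) (by rw [Nat.succ_mul] at h1; omega) hX (fun X' a b => hyp X' (by omega) b)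
      rw [← Finset.sum_Ioc_consecutive F (Nat.le_add_right X h) hX,
        ← Finset.sum_Ioc_consecutive W (Nat.le_add_right X h) hX, add_assoc]
      exact (norm_add_le _ _).trans (add_le_add (hyp X le_rfl hX) h3)
    · have h4 : ‖∑ n ∈ Finset.Ioc X N, F n‖ ≤ M * h := by
        calc _ ≤ ∑ n ∈ Finset.Ioc X N, M := by
              refine (norm_sum_le _ _).trans (Finset.sum_le_sum ?_)
              intro n hn
              exact hF n (Finset.mem_Ioc.1 hn).2
          _ = (N - X : ℕ) * M := by rw [Finset.sum_const, Nat.card_Ioc, nsmul_eq_mul]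
          _ ≤ h * M := by
              gcongr
              omega
          _ = _ := mul_comm _ _
      have h5 : 0 ≤ ∑ n ∈ Finset.Ioc X N, W n := Finset.sum_nonneg fun n _ => hW n
      linarith

lemma pow_diff (N x y : ℝ) (hx : 0 ≤ x) (hxy : x ≤ y) (hy : y ≤ N) (i : ℕ) :
    N * (y ^ i - x ^ i) ≤ i * N ^ i * (y - x) := by
  induction i with
  | zero => simp
  | succ i ih =>
    have hN : 0 ≤ N := by linarith
    have hyx : 0 ≤ y - x := by linarith
    have h1 : y * (N * (y ^ i - x ^ i)) ≤ N * (i * N ^ i * (y - x)) :=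
      mul_le_mul hy ih (mul_nonneg hN (sub_nonneg.2 (pow_le_pow_left₀ hx hxy i))) hN
    have h2 : N * x ^ i * (y - x) ≤ N * N ^ i * (y - x) := by
      gcongr
      linarith
    calc N * (y ^ (i + 1) - x ^ (i + 1)) = y * (N * (y ^ i - x ^ i)) + N * x ^ i * (y - x) := by ring
      _ ≤ N * (i * N ^ i * (y - x)) + N * N ^ i * (y - x) := by linarith
      _ = _ := by push_cast; ring

/-- polynomial phase -/
def pol (k : ℕ) (α : ℕ → ℝ) (x : ℝ) : ℝ := ∑ i ∈ Finset.range (k + 1), α i * x ^ i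

/-- replace coefficients above j by rationals with denominator q -/
def repl (α : ℕ → ℝ) (a : ℕ → ℤ) (q j i : ℕ) : ℝ := if i ≤ j then α i else (a i : ℝ) / q

lemma strip_approx (k j : ℕ) (α : ℕ → ℝ) (a : ℕ → ℤ) (q N X n h : ℕ) (Q : ℝ) (hQ : 0 ≤ Q) (hN : 0 < N)
    (hα : ∀ i, j < i → i ≤ k → |α i - a i / q| ≤ Q / (N:ℝ) ^ i) (hX : X ≤ n) (hn : n ≤ X + h) (hnN : n ≤ N) :
    ‖e (pol k α n) - e (pol k α X - pol k (repl α a q j) X) * e (pol k (repl α a q j) n)‖ ≤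
      2 * Real.pi * ((k + 1) ^ 2 * Q * h / N) := by
  rw [← e_add]
  refine (norm_e_sub_le _ _).trans ?_
  gcongr
  have hNr : (0:ℝ) < N := by exact_mod_cast hN
  have hXn : (X:ℝ) ≤ n := by exact_mod_cast hX
  have hnN' : (n:ℝ) ≤ N := by exact_mod_cast hnN
  have hnh : (n:ℝ) - X ≤ h := by
    have : (n:ℝ) ≤ X + h := by exact_mod_cast hn
    linarith
  have e1 : pol k α n - (pol k α X - pol k (repl α a q j) X + pol k (repl α a q j) n) =
      ∑ i ∈ Finset.range (k + 1), (α i - repl α a q j i) * ((n:ℝ) ^ i - (X:ℝ) ^ i) := by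
    unfold pol
    rw [← Finset.sum_sub_distrib, ← Finset.sum_add_distrib, ← Finset.sum_sub_distrib]
    apply Finset.sum_congr rfl
    intro i _
    ring
  rw [e1]
  calc _ ≤ ∑ i ∈ Finset.range (k + 1), ((k + 1) * Q * h / N : ℝ) := by
        refine (Finset.abs_sum_le_sum_abs _ _).trans (Finset.sum_le_sum ?_)
        intro i hi
        rw [Finset.mem_range] at hi
        by_cases hij : i ≤ j
        · rw [repl, if_pos hij, sub_self, zero_mul, abs_zero]
          positivity
        · rw [repl, if_neg hij, abs_mul]
          have h1 := hα i (by omega) (by omega)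
          have h2 := pow_diff N X n (Nat.cast_nonneg _) hXn hnN' i
          have h3 : 0 ≤ (n:ℝ) ^ i - (X:ℝ) ^ i := sub_nonneg.2 (pow_le_pow_left₀ (Nat.cast_nonneg _) hXn i)
          rw [abs_of_nonneg h3]
          have h4 : (n:ℝ) ^ i - (X:ℝ) ^ i ≤ (k + 1) * (N:ℝ) ^ i * h / N := by
            rw [le_div_iff₀ hNr, mul_comm]
            refine h2.trans ?_
            have : (i:ℝ) ≤ k + 1 := by exact_mod_cast hi.le
            gcongr
          calc _ ≤ Q / (N:ℝ) ^ i * ((k + 1) * (N:ℝ) ^ i * h / N) := by gcongr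
            _ = _ := by field_simp
    _ = _ := by
        rw [Finset.sum_const, Finset.card_range, nsmul_eq_mul]
        push_cast
        ring

lemma assemble (k B : ℕ) (ε ε0 : ℝ) (hε : 0 < ε) (hε0 : 0 < ε0) (hε01 : ε0 ≤ 1) : ∀ᶠ N : ℕ in atTop,
    ∀ (α : ℕ → ℝ) (a : ℕ → ℤ) (j q : ℕ),
    (∀ i, j < i → i ≤ k → |α i - a i / q| ≤ (ell N : ℝ) ^ B / (N:ℝ) ^ i) →
    (∀ X Y : ℕ, X ≤ Y → Y ≤ N → ε0 * N ≤ X → (N:ℝ) ≤ ((Y:ℝ) - X) * (ell N : ℝ) ^ (B + 3) →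
      ‖∑ n ∈ Finset.Ioc X Y, (Λ n : ℂ) * e (pol k (repl α a q j) n)‖ ≤ ε * ((Y:ℝ) - X)) →
    ‖∑ n ∈ Finset.Ioc 0 N, (Λ n : ℂ) * e (pol k α n)‖ ≤ (6 * ε0 + 4 * ε) * N := by
  filter_upwards [ev_ell_pow (B + 2) 2, ev_ell_ge 2, ev_ell_ge (1 / ε), ev_ell_ge (50 * (k + 1) ^ 2 / ε), eventually_gt_atTop 0,
    eventually_ge_atTop ⌈6 / ε⌉₊] with N hN2 hl2 hlε hlk hN0 hN6
  intro α a j q hα hyp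
  have hNr : (0:ℝ) < N := by exact_mod_cast hN0
  have hl1 : (1:ℝ) ≤ ell N := by linarith
  have hlp : (0:ℝ) < ell N := by linarith
  have hlN : 0 < ell N := by exact_mod_cast hlp
  obtain ⟨d1, d2, d3⟩ := div_ell_pos N (ell N ^ (B + 2)) (by positivity) (by exact_mod_cast hN2)
  set h := N / ell N ^ (B + 2) with hh
  have hhr : (0:ℝ) < h := by exact_mod_cast d1
  have hhle : (h:ℝ) * (ell N : ℝ) ^ (B + 2) ≤ N := by
    have := Nat.div_mul_le_self N (ell N ^ (B + 2))
    exact_mod_cast this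
  have hhge : (N:ℝ) ≤ h * (ell N : ℝ) ^ (B + 3) := by
    rw [div_le_iff₀ hhr] at d3
    refine d3.trans ?_
    push_cast
    calc 2 * (ell N : ℝ) ^ (B + 2) * h ≤ ell N * (ell N : ℝ) ^ (B + 2) * h := by gcongr
      _ = _ := by ring
  set X0 := ⌈ε0 * N⌉₊ with hX0
  have hX0N : X0 ≤ N := by
    rw [hX0, Nat.ceil_le]
    exact mul_le_of_le_one_left hNr.le hε01
  have hX0le : (X0:ℝ) ≤ ε0 * N + 1 := (Nat.ceil_lt_add_one (by positivity)).le
  have hX0ge : ε0 * N ≤ X0 := Nat.le_ceil _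
  set η : ℝ := 2 * Real.pi * ((k + 1) ^ 2 * (ell N : ℝ) ^ B * h / N) with hη
  have hη0 : 0 ≤ η := by positivity
  have hΛ : ∀ n, n ≤ N → Λ n ≤ ell N := by
    intro n hn
    refine vonMangoldt_le_log.trans ?_
    rcases Nat.eq_zero_or_pos n with h | h
    · rw [h]; simp
    · exact (Real.log_le_log (by exact_mod_cast h) (by exact_mod_cast hn)).trans (log_le_ell N)
  have hnorm : ∀ n, ‖(Λ n : ℂ) * e (pol k α n)‖ = Λ n := by
    intro n
    rw [norm_mul, norm_e, mul_one, Complex.norm_real, Real.norm_of_nonneg vonMangoldt_nonneg]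
  have main := strips (fun n => (Λ n : ℂ) * e (pol k α n)) (fun n => ε + η * Λ n) N h (ell N) d1 hlp.le
    (fun n => by have := vonMangoldt_nonneg (n := n); positivity)
    (fun n hn => by rw [hnorm]; exact hΛ n hn) N X0 (by nlinarith) hX0N (by
      intro X hX hXN
      have e1 := hyp X (X + h) (Nat.le_add_right _ _) hXN (hX0ge.trans (by exact_mod_cast hX))
        (by push_cast; rw [add_sub_cancel_left]; exact hhge)
      have e2 : ∑ n ∈ Finset.Ioc X (X + h), (Λ n : ℂ) * e (pol k α n) =
          e (pol k α X - pol k (repl α a q j) X) * ∑ n ∈ Finset.Ioc X (X + h), (Λ n : ℂ) * e (pol k (repl α a q j) n) +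
          ∑ n ∈ Finset.Ioc X (X + h), (Λ n : ℂ) * (e (pol k α n) - e (pol k α X - pol k (repl α a q j) X) * e (pol k (repl α a q j) n)) := by
        rw [Finset.mul_sum, ← Finset.sum_add_distrib]
        apply Finset.sum_congr rfl
        intro n _
        ring
      rw [e2, Finset.sum_add_distrib]
      refine (norm_add_le _ _).trans (add_le_add ?_ ?_)
      · rw [norm_mul, norm_e, one_mul, Finset.sum_const, Nat.card_Ioc, nsmul_eq_mul]
        refine e1.trans (le_of_eq ?_)
        push_cast
        rw [add_sub_cancel_left]
        simp [mul_comm]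
      · refine (norm_sum_le _ _).trans (Finset.sum_le_sum ?_)
        intro n hn
        rw [Finset.mem_Ioc] at hn
        rw [norm_mul, Complex.norm_real, Real.norm_of_nonneg vonMangoldt_nonneg, mul_comm]
        exact mul_le_mul_of_nonneg_right (strip_approx k j α a q N X n h _ (by positivity) hN0 hα hn.1.le hn.2 (hn.2.trans hXN))
          vonMangoldt_nonneg)
  rw [← Finset.sum_Ioc_consecutive _ (Nat.zero_le X0) hX0N]
  have m1 : ‖∑ n ∈ Finset.Ioc 0 X0, (Λ n : ℂ) * e (pol k α n)‖ ≤ 6 * X0 := by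
    refine (norm_sum_le _ _).trans ?_
    simp only [hnorm]
    exact psi_bound X0
  have m2 : ∑ n ∈ Finset.Ioc X0 N, (ε + η * Λ n) ≤ ε * N + η * (6 * N) := by
    calc _ ≤ ∑ n ∈ Finset.Ioc 0 N, (ε + η * Λ n) := by
          apply Finset.sum_le_sum_of_subset_of_nonneg
          · exact Finset.Ioc_subset_Ioc_left (Nat.zero_le _)
          · intro n _ _
            have := vonMangoldt_nonneg (n := n)
            positivity
      _ = ε * N + η * ∑ n ∈ Finset.Ioc 0 N, Λ n := by
          rw [Finset.sum_add_distrib, ← Finset.mul_sum, Finset.sum_const, Nat.card_Ioc, nsmul_eq_mul]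
          simp [mul_comm]
      _ ≤ _ := by
          gcongr
          exact psi_bound N
  have m3 : η * (6 * N) ≤ ε * N := by
    have b1 : (ell N : ℝ) ^ B * h * ell N ≤ N := by
      refine le_trans ?_ hhle
      calc (ell N : ℝ) ^ B * h * ell N = h * (ell N : ℝ) ^ (B + 1) := by ring
        _ ≤ _ := by gcongr <;> omega
    have b2 : 50 * ((k:ℝ) + 1) ^ 2 ≤ ε * ell N := by
      rw [div_le_iff₀ hε] at hlk; linarith
    have b3 : η * (6 * N) = (12 * Real.pi * (k + 1) ^ 2) * ((ell N : ℝ) ^ B * h) := by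
      rw [hη]; field_simp; ring
    rw [b3]
    have b4 : 12 * Real.pi * ((k:ℝ) + 1) ^ 2 ≤ ε * ell N := by
      refine le_trans ?_ b2
      have := Real.pi_lt_d2
      gcongr
      linarith
    calc _ ≤ (ε * ell N) * ((ell N : ℝ) ^ B * h) := by gcongr
      _ = ε * ((ell N : ℝ) ^ B * h * ell N) := by ring
      _ ≤ _ := by gcongr
  have m4 : (ell N : ℝ) * h ≤ ε * N := by
    have b1 : (1:ℝ) ≤ ε * ell N := by rw [div_le_iff₀ hε] at hlε; linarith
    calc (ell N : ℝ) * h = 1 * (ell N * h) := (one_mul _).symm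
      _ ≤ (ε * ell N) * (ell N * h) := by gcongr
      _ = ε * (h * (ell N : ℝ) ^ 2) := by ring
      _ ≤ ε * (h * (ell N : ℝ) ^ (B + 2)) := by gcongr <;> omega
      _ ≤ _ := by gcongr
  have m5 : (6:ℝ) ≤ ε * N := by
    have : 6 / ε ≤ N := (Nat.le_ceil _).trans (by exact_mod_cast hN6)
    rw [div_le_iff₀ hε] at this
    linarith
  refine (norm_add_le _ _).trans ((add_le_add m1 main).trans ?_)
  linarith

end UDP

namespace UDP
open ArithmeticFunction

lemma irr_gap (α : ℝ) (h : Irrational α) (T : ℕ) : ∃ c : ℝ, 0 < c ∧ ∀ m : ℕ, 0 < m → m < T → ∀ a : ℤ,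
    c ≤ |m * α - a| := by
  induction T with
  | zero => exact ⟨1, one_pos, fun m _ hm => by omega⟩
  | succ T ih =>
    obtain ⟨c, hc, hcm⟩ := ih
    rcases Nat.eq_zero_or_pos T with hT | hT
    · exact ⟨1, one_pos, fun m h0 hm => by omega⟩
    · have hp : 0 < |(T:ℝ) * α - round ((T:ℝ) * α)| := by
        rw [abs_pos, sub_ne_zero]
        exact (h.natCast_mul hT.ne').ne_int _
      refine ⟨min c |(T:ℝ) * α - round ((T:ℝ) * α)|, lt_min hc hp, ?_⟩
      intro m h0 hm a
      rcases Nat.lt_or_ge m T with h1 | h1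
      · exact (min_le_left _ _).trans (hcm m h0 h1 a)
      · have : m = T := by omega
        subst this
        exact (min_le_right _ _).trans (round_le _ a)

lemma ratper (s : Finset ℕ) (a : ℕ → ℤ) (q : ℕ) (hq : 0 < q) (m n : ℤ) (h : m ≡ n [ZMOD q]) :
    e (∑ i ∈ s, (a i : ℝ) / q * (m:ℝ) ^ i) = e (∑ i ∈ s, (a i : ℝ) / q * (n:ℝ) ^ i) := by
  have hqr : (q:ℝ) ≠ 0 := by exact_mod_cast hq.ne'
  have h1 : ∀ i, ∃ z : ℤ, m ^ i - n ^ i = q * z := fun i => (Int.ModEq.dvd (h.pow i).symm)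
  choose z hz using h1
  have h2 : ∑ i ∈ s, (a i : ℝ) / q * (m:ℝ) ^ i = ∑ i ∈ s, (a i : ℝ) / q * (n:ℝ) ^ i + ((∑ i ∈ s, a i * z i : ℤ) : ℝ) := by
    push_cast
    rw [← Finset.sum_add_distrib]
    apply Finset.sum_congr rfl
    intro i _
    have : (m:ℝ) ^ i - (n:ℝ) ^ i = q * z i := by exact_mod_cast hz i
    have e2 : (m:ℝ) ^ i = (n:ℝ) ^ i + q * z i := by linarith
    rw [e2]
    field_simp
  rw [h2, e_add_int]

/-- simultaneous rational approximation of the coefficients above j -/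
def Rt (α : ℕ → ℝ) (N B j k : ℕ) : Prop := ∃ q : ℕ, 0 < q ∧ (q:ℝ) ≤ (ell N : ℝ) ^ B ∧
  ∀ i, j < i → i ≤ k → Near (q * α i) ((ell N : ℝ) ^ B / (N:ℝ) ^ i)

lemma Rt_approx (α : ℕ → ℝ) (q j k : ℕ) (hq : 0 < q) (δ : ℕ → ℝ) (hδ : ∀ i, 0 ≤ δ i)
    (h : ∀ i, j < i → i ≤ k → Near (q * α i) (δ i)) :
    ∃ a : ℕ → ℤ, ∀ i, j < i → i ≤ k → |α i - a i / q| ≤ δ i := by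
  have hqr : (0:ℝ) < q := by exact_mod_cast hq
  have hq1 : (1:ℝ) ≤ q := by exact_mod_cast hq
  have : ∀ i, ∃ a : ℤ, j < i → i ≤ k → |α i - a / q| ≤ δ i := by
    intro i
    by_cases hi : j < i ∧ i ≤ k
    · obtain ⟨a, ha⟩ := h i hi.1 hi.2
      refine ⟨a, fun _ _ => ?_⟩
      have e1 : α i - a / q = (q * α i - a) / q := by field_simp
      rw [e1, abs_div, abs_of_pos hqr]
      exact (div_le_self (abs_nonneg _) hq1).trans ha
    · exact ⟨0, fun h1 h2 => absurd ⟨h1, h2⟩ hi⟩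
  choose a ha using this
  exact ⟨a, ha⟩

lemma pol_split (k j : ℕ) (α : ℕ → ℝ) (a : ℕ → ℤ) (q : ℕ) (hj : j ≤ k) (x : ℝ) :
    pol k (repl α a q j) x = ∑ i ∈ Finset.Ico (j + 1) (k + 1), (a i : ℝ) / q * x ^ i +
      ∑ i ∈ Finset.range (j + 1), α i * x ^ i := by
  unfold pol
  rw [← Finset.sum_range_add_sum_Ico _ (by omega : j + 1 ≤ k + 1), add_comm]
  congr 1
  · apply Finset.sum_congr rfl
    intro i hi
    rw [Finset.mem_Ico] at hi
    rw [repl, if_neg (by omega)]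
  · apply Finset.sum_congr rfl
    intro i hi
    rw [Finset.mem_range] at hi
    rw [repl, if_pos (by omega)]

lemma descend (k : ℕ) (α : ℕ → ℝ) (ε : ℝ) (hε : 0 < ε) (d : ℕ) : ∀ j, j + d = k → ∃ B : ℕ, ∀ᶠ N : ℕ in atTop,
    ‖∑ n ∈ Finset.Ioc 0 N, (Λ n : ℂ) * e (pol k α n)‖ ≤ ε * N ∨ Rt α N B j k := by
  induction d with
  | zero =>
    intro j hj
    refine ⟨0, Eventually.of_forall fun N => Or.inr ⟨1, one_pos, by simp, fun i h1 h2 => by omega⟩⟩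
  | succ d ih =>
    intro j hj
    obtain ⟨B, hB⟩ := ih (j + 1) (by omega)
    set ε0 : ℝ := min (ε / 12) 1 with hε0
    have hε0p : 0 < ε0 := lt_min (by positivity) one_pos
    obtain ⟨B', hm⟩ := minor j (B + 3) (ε / 8) ε0 (by positivity) hε0p
    refine ⟨B + B', ?_⟩
    filter_upwards [hB, hm, assemble k B (ε / 8) ε0 (by positivity) hε0p (min_le_right _ _), ev_ell_ge 1,
      eventually_gt_atTop 0] with N hN hmN hA hl hN0
    rcases hN with hN | ⟨q, hq, hqB, hnear⟩
    · exact Or.inl hN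
    by_cases hM : Maj ((ell N : ℝ) ^ B') N (j + 1) (α (j + 1))
    · right
      obtain ⟨q', hq', hqB', hnear'⟩ := hM
      refine ⟨q * q', by positivity, ?_, ?_⟩
      · push_cast
        rw [pow_add]
        gcongr
      · intro i h1 h2
        rcases Nat.lt_or_ge (j + 1) i with h3 | h3
        · have := (hnear i h3 h2).natMul q'
          have t : Near ((q':ℝ) * (q * α i)) ((ell N : ℝ) ^ (B + B') / (N:ℝ) ^ i) := by
            refine this.mono ?_
            rw [pow_add, mul_comm ((ell N : ℝ) ^ B), mul_div_assoc]
            gcongr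
          convert t using 1
          push_cast
          ring
        · have hi : i = j + 1 := by omega
          subst hi
          have := hnear'.natMul q
          have t : Near ((q:ℝ) * (q' * α (j + 1))) ((ell N : ℝ) ^ (B + B') / (N:ℝ) ^ (j + 1)) := by
            refine this.mono ?_
            rw [pow_add (ell N : ℝ) B B', mul_div_assoc]
            gcongr
          convert t using 1
          push_cast
          ring
    · left
      obtain ⟨a, ha⟩ := Rt_approx α q (j + 1) k hq (fun i => (ell N : ℝ) ^ B / (N:ℝ) ^ i) (fun i => by positivity) hnear
      have hfin := hA α a (j + 1) q ha (by
        intro X Y hXY hYN hX hH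
        have e1 := hmN (α (j + 1)) (fun n => ∑ i ∈ Finset.range (j + 1 + 1), α i * (n : ℝ) ^ i) q
          (fun n => e (∑ i ∈ Finset.Ico (j + 1 + 1) (k + 1), (a i : ℝ) / q * (n:ℝ) ^ i)) X Y (isPoly_sum (j + 1) α) hM hq
          (hqB.trans (pow_le_pow_right₀ hl (by omega)))
          (fun m n hmn => by
            have := ratper (Finset.Ico (j + 1 + 1) (k + 1)) a q hq m n (Int.natCast_modEq_iff.2 hmn)
            simpa using this)
          (fun n => (norm_e _).le) hXY hYN hX hH
        refine le_trans (le_of_eq ?_) e1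
        congr 1
        apply Finset.sum_congr rfl
        intro n _
        rw [pol_split k (j + 1) α a q (by omega), e_add]
        simp)
      refine hfin.trans ?_
      have : ε0 ≤ ε / 12 := min_le_left _ _
      gcongr
      linarith

theorem poly_top (m : ℕ) (α : ℕ → ℝ) (hirr : Irrational (α (m + 1))) (ε : ℝ) (hε : 0 < ε) :
    ∀ᶠ N : ℕ in atTop, ‖∑ n ∈ Finset.Ioc 0 N, (Λ n : ℂ) * e (pol (m + 1) α n)‖ ≤ ε * N := by
  obtain ⟨B, hB⟩ := descend (m + 1) α ε hε (m + 1) 0 (by omega)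
  set ε0 : ℝ := min (ε / 12) 1 with hε0
  have hε0p : 0 < ε0 := lt_min (by positivity) one_pos
  obtain ⟨T, hT⟩ := major m (B + 3) (ε / 8) ε0 (by positivity) hε0p
  obtain ⟨c, hc, hgap⟩ := irr_gap _ hirr T
  filter_upwards [hB, hT, assemble (m + 1) B (ε / 8) ε0 (by positivity) hε0p (min_le_right _ _), ev_ell_ge 1,
      eventually_gt_atTop 0, ev_ell_pow B ((T + 1) / c)] with N hN hmN hA hl hN0 hNT
  rcases hN with hN | ⟨q, hq, hqB, hnear⟩
  · exact hN
  have hNr : (0:ℝ) < N := by exact_mod_cast hN0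
  have hlp : (0:ℝ) < ell N := by linarith
  obtain ⟨a, ha⟩ := Rt_approx α q 0 (m + 1) hq (fun i => (ell N : ℝ) ^ B / (N:ℝ) ^ i) (fun i => by positivity) hnear
  set r : ℚ := (a (m + 1) : ℚ) / (q : ℤ) with hr
  have hrr : (a (m + 1) : ℝ) / q = r.num / r.den := by
    have : (r : ℝ) = (a (m + 1) : ℝ) / q := by rw [hr]; push_cast; rfl
    rw [← this]
    exact_mod_cast (Rat.num_div_den r).symm
  have hdvd : r.den ∣ q := by
    have h' : (r.den : ℤ) ∣ (q : ℤ) := by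
      rw [hr, ← Rat.divInt_eq_div]
      exact Rat.den_dvd _ _
    exact Int.natCast_dvd_natCast.1 h'
  have hcop : IsCoprime r.num (r.den : ℤ) := by
    rw [Int.isCoprime_iff_gcd_eq_one, Int.gcd, Int.natAbs_natCast]
    exact r.reduced
  have hTq : T ≤ r.den := by
    by_contra hcon
    push Not at hcon
    have h1 := hgap r.den r.den_pos hcon r.num
    have h2 := ha (m + 1) (by omega) le_rfl
    rw [hrr] at h2
    have hd : (0:ℝ) < r.den := by exact_mod_cast r.den_pos
    have h3 : |(r.den : ℝ) * α (m + 1) - r.num| = r.den * |α (m + 1) - r.num / r.den| := by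
      rw [← abs_of_pos hd, ← abs_mul, abs_of_pos hd]
      congr 1
      field_simp
    have h4 : (ell N : ℝ) ^ B / (N:ℝ) ^ (m + 1) ≤ (ell N : ℝ) ^ B / N := by
      gcongr
      exact le_self_pow₀ (by exact_mod_cast hN0) (by omega)
    have h5 : (r.den : ℝ) * |α (m + 1) - r.num / r.den| ≤ T * ((ell N : ℝ) ^ B / N) := by
      have : (r.den : ℝ) ≤ T := by exact_mod_cast hcon.le
      have := h2.trans h4
      gcongr
    have h6 : c ≤ T * ((ell N : ℝ) ^ B / N) := by linarith
    rw [← mul_div_assoc, le_div_iff₀ hNr] at h6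
    rw [div_mul_eq_mul_div, div_le_iff₀ hc] at hNT
    have : 0 < (ell N : ℝ) ^ B := by positivity
    linarith
  have hfin := hA α a 0 q ha (by
    intro X Y hXY hYN hX hH
    have e1 := hmN (r.num / r.den) (fun n => pol (m + 1) (repl α a q 0) n) q r.den r.num X Y
      ((isPoly_sum (m + 1) (repl α a q 0)).congr (by rw [repl, if_neg (by omega), hrr]) (fun n => rfl))
      rfl hcop hdvd hq hTq
      (by
        intro m' n' hmn
        simp only [pol_split (m + 1) 0 α a q (by omega), e_add]
        rw [ratper _ a q hq m' n' hmn]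
        simp)
      (hqB.trans (pow_le_pow_right₀ hl (by omega))) hXY hYN hX hH
    simpa using e1)
  refine hfin.trans ?_
  have : ε0 ≤ ε / 12 := min_le_left _ _
  gcongr
  linarith

end UDP

namespace UDP
open ArithmeticFunction

lemma e_nat_mul (c : ℕ) (x : ℝ) : e (c * x) = e x ^ c := by
  induction c with
  | zero => simp [e_zero]
  | succ c ih => rw [pow_succ, ← ih, ← e_add]; congr 1; push_cast; ring

lemma e_eq_one (x : ℝ) (h : e x = 1) : ∃ z : ℤ, x = z := by
  unfold e at h
  rw [Complex.exp_eq_one_iff] at h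
  obtain ⟨n, hn⟩ := h
  refine ⟨n, ?_⟩
  have h2 : (2 * Real.pi * Complex.I : ℂ) ≠ 0 := Complex.two_pi_I_ne_zero
  rw [mul_comm (n:ℂ)] at hn
  have := mul_left_cancel₀ h2 hn
  exact_mod_cast this

lemma orth (Q n r : ℕ) (hQ : 0 < Q) : ∑ c ∈ Finset.range Q, e (c * (((n:ℝ) - r) / Q)) =
    if n ≡ r [MOD Q] then (Q:ℂ) else 0 := by
  simp only [e_nat_mul]
  have hQr : (Q:ℝ) ≠ 0 := by exact_mod_cast hQ.ne'
  set ζ := e (((n:ℝ) - r) / Q) with hζ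
  have h1 : ζ ^ Q = 1 := by
    rw [hζ, ← e_nat_mul, mul_div_cancel₀ _ hQr]
    have := e_int ((n:ℤ) - r)
    push_cast at this
    exact this
  split_ifs with h
  · obtain ⟨z, hz⟩ := (Nat.modEq_iff_dvd.1 h.symm)
    have : ((n:ℝ) - r) / Q = z := by
      rw [div_eq_iff hQr, mul_comm]
      exact_mod_cast hz
    have hone : ζ = 1 := by rw [hζ, this, e_int]
    rw [hone]
    simp
  · have hne : ζ ≠ 1 := by
      intro h2
      obtain ⟨z, hz⟩ := e_eq_one _ h2
      apply h
      apply Nat.ModEq.symm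
      rw [Nat.modEq_iff_dvd]
      refine ⟨z, ?_⟩
      rw [div_eq_iff hQr, mul_comm] at hz
      exact_mod_cast hz
    rw [geom_sum_eq hne, h1, sub_self, zero_div]

lemma poly_per (m : ℕ) (α : ℕ → ℝ) (hirr : Irrational (α (m + 1))) (Q : ℕ) (hQ : 0 < Q) (ρ : ℕ → ℂ)
    (hρ : ∀ m n, m ≡ n [MOD Q] → ρ m = ρ n) (hρ1 : ∀ n, ‖ρ n‖ ≤ 1) (ε : ℝ) (hε : 0 < ε) :
    ∀ᶠ N : ℕ in atTop, ‖∑ n ∈ Finset.Ioc 0 N, (Λ n : ℂ) * (ρ n * e (pol (m + 1) α n))‖ ≤ ε * N := by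
  have hQr : (0:ℝ) < Q := by exact_mod_cast hQ
  have hQc : (Q:ℂ) ≠ 0 := by exact_mod_cast hQ.ne'
  have hall : ∀ᶠ N : ℕ in atTop, ∀ c ∈ Finset.range Q,
      ‖∑ n ∈ Finset.Ioc 0 N, (Λ n : ℂ) * e (pol (m + 1) (fun i => α i + if i = 1 then (c:ℝ) / Q else 0) n)‖ ≤ ε / Q * N := by
    rw [eventually_all_finset]
    intro c _
    apply poly_top
    · split_ifs
      · have := hirr.add_ratCast ((c:ℚ) / Q)
        push_cast at this
        exact this
      · simpa using hirr
    · positivity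
  filter_upwards [hall] with N hN
  have hpol : ∀ (c n : ℕ), pol (m + 1) (fun i => α i + if i = 1 then (c:ℝ) / Q else 0) n =
      pol (m + 1) α n + c * (n / Q) := by
    intro c n
    unfold pol
    simp only [add_mul, Finset.sum_add_distrib]
    congr 1
    rw [Finset.sum_eq_single 1]
    · simp; ring
    · intro i _ hi; rw [if_neg hi, zero_mul]
    · intro h; simp at h
  have key : ∑ n ∈ Finset.Ioc 0 N, (Λ n : ℂ) * (ρ n * e (pol (m + 1) α n)) =
      ∑ r ∈ Finset.range Q, ∑ c ∈ Finset.range Q, (ρ r / Q * e (-(c * (r / Q)))) *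
        ∑ n ∈ Finset.Ioc 0 N, (Λ n : ℂ) * e (pol (m + 1) (fun i => α i + if i = 1 then (c:ℝ) / Q else 0) n) := by
    simp only [Finset.mul_sum]
    have : ∀ r ∈ Finset.range Q, ∑ c ∈ Finset.range Q, ∑ n ∈ Finset.Ioc 0 N, (ρ r / Q * e (-(c * (r / Q)))) *
        ((Λ n : ℂ) * e (pol (m + 1) (fun i => α i + if i = 1 then (c:ℝ) / Q else 0) n)) =
        ∑ n ∈ (Finset.Ioc 0 N).filter (fun n => n ≡ r [MOD Q]), (Λ n : ℂ) * (ρ n * e (pol (m + 1) α n)) := by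
      intro r _
      rw [Finset.sum_comm, Finset.sum_filter]
      apply Finset.sum_congr rfl
      intro n _
      have h1 : ∀ c ∈ Finset.range Q, (ρ r / Q * e (-(c * (r / Q)))) *
        ((Λ n : ℂ) * e (pol (m + 1) (fun i => α i + if i = 1 then (c:ℝ) / Q else 0) n)) =
        ρ r / Q * Λ n * e (pol (m + 1) α n) * e (c * (((n:ℝ) - r) / Q)) := by
        intro c _
        rw [hpol, e_add]
        have : e ((c:ℝ) * (((n:ℝ) - r) / Q)) = e (c * (n / Q)) * e (-(c * (r / Q))) := by
          rw [← e_add]; congr 1; ring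
        rw [this]
        ring
      rw [Finset.sum_congr rfl h1, ← Finset.mul_sum, orth Q n r hQ]
      split_ifs with h
      · rw [hρ n r h]
        field_simp
      · ring
    rw [Finset.sum_congr rfl this]
    exact sum_residues _ _ Q hQ
  rw [key]
  calc _ ≤ ∑ r ∈ Finset.range Q, ∑ c ∈ Finset.range Q, (1 / Q * (ε / Q * N) : ℝ) := by
        refine (norm_sum_le _ _).trans (Finset.sum_le_sum fun r _ => ?_)
        refine (norm_sum_le _ _).trans (Finset.sum_le_sum fun c hc => ?_)
        rw [norm_mul, norm_mul, norm_e, mul_one, norm_div, Complex.norm_natCast]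
        gcongr
        · exact hρ1 r
        · exact hN c hc
    _ = ε * N := by
        rw [Finset.sum_const, Finset.sum_const, Finset.card_range, nsmul_eq_mul, nsmul_eq_mul]
        field_simp

theorem poly_any (K : ℕ) (α : ℕ → ℝ) (hirr : ∃ i, i + 1 ≤ K ∧ Irrational (α (i + 1))) (ε : ℝ) (hε : 0 < ε) :
    ∀ᶠ N : ℕ in atTop, ‖∑ n ∈ Finset.Ioc 0 N, (Λ n : ℂ) * e (pol K α n)‖ ≤ ε * N := by
  classical
  set m := Nat.findGreatest (fun i => i + 1 ≤ K ∧ Irrational (α (i + 1))) K with hm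
  obtain ⟨i0, hi0⟩ := hirr
  have hmP : m + 1 ≤ K ∧ Irrational (α (m + 1)) :=
    Nat.findGreatest_spec (P := fun i => i + 1 ≤ K ∧ Irrational (α (i + 1))) (by omega : i0 ≤ K) hi0
  have hmax : ∀ i, m + 1 < i → i ≤ K → ¬ Irrational (α i) := by
    intro i h1 h2 h3
    have := Nat.le_findGreatest (P := fun i => i + 1 ≤ K ∧ Irrational (α (i + 1))) (by omega : i - 1 ≤ K)
      (by rw [Nat.sub_add_cancel (by omega)]; exact ⟨h2, h3⟩)
    omega
  have hrat : ∀ i, ∃ r : ℚ, m + 1 < i → i ≤ K → α i = r := by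
    intro i
    by_cases h : m + 1 < i ∧ i ≤ K
    · have := hmax i h.1 h.2
      rw [Irrational, not_not] at this
      obtain ⟨r, hr⟩ := this
      exact ⟨r, fun _ _ => hr.symm⟩
    · exact ⟨0, fun h1 h2 => absurd ⟨h1, h2⟩ h⟩
  choose r hr using hrat
  set Q : ℕ := ∏ i ∈ Finset.Ico (m + 1 + 1) (K + 1), (r i).den with hQ
  have hQ0 : 0 < Q := Finset.prod_pos fun i _ => (r i).den_pos
  have hQr : (Q:ℝ) ≠ 0 := by exact_mod_cast hQ0.ne'
  have hcommon : ∀ i, ∃ a : ℤ, m + 1 < i → i ≤ K → α i = a / Q := by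
    intro i
    by_cases h : m + 1 < i ∧ i ≤ K
    · obtain ⟨t, ht⟩ := Finset.dvd_prod_of_mem (fun i => (r i).den) (Finset.mem_Ico.2 ⟨by omega, by omega⟩ : i ∈ Finset.Ico (m + 1 + 1) (K + 1))
      refine ⟨(r i).num * t, fun _ _ => ?_⟩
      have e1 : (Q:ℝ) = (r i).den * t := by rw [hQ]; exact_mod_cast ht
      have e2 : ((r i : ℚ) : ℝ) = (r i).num / (r i).den := by exact_mod_cast (Rat.num_div_den (r i)).symm
      have e3 : ((r i).den : ℝ) ≠ 0 := by exact_mod_cast (r i).den_pos.ne'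
      have e4 : (t:ℝ) ≠ 0 := by
        intro h0; rw [h0, mul_zero] at e1; exact hQr e1
      rw [hr i h.1 h.2, e2, e1]
      push_cast
      field_simp
    · exact ⟨0, fun h1 h2 => absurd ⟨h1, h2⟩ h⟩
  choose a ha using hcommon
  have hsplit : ∀ n : ℕ, e (pol K α n) = e (∑ i ∈ Finset.Ico (m + 1 + 1) (K + 1), (a i : ℝ) / Q * ((n:ℤ):ℝ) ^ i) * e (pol (m + 1) α n) := by
    intro n
    rw [← e_add]
    congr 1
    unfold pol
    rw [← Finset.sum_range_add_sum_Ico _ (by omega : m + 1 + 1 ≤ K + 1), add_comm]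
    congr 1
    apply Finset.sum_congr rfl
    intro i hi
    rw [Finset.mem_Ico] at hi
    rw [ha i (by omega) (by omega)]
    simp
  have := poly_per m α hmP.2 Q hQ0 (fun n => e (∑ i ∈ Finset.Ico (m + 1 + 1) (K + 1), (a i : ℝ) / Q * ((n:ℤ):ℝ) ^ i))
    (fun x y hxy => ratper _ a Q hQ0 x y (Int.natCast_modEq_iff.2 hxy)) (fun n => (norm_e _).le) ε hε
  filter_upwards [this] with N hN
  simp only [hsplit]
  exact hN

end UDP

namespace UDP
open ArithmeticFunction

lemma ev_log_sqrt (ε : ℝ) (hε : 0 < ε) : ∀ᶠ N : ℕ in atTop, Real.log N ≤ ε * Real.sqrt N := by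
  have h := (isLittleO_log_rpow_atTop (by norm_num : (0:ℝ) < 1/2)).bound hε
  have h2 := tendsto_natCast_atTop_atTop (R := ℝ) |>.eventually h
  filter_upwards [h2, eventually_ge_atTop 1] with N hN h1
  rw [← Real.sqrt_eq_rpow, Real.norm_eq_abs, Real.norm_eq_abs, abs_of_nonneg (Real.sqrt_nonneg _)] at hN
  exact (le_abs_self _).trans hN

/-- log-weighted prime indicator -/
def cp (n : ℕ) : ℝ := if n.Prime then Real.log n else 0

lemma cp_nonneg (n : ℕ) : 0 ≤ cp n := by
  unfold cp; split_ifs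
  · exact Real.log_natCast_nonneg n
  · exact le_rfl

lemma cp_sum (N : ℕ) : ∑ n ∈ Finset.Ioc 0 N, cp n = Chebyshev.theta N := by
  unfold cp Chebyshev.theta
  rw [Finset.sum_filter, Nat.floor_natCast]

lemma cp_sum_le (N : ℕ) : ∑ n ∈ Finset.Ioc 0 N, cp n ≤ 2 * N := by
  rw [cp_sum]
  have h := Chebyshev.theta_le_log4_mul_x (x := (N:ℝ)) (by positivity)
  have h4 : Real.log 4 ≤ 2 := by
    rw [show (4:ℝ) = 2 ^ 2 by norm_num, Real.log_pow]
    have := Real.log_two_lt_d9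
    push_cast; linarith
  exact h.trans (by gcongr)

lemma psi_theta_small (ε : ℝ) (hε : 0 < ε) : ∀ᶠ N : ℕ in atTop,
    Chebyshev.psi N - Chebyshev.theta N ≤ ε * N := by
  filter_upwards [ev_log_sqrt (ε / 2) (by positivity), eventually_ge_atTop 1] with N hN h1
  have h := Chebyshev.psi_sub_theta_le (x := (N:ℝ)) (by exact_mod_cast h1)
  have hs : Real.sqrt N * Real.sqrt N = N := Real.mul_self_sqrt (by positivity)
  calc _ ≤ 2 * Real.sqrt N * Real.log N := h
    _ ≤ 2 * Real.sqrt N * (ε / 2 * Real.sqrt N) := by gcongr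
    _ = ε * (Real.sqrt N * Real.sqrt N) := by ring
    _ = ε * N := by rw [hs]

lemma cp_exp (z : ℕ → ℂ) (hz : ∀ n, ‖z n‖ ≤ 1)
    (h : ∀ ε : ℝ, 0 < ε → ∀ᶠ N : ℕ in atTop, ‖∑ n ∈ Finset.Ioc 0 N, (Λ n : ℂ) * z n‖ ≤ ε * N)
    (ε : ℝ) (hε : 0 < ε) :
    ∀ᶠ N : ℕ in atTop, ‖∑ n ∈ Finset.Ioc 0 N, (cp n : ℂ) * z n‖ ≤ ε * N := by
  filter_upwards [h (ε/2) (by positivity), psi_theta_small (ε/2) (by positivity)] with N h1 h2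
  have key : ∑ n ∈ Finset.Ioc 0 N, (cp n : ℂ) * z n = ∑ n ∈ Finset.Ioc 0 N, (Λ n : ℂ) * z n
      - ∑ n ∈ Finset.Ioc 0 N, ((Λ n - cp n : ℝ) : ℂ) * z n := by
    rw [← Finset.sum_sub_distrib]
    apply Finset.sum_congr rfl
    intro n _
    push_cast; ring
  have h3 : ‖∑ n ∈ Finset.Ioc 0 N, ((Λ n - cp n : ℝ) : ℂ) * z n‖ ≤ ε / 2 * N := by
    refine (norm_sum_le _ _).trans ?_
    refine le_trans ?_ h2
    rw [← cp_sum]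
    unfold Chebyshev.psi
    rw [Nat.floor_natCast, ← Finset.sum_sub_distrib]
    apply Finset.sum_le_sum
    intro n _
    have hpos : 0 ≤ Λ n - cp n := by
      unfold cp; split_ifs with hp
      · rw [vonMangoldt_apply_prime hp]; simp
      · rw [sub_zero]; exact vonMangoldt_nonneg
    rw [norm_mul, Complex.norm_real, Real.norm_of_nonneg hpos]
    exact mul_le_of_le_one_right hpos (hz n)
  rw [key]
  refine (norm_sub_le _ _).trans ?_
  linarith

lemma abel (a w : ℕ → ℂ) (N : ℕ) : ∑ m ∈ Finset.Ioc 0 N, a m * w m =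
    (∑ m ∈ Finset.Ioc 0 N, a m) * w (N + 1) +
      ∑ n ∈ Finset.Ioc 0 N, (∑ m ∈ Finset.Ioc 0 n, a m) * (w n - w (n + 1)) := by
  induction N with
  | zero => simp
  | succ N ih =>
    rw [Finset.sum_Ioc_succ_top (by omega), ih, Finset.sum_Ioc_succ_top (by omega),
      Finset.sum_Ioc_succ_top (by omega : 0 ≤ N) (fun n => (∑ m ∈ Finset.Ioc 0 n, a m) * (w n - w (n + 1))),
      Finset.sum_Ioc_succ_top (by omega)]
    ring

/-- the weight -/
def wt (g : ℕ → ℝ) (n : ℕ) : ℂ := e (g n) * ((1 / Real.log n : ℝ) : ℂ)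

lemma inv_log_diff (n : ℕ) (hn : 2 ≤ n) :
    |1 / Real.log n - 1 / Real.log ((n + 1 : ℕ):ℝ)| ≤ 2 / (n * Real.log n) := by
  have hn' : (2:ℝ) ≤ n := by exact_mod_cast hn
  have hl : 0 < Real.log n := Real.log_pos (by linarith)
  have hl1 : (1/2:ℝ) ≤ Real.log ((n + 1 : ℕ):ℝ) := by
    have h1 : Real.log 2 ≤ Real.log ((n + 1 : ℕ):ℝ) :=
      Real.log_le_log (by norm_num) (by push_cast; linarith)
    have := Real.log_two_gt_d9
    linarith
  have hmono : Real.log n ≤ Real.log ((n + 1 : ℕ):ℝ) :=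
    Real.log_le_log (by linarith) (by push_cast; linarith)
  have hd : Real.log ((n + 1 : ℕ):ℝ) - Real.log n ≤ 1 / n := by
    rw [← Real.log_div (by positivity) (by positivity)]
    have := Real.log_le_sub_one_of_pos (x := ((n + 1 : ℕ):ℝ) / n) (by positivity)
    refine this.trans (le_of_eq ?_)
    push_cast
    field_simp
    ring
  have e1 : 1 / Real.log n - 1 / Real.log ((n + 1 : ℕ):ℝ) =
      (Real.log ((n + 1 : ℕ):ℝ) - Real.log n) / (Real.log n * Real.log ((n + 1 : ℕ):ℝ)) := by
    have : Real.log ((n + 1 : ℕ):ℝ) ≠ 0 := by linarith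
    field_simp
  rw [e1, abs_of_nonneg (div_nonneg (by linarith) (by apply mul_nonneg <;> linarith))]
  calc _ ≤ (1 / n) / (Real.log n * (1/2)) := by gcongr
    _ = 2 / (n * Real.log n) := by field_simp

lemma wt_diff (g : ℕ → ℝ) (C : ℝ) (hg : ∀ n : ℕ, 1 ≤ n → |g n - g (n + 1)| ≤ C / n) (n : ℕ) (hn : 2 ≤ n) :
    ‖wt g n - wt g (n + 1)‖ ≤ (2 * Real.pi * C + 2) / (n * Real.log n) := by
  have hn' : (2:ℝ) ≤ n := by exact_mod_cast hn
  have hl : 0 < Real.log n := Real.log_pos (by linarith)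
  have e1 : wt g n - wt g (n + 1) = (e (g n) - e (g (n + 1))) * ((1 / Real.log n : ℝ) : ℂ)
      + e (g (n + 1)) * ((1 / Real.log n - 1 / Real.log ((n + 1 : ℕ):ℝ) : ℝ) : ℂ) := by
    unfold wt; push_cast; ring
  rw [e1]
  refine (norm_add_le _ _).trans ?_
  rw [norm_mul, norm_mul, norm_e, one_mul, Complex.norm_real, Complex.norm_real, Real.norm_eq_abs, Real.norm_eq_abs,
    abs_of_pos (by positivity : 0 < 1 / Real.log n)]
  have h1 : ‖e (g n) - e (g (n + 1))‖ ≤ 2 * Real.pi * (C / n) :=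
    (norm_e_sub_le _ _).trans (by gcongr; exact hg n (by omega))
  have h2 := inv_log_diff n hn
  calc _ ≤ 2 * Real.pi * (C / n) * (1 / Real.log n) + 2 / (n * Real.log n) := by gcongr
    _ = _ := by field_simp

lemma prime_sum_aux (z : ℕ → ℂ) (hz : ∀ n, ‖z n‖ ≤ 1)
    (h : ∀ ε : ℝ, 0 < ε → ∀ᶠ N : ℕ in atTop, ‖∑ n ∈ Finset.Ioc 0 N, (cp n : ℂ) * z n‖ ≤ ε * N)
    (g : ℕ → ℝ) (C : ℝ) (hC : 0 ≤ C) (hg : ∀ n : ℕ, 1 ≤ n → |g n - g (n + 1)| ≤ C / n)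
    (ε : ℝ) (hε : 0 < ε) :
    ∀ᶠ N : ℕ in atTop, ‖∑ n ∈ Finset.Ioc 0 N, (cp n : ℂ) * z n * wt g n‖ ≤ ε * (N / Real.log N) := by
  set D := 2 * Real.pi * C + 2 with hD
  have hDpos : 0 < D := by positivity
  set A : ℕ → ℂ := fun n => ∑ m ∈ Finset.Ioc 0 n, (cp m : ℂ) * z m with hA
  have hA2 : ∀ n, ‖A n‖ ≤ 2 * n := by
    intro n
    refine (norm_sum_le _ _).trans (le_trans ?_ (cp_sum_le n))
    apply Finset.sum_le_sum
    intro m _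
    rw [norm_mul, Complex.norm_real, Real.norm_of_nonneg (cp_nonneg m)]
    exact mul_le_of_le_one_right (cp_nonneg m) (hz m)
  have hA1 : A 1 = 0 := by simp [hA, cp]
  set δ := ε / (2 * (1 + 2 * D)) with hδ
  have hδpos : 0 < δ := by positivity
  obtain ⟨N0, hN0⟩ := eventually_atTop.1 (h δ hδpos)
  set η := ε / (2 * (4 * D)) with hη
  have hηpos : 0 < η := by positivity
  filter_upwards [eventually_ge_atTop ((N0 + 2) ^ 2), ev_log_sqrt η hηpos] with N hN hlog
  set s := Real.sqrt N with hs
  have hN2 : 4 ≤ N := le_trans (Nat.pow_le_pow_left (by omega : 2 ≤ N0 + 2) 2) hN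
  have hNr : (4:ℝ) ≤ N := by exact_mod_cast hN2
  have hss : s * s = N := Real.mul_self_sqrt (by positivity)
  have hs0 : (N0:ℝ) + 2 ≤ s := by
    apply Real.le_sqrt_of_sq_le
    exact_mod_cast hN
  have hsN : s ≤ N := by rw [← hss]; exact le_mul_of_one_le_left (by positivity) (by linarith [(Nat.cast_nonneg N0 : (0:ℝ) ≤ N0)])
  have hl : 0 < Real.log N := Real.log_pos (by linarith)
  have hls : Real.log N = 2 * Real.log s := by
    rw [← hss, Real.log_mul (by linarith [(Nat.cast_nonneg N0 : (0:ℝ) ≤ N0)]) (by linarith [(Nat.cast_nonneg N0 : (0:ℝ) ≤ N0)])]; ring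
  have hls0 : 0 < Real.log s := by linarith
  rw [abel (fun m => (cp m : ℂ) * z m) (wt g) N]
  have hterm : ∀ n ∈ Finset.Ioc 0 N, ‖A n * (wt g n - wt g (n + 1))‖ ≤
      (if (n:ℝ) ≤ s then 4 * D else 0) + δ * D / Real.log s := by
    intro n hn
    rw [Finset.mem_Ioc] at hn
    have hpos : 0 ≤ δ * D / Real.log s := by positivity
    rcases Nat.lt_or_ge n 2 with h2 | h2
    · have : n = 1 := by omega
      rw [this, hA1]; simp only [zero_mul, norm_zero]
      split_ifs <;> positivity
    · have hn' : (2:ℝ) ≤ n := by exact_mod_cast h2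
      have hln : 0 < Real.log n := Real.log_pos (by linarith)
      have hw := wt_diff g C hg n h2
      rw [← hD] at hw
      rw [norm_mul]
      split_ifs with hns
      · have hln2 : 1 / 2 ≤ Real.log n := by
          have h1 : Real.log 2 ≤ Real.log (n:ℝ) := Real.log_le_log (by norm_num) hn'
          have := Real.log_two_gt_d9
          linarith
        have : ‖A n‖ * ‖wt g n - wt g (n + 1)‖ ≤ 4 * D := by
          calc _ ≤ (2 * n) * (D / (n * Real.log n)) := by gcongr; exact hA2 n
            _ ≤ (2 * n) * (D / (n * (1/2))) := by gcongr
            _ = 4 * D := by field_simp; ring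
        linarith
      · push Not at hns
        have hnN0 : N0 ≤ n := by
          have : (N0:ℝ) ≤ n := by linarith
          exact_mod_cast this
        have hll : Real.log s ≤ Real.log n := Real.log_le_log (by linarith [(Nat.cast_nonneg N0 : (0:ℝ) ≤ N0)]) hns.le
        rw [zero_add]
        calc _ ≤ (δ * n) * (D / (n * Real.log n)) := by gcongr; exact hN0 n hnN0
          _ ≤ (δ * n) * (D / (n * Real.log s)) := by gcongr
          _ = δ * D / Real.log s := by field_simp
  have hsum : ‖∑ n ∈ Finset.Ioc 0 N, A n * (wt g n - wt g (n + 1))‖ ≤ s * (4 * D) + N * (δ * D / Real.log s) := by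
    refine (norm_sum_le_of_le _ hterm).trans ?_
    rw [Finset.sum_add_distrib, Finset.sum_const, Nat.card_Ioc, nsmul_eq_mul, Nat.sub_zero,
      ← Finset.sum_filter, Finset.sum_const, nsmul_eq_mul]
    gcongr
    have hsub : (Finset.Ioc 0 N).filter (fun n : ℕ => (n:ℝ) ≤ s) ⊆ Finset.Ioc 0 ⌊s⌋₊ := by
      intro n hn
      rw [Finset.mem_filter, Finset.mem_Ioc] at hn
      rw [Finset.mem_Ioc]
      exact ⟨hn.1.1, Nat.le_floor hn.2⟩
    have hc := Finset.card_le_card hsub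
    rw [Nat.card_Ioc, Nat.sub_zero] at hc
    calc _ ≤ ((⌊s⌋₊ : ℕ) : ℝ) := by exact_mod_cast hc
      _ ≤ s := Nat.floor_le (Real.sqrt_nonneg _)
  have hfirst : ‖A N * wt g (N + 1)‖ ≤ δ * N * (1 / Real.log N) := by
    rw [norm_mul]
    have hNN0 : N0 ≤ N := by
      have : (N0:ℝ) ≤ N := by linarith
      exact_mod_cast this
    have hw : ‖wt g (N + 1)‖ ≤ 1 / Real.log N := by
      unfold wt
      have : Real.log N ≤ Real.log ((N + 1 : ℕ) : ℝ) := Real.log_le_log (by linarith) (by push_cast; linarith)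
      rw [norm_mul, norm_e, one_mul, Complex.norm_real, Real.norm_eq_abs, abs_of_nonneg (by apply one_div_nonneg.2; linarith)]
      gcongr
    gcongr
    exact hN0 N hNN0
  refine (norm_add_le _ _).trans ((add_le_add hfirst hsum).trans ?_)
  have hsq : s * (4 * D) ≤ ε / 2 * (N / Real.log N) := by
    rw [← mul_div_assoc, le_div_iff₀ hl]
    calc s * (4 * D) * Real.log N ≤ s * (4 * D) * (η * s) := by gcongr
      _ = (s * s) * (4 * D * η) := by ring
      _ = ε / 2 * N := by rw [hss, hη]; field_simp
  have hlast : δ * N * (1 / Real.log N) + N * (δ * D / Real.log s) = ε / 2 * (N / Real.log N) := by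
    rw [hls, hδ]; field_simp
  linarith

lemma pi_lower : ∀ᶠ N : ℕ in atTop, (N:ℝ) / Real.log N ≤ 4 * (Nat.primeCounting N : ℝ) := by
  filter_upwards [ev_log_sqrt (1/8) (by norm_num), eventually_ge_atTop 16] with N hN h16
  have hNr : (16:ℝ) ≤ N := by exact_mod_cast h16
  have hl : 0 < Real.log N := Real.log_pos (by linarith)
  have h := Chebyshev.pi_ge N
  have hs : Real.sqrt N ≤ N := by
    rw [Real.sqrt_le_left (by positivity)]; nlinarith
  have h1 : Real.log (N + 1) ≤ 2 * Real.log N := by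
    rw [← Real.log_rpow (by linarith)]
    apply Real.log_le_log (by linarith)
    norm_num; nlinarith
  have h2 := Real.log_two_gt_d9
  have : (N:ℝ) / 4 / Real.log N ≤ Nat.primeCounting N := by
    refine le_trans ?_ h
    gcongr
    have : (N:ℝ) * (1/2) ≤ N * Real.log 2 := by gcongr; linarith
    linarith
  have e1 : (N:ℝ) / Real.log N = 4 * (N / 4 / Real.log N) := by ring
  rw [e1]; gcongr

lemma sum_nth_prime (G : ℕ → ℂ) (M : ℕ) : ∑ n ∈ Finset.range M, G (nthPrime n) =
    ∑ p ∈ Finset.Ioc 0 (nthPrime M - 1), if p.Prime then G p else 0 := by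
  have h0 : ∑ n ∈ Finset.range M, G (nthPrime n) = ∑ p ∈ (Finset.range (nthPrime M)).filter Nat.Prime, G p := by
    induction M with
    | zero =>
      simp only [Finset.range_zero, Finset.sum_empty, nthPrime, Nat.nth_prime_zero_eq_two]
      symm; apply Finset.sum_eq_zero
      intro p hp
      rw [Finset.mem_filter, Finset.mem_range] at hp
      have := hp.2.two_le; omega
    | succ M ih =>
      rw [Finset.sum_range_succ, ih]
      unfold nthPrime
      rw [Nat.filter_range_nth_eq_insert_of_infinite Nat.infinite_setOfPred_prime, Finset.sum_insert (by simp), add_comm]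
  rw [h0, ← Finset.sum_filter]
  apply Finset.sum_congr _ (fun _ _ => rfl)
  ext p
  have hM : 2 ≤ nthPrime M := (Nat.prime_nth_prime M).two_le
  simp only [Finset.mem_filter, Finset.mem_range, Finset.mem_Ioc]
  constructor
  · rintro ⟨h1, h2⟩; exact ⟨⟨h2.pos, by omega⟩, h2⟩
  · rintro ⟨h1, h2⟩; exact ⟨by omega, h2⟩

lemma prime_index (z : ℕ → ℂ) (hz : ∀ n, ‖z n‖ ≤ 1)
    (h : ∀ ε : ℝ, 0 < ε → ∀ᶠ N : ℕ in atTop, ‖∑ n ∈ Finset.Ioc 0 N, (Λ n : ℂ) * z n‖ ≤ ε * N)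
    (g : ℕ → ℝ) (C : ℝ) (hC : 0 ≤ C) (hg : ∀ n : ℕ, 1 ≤ n → |g n - g (n + 1)| ≤ C / n)
    (ε : ℝ) (hε : 0 < ε) :
    ∀ᶠ M : ℕ in atTop, ‖∑ n ∈ Finset.range M, z (nthPrime n) * e (g (nthPrime n))‖ ≤ ε * M := by
  have h1 := (prime_sum_aux z hz (cp_exp z hz h) g C hC hg (ε / 4) (by positivity)).and pi_lower
  have ht : Tendsto (fun M : ℕ => nthPrime M - 1) atTop atTop := by
    apply tendsto_atTop_mono (f := fun M => M) _ tendsto_id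
    intro M
    have := Nat.add_two_le_nth_prime M
    unfold nthPrime; omega
  filter_upwards [ht.eventually h1] with M hM
  rw [sum_nth_prime (fun p => z p * e (g p))]
  have hc : Nat.primeCounting (nthPrime M - 1) = M := by
    have hM : 2 ≤ nthPrime M := (Nat.prime_nth_prime M).two_le
    unfold Nat.primeCounting Nat.primeCounting'
    rw [Nat.sub_add_cancel (by omega)]
    exact Nat.count_nth_of_infinite Nat.infinite_setOfPred_prime M
  have e1 : ∀ p : ℕ, (if p.Prime then z p * e (g p) else 0) = (cp p : ℂ) * z p * wt g p := by
    intro p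
    unfold cp wt
    split_ifs with hp
    · have : (Real.log p : ℂ) ≠ 0 := by
        have : 0 < Real.log p := Real.log_pos (by exact_mod_cast hp.one_lt)
        exact_mod_cast this.ne'
      push_cast at this ⊢
      field_simp
    · simp
  simp only [e1]
  rw [hc] at hM
  refine hM.1.trans ?_
  calc _ ≤ ε / 4 * (4 * M) := by gcongr; exact hM.2
    _ = ε * M := by ring

lemma f1_diff (f₁ : ℝ → ℝ) (hf₁ : ContDiff ℝ 1 f₁) (C : ℝ) (hC : 0 < C)
    (hbound : ∀ x : ℝ, |x * deriv f₁ x| ≤ C) (n : ℕ) (hn : 1 ≤ n) :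
    |f₁ n - f₁ ((n + 1 : ℕ) : ℝ)| ≤ C / n := by
  have hn' : (1:ℝ) ≤ n := by exact_mod_cast hn
  have hd : Differentiable ℝ f₁ := hf₁.differentiable (by norm_num)
  have := Convex.norm_image_sub_le_of_norm_deriv_le (f := f₁) (s := Set.Icc (n:ℝ) ((n + 1 : ℕ) : ℝ)) (C := C / n)
    (x := ((n + 1 : ℕ) : ℝ)) (y := n)
    (fun x _ => hd x) (fun x hx => by
      have hxn : (n:ℝ) ≤ x := hx.1
      have hb := hbound x
      rw [abs_mul, abs_of_pos (by linarith : 0 < x)] at hb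
      rw [Real.norm_eq_abs, le_div_iff₀ (by linarith)]
      calc |deriv f₁ x| * n ≤ |deriv f₁ x| * x := by gcongr
        _ = x * |deriv f₁ x| := mul_comm _ _
        _ ≤ C := hb) (convex_Icc _ _) (by simp) (by simp)
  rw [Real.norm_eq_abs] at this
  refine this.trans (le_of_eq ?_)
  simp

theorem primes_weyl (f₁ : ℝ → ℝ) (hf₁ : ContDiff ℝ 1 f₁)
    (C : ℝ) (hC : 0 < C) (hbound : ∀ x : ℝ, |x * deriv f₁ x| ≤ C)
    (k : ℕ) (α : Fin k → ℝ) (hirr : ∃ i, Irrational (α i)) (h : ℤ) (hh : h ≠ 0) (ε : ℝ) (hε : 0 < ε) :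
    ∀ᶠ M : ℕ in atTop, ‖∑ n ∈ Finset.range M, e (h * (f₁ (nthPrime n) +
      ∑ i : Fin k, α i * ((nthPrime n : ℕ) : ℝ) ^ ((i : ℕ) + 1)))‖ ≤ ε * M := by
  set β : ℕ → ℝ := fun j => if hj : 1 ≤ j ∧ j - 1 < k then h * α ⟨j - 1, hj.2⟩ else 0 with hβ
  have hpol : ∀ n : ℕ, pol k β n = h * ∑ i : Fin k, α i * (n : ℝ) ^ ((i : ℕ) + 1) := by
    intro n
    unfold pol
    rw [Finset.sum_range_succ', Finset.mul_sum, Finset.sum_range]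
    have : β 0 = 0 := by simp [hβ]
    rw [this, zero_mul, add_zero]
    apply Finset.sum_congr rfl
    intro i _
    simp [hβ]; ring
  have hp := poly_any k β (by
    obtain ⟨i, hi⟩ := hirr
    refine ⟨i, i.2, ?_⟩
    simp only [hβ]
    rw [dif_pos ⟨by omega, by simp⟩]
    simpa using hi.intCast_mul hh)
  have := prime_index (fun n => e (pol k β n)) (fun n => (norm_e _).le) hp (fun n => h * f₁ n) (|(h:ℝ)| * C)
    (by positivity) (fun n hn => by
      rw [← mul_sub, abs_mul, mul_div_assoc]
      gcongr
      exact f1_diff f₁ hf₁ C hC hbound n hn) ε hε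
  filter_upwards [this] with M hM
  convert hM using 2
  apply Finset.sum_congr rfl
  intro n _
  rw [hpol, ← e_add]
  congr 1
  ring

end UDP

namespace UDP

/-- Averages along `a` of the circle function `F` converge to its mean. -/
def AvgConv (a : ℕ → ℝ) (F : C(AddCircle (1:ℝ), ℂ)) : Prop :=
  ∀ ε : ℝ, 0 < ε → ∀ᶠ N : ℕ in atTop,
    ‖∑ n ∈ Finset.range N, F (a n : AddCircle (1:ℝ)) - N * ∫ x : AddCircle (1:ℝ), F x‖ ≤ ε * N

lemma cont_integrable (F : C(AddCircle (1:ℝ), ℂ)) : Integrable (fun x => F x) (volume : Measure (AddCircle (1:ℝ))) :=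
  F.continuous.integrable_of_hasCompactSupport (HasCompactSupport.of_compactSpace _)

lemma avg_fourier (a : ℕ → ℝ)
    (hw : ∀ h : ℤ, h ≠ 0 → ∀ ε : ℝ, 0 < ε → ∀ᶠ N : ℕ in atTop, ‖∑ n ∈ Finset.range N, e (h * a n)‖ ≤ ε * N)
    (h : ℤ) : AvgConv a (fourier h) := by
  intro ε hε
  by_cases hh : h = 0
  · subst hh
    filter_upwards with N
    simp [measureReal_def]
    positivity
  · have h0 : ∫ x : AddCircle (1:ℝ), fourier h x = 0 :=
      integral_eq_zero_of_add_right_eq_neg (fourier_add_half_inv_index hh one_pos)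
    filter_upwards [hw h hh ε hε] with N hN
    rw [h0, mul_zero, sub_zero]
    convert hN using 2
    apply Finset.sum_congr rfl
    intro n _
    rw [fourier_coe_apply]
    unfold e
    congr 1
    push_cast
    ring

lemma avg_add (a : ℕ → ℝ) (F G : C(AddCircle (1:ℝ), ℂ)) (hF : AvgConv a F) (hG : AvgConv a G) :
    AvgConv a (F + G) := by
  intro ε hε
  filter_upwards [hF (ε/2) (by positivity), hG (ε/2) (by positivity)] with N h1 h2
  have e1 : ∫ x : AddCircle (1:ℝ), (F + G) x = (∫ x : AddCircle (1:ℝ), F x) + ∫ x : AddCircle (1:ℝ), G x :=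
    integral_add (cont_integrable F) (cont_integrable G)
  rw [e1]
  simp only [ContinuousMap.add_apply, Finset.sum_add_distrib]
  rw [mul_add, add_sub_add_comm]
  refine (norm_add_le _ _).trans ?_
  linarith

lemma avg_smul (a : ℕ → ℝ) (c : ℂ) (F : C(AddCircle (1:ℝ), ℂ)) (hF : AvgConv a F) :
    AvgConv a (c • F) := by
  intro ε hε
  filter_upwards [hF (ε/(‖c‖ + 1)) (by positivity)] with N h1
  have e1 : ∫ x : AddCircle (1:ℝ), (c • F) x = c * (∫ x : AddCircle (1:ℝ), F x) :=
    integral_const_mul c _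
  rw [e1]
  simp only [ContinuousMap.smul_apply, smul_eq_mul, ← Finset.mul_sum]
  rw [mul_left_comm, ← mul_sub, norm_mul]
  calc _ ≤ (‖c‖ + 1) * (ε/(‖c‖ + 1) * N) := by gcongr; linarith
    _ = ε * N := by field_simp

lemma avg_all (a : ℕ → ℝ)
    (hw : ∀ h : ℤ, h ≠ 0 → ∀ ε : ℝ, 0 < ε → ∀ᶠ N : ℕ in atTop, ‖∑ n ∈ Finset.range N, e (h * a n)‖ ≤ ε * N)
    (F : C(AddCircle (1:ℝ), ℂ)) : AvgConv a F := by
  have hspan : ∀ P ∈ Submodule.span ℂ (Set.range (fourier (T := (1:ℝ)))), AvgConv a P := by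
    intro P hP
    induction hP using Submodule.span_induction with
    | mem x hx => obtain ⟨n, rfl⟩ := hx; exact avg_fourier a hw n
    | zero =>
      intro ε hε
      filter_upwards with N
      simp; positivity
    | add x y _ _ hx hy => exact avg_add a x y hx hy
    | smul c x _ hx => exact avg_smul a c x hx
  intro ε hε
  have hF : F ∈ (Submodule.span ℂ (Set.range (fourier (T := (1:ℝ))))).topologicalClosure := by
    rw [span_fourier_closure_eq_top]; trivial
  rw [← SetLike.mem_coe, Submodule.topologicalClosure_coe, Metric.mem_closure_iff] at hF
  obtain ⟨P, hP, hd⟩ := hF (ε/3) (by positivity)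
  have hpt : ∀ x, ‖F x - P x‖ ≤ ε / 3 := by
    intro x
    rw [← dist_eq_norm]
    exact (ContinuousMap.dist_apply_le_dist x).trans hd.le
  have hIPF : ‖(∫ x : AddCircle (1:ℝ), P x) - ∫ x : AddCircle (1:ℝ), F x‖ ≤ ε / 3 := by
    rw [← integral_sub (cont_integrable P) (cont_integrable F)]
    refine (norm_integral_le_of_norm_le_const (C := ε / 3) (Eventually.of_forall fun x => ?_)).trans ?_
    · rw [norm_sub_rev]; exact hpt x
    · simp [measureReal_def]
  filter_upwards [hspan P hP (ε/3) (by positivity)] with N hN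
  have e1 : ∑ n ∈ Finset.range N, F (a n : AddCircle (1:ℝ)) - N * ∫ x : AddCircle (1:ℝ), F x =
      ∑ n ∈ Finset.range N, (F (a n : AddCircle (1:ℝ)) - P (a n : AddCircle (1:ℝ))) +
      (∑ n ∈ Finset.range N, P (a n : AddCircle (1:ℝ)) - N * ∫ x : AddCircle (1:ℝ), P x) +
      N * ((∫ x : AddCircle (1:ℝ), P x) - ∫ x : AddCircle (1:ℝ), F x) := by
    rw [Finset.sum_sub_distrib]; ring
  have h1 : ‖∑ n ∈ Finset.range N, (F (a n : AddCircle (1:ℝ)) - P (a n : AddCircle (1:ℝ)))‖ ≤ N * (ε / 3) := by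
    refine (norm_sum_le_of_le _ (fun n _ => hpt _)).trans ?_
    simp
  have h2 : ‖(N:ℂ) * ((∫ x : AddCircle (1:ℝ), P x) - ∫ x : AddCircle (1:ℝ), F x)‖ ≤ N * (ε / 3) := by
    rw [norm_mul, Complex.norm_natCast]; gcongr
  rw [e1]
  refine (norm_add₃_le).trans ?_
  linarith

/-- trapezoid bump on the circle -/
def bump (c : AddCircle (1:ℝ)) (r δ : ℝ) (x : AddCircle (1:ℝ)) : ℝ :=
  max 0 (1 - max 0 (‖x - c‖ - r) / δ)

lemma bump_cont (c : AddCircle (1:ℝ)) (r δ : ℝ) : Continuous (bump c r δ) := by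
  unfold bump; fun_prop

lemma bump_nonneg (c : AddCircle (1:ℝ)) (r δ : ℝ) (x) : 0 ≤ bump c r δ x := le_max_left _ _

lemma bump_one (c : AddCircle (1:ℝ)) (r δ : ℝ) (x) (hx : ‖x - c‖ ≤ r) : bump c r δ x = 1 := by
  unfold bump
  rw [max_eq_left (by linarith : ‖x - c‖ - r ≤ 0)]; simp

lemma bump_int (c : AddCircle (1:ℝ)) (r δ : ℝ) (hr : 0 ≤ r) (hδ : 0 < δ) :
    ∫ x : AddCircle (1:ℝ), bump c r δ x ≤ 2 * (r + δ) := by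
  have hle : ∀ x, bump c r δ x ≤ (Metric.closedBall c (r + δ)).indicator (fun _ => (1:ℝ)) x := by
    intro x
    by_cases hx : x ∈ Metric.closedBall c (r + δ)
    · rw [Set.indicator_of_mem hx]
      unfold bump
      apply max_le zero_le_one
      have : 0 ≤ max 0 (‖x - c‖ - r) / δ := by positivity
      linarith
    · rw [Set.indicator_of_notMem hx]
      rw [Metric.mem_closedBall, dist_eq_norm, not_le] at hx
      unfold bump
      apply max_le le_rfl
      have : 1 ≤ max 0 (‖x - c‖ - r) / δ := by
        rw [le_div_iff₀ hδ, one_mul]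
        exact le_max_of_le_right (by linarith)
      linarith
  have hi : Integrable (bump c r δ) (volume : Measure (AddCircle (1:ℝ))) :=
    (bump_cont c r δ).integrable_of_hasCompactSupport (HasCompactSupport.of_compactSpace _)
  have hm : MeasurableSet (Metric.closedBall c (r + δ)) := Metric.isClosed_closedBall.measurableSet
  have hi2 : Integrable ((Metric.closedBall c (r + δ)).indicator (fun _ => (1:ℝ))) (volume : Measure (AddCircle (1:ℝ))) :=
    (integrable_const _).indicator hm
  refine (integral_mono hi hi2 hle).trans ?_
  rw [integral_indicator_const _ hm, measureReal_def, AddCircle.volume_closedBall,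
    ENNReal.toReal_ofReal (by positivity)]
  simp

open scoped Classical in
/-- counting function -/
def cntIcc (a : ℕ → ℝ) (α β : ℝ) (N : ℕ) : ℝ :=
  (((Finset.range N).filter fun n => Int.fract (a n) ∈ Set.Icc α β).card : ℝ)

lemma upper (a : ℕ → ℝ)
    (hw : ∀ h : ℤ, h ≠ 0 → ∀ ε : ℝ, 0 < ε → ∀ᶠ N : ℕ in atTop, ‖∑ n ∈ Finset.range N, e (h * a n)‖ ≤ ε * N)
    (α β : ℝ) (hαβ : α ≤ β) (ε : ℝ) (hε : 0 < ε) :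
    ∀ᶠ N : ℕ in atTop, cntIcc a α β N ≤ (β - α + ε) * N := by
  classical
  set c : AddCircle (1:ℝ) := (((α + β) / 2 : ℝ) : AddCircle (1:ℝ)) with hc
  set r := (β - α) / 2 with hr
  have hr0 : 0 ≤ r := by linarith
  set δ := ε / 4 with hδ
  have hδ0 : 0 < δ := by positivity
  let F : C(AddCircle (1:ℝ), ℂ) := ⟨fun x => (bump c r δ x : ℂ), Complex.continuous_ofReal.comp (bump_cont c r δ)⟩
  filter_upwards [avg_all a hw F (ε/2) (by positivity)] with N hN
  have e1 : ∑ n ∈ Finset.range N, F (a n : AddCircle (1:ℝ)) - N * ∫ x : AddCircle (1:ℝ), F x =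
      ((∑ n ∈ Finset.range N, bump c r δ (a n : AddCircle (1:ℝ)) - N * ∫ x : AddCircle (1:ℝ), bump c r δ x : ℝ) : ℂ) := by
    push_cast
    rw [← integral_complex_ofReal]
    rfl
  rw [e1, Complex.norm_real, Real.norm_eq_abs] at hN
  have h1 := (le_abs_self _).trans hN
  have h2 : (N:ℝ) * ∫ x : AddCircle (1:ℝ), bump c r δ x ≤ N * (2 * (r + δ)) := by
    gcongr; exact bump_int c r δ hr0 hδ0
  have h3 : cntIcc a α β N ≤ ∑ n ∈ Finset.range N, bump c r δ (a n : AddCircle (1:ℝ)) := by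
    unfold cntIcc
    rw [Finset.card_filter]
    push_cast
    apply Finset.sum_le_sum
    intro n _
    split_ifs with hn
    · rw [bump_one]
      have hfr : (a n : AddCircle (1:ℝ)) = (Int.fract (a n) : ℝ) := (AddCircle.coe_fract _).symm
      rw [hfr, hc, ← AddCircle.coe_sub, UnitAddCircle.norm_eq]
      have := round_le (Int.fract (a n) - (α + β) / 2) 0
      refine this.trans ?_
      rw [Int.cast_zero, sub_zero, abs_le]
      rw [Set.mem_Icc] at hn
      constructor <;> linarith [hn.1, hn.2]
    · exact bump_nonneg _ _ _ _
  have h4 : (N:ℝ) * (2 * (r + δ)) + ε / 2 * N = (β - α + ε) * N := by rw [hr, hδ]; ring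
  linarith

lemma cntIcc_cover (a : ℕ → ℝ) (α β : ℝ) (N : ℕ) : (N:ℝ) ≤ cntIcc a 0 α N + cntIcc a α β N + cntIcc a β 1 N := by
  classical
  unfold cntIcc
  rw [← Nat.cast_add, ← Nat.cast_add, Nat.cast_le]
  conv_lhs => rw [← Finset.card_range N]
  refine (Finset.card_le_card ?_).trans ((Finset.card_union_le _ _).trans
    (Nat.add_le_add_right (Finset.card_union_le _ _) _))
  intro n hn
  have h0 := Int.fract_nonneg (a n)
  have h1 := (Int.fract_lt_one (a n)).le
  simp only [Finset.mem_union, Finset.mem_filter, Set.mem_Icc]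
  rcases le_total (Int.fract (a n)) α with h | h
  · exact Or.inl (Or.inl ⟨hn, h0, h⟩)
  · rcases le_total (Int.fract (a n)) β with h' | h'
    · exact Or.inl (Or.inr ⟨hn, h, h'⟩)
    · exact Or.inr ⟨hn, h', h1⟩

theorem weyl_crit (a : ℕ → ℝ)
    (hw : ∀ h : ℤ, h ≠ 0 → ∀ ε : ℝ, 0 < ε → ∀ᶠ N : ℕ in atTop, ‖∑ n ∈ Finset.range N, e (h * a n)‖ ≤ ε * N) :
    UDMod1 a := by
  intro α β hα hαβ hβ
  change Tendsto (fun N : ℕ => cntIcc a α β N / N) atTop (𝓝 (β - α))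
  rw [Metric.tendsto_atTop']
  intro ε hε
  have h := (upper a hw 0 α hα (ε/4) (by positivity)).and
    ((upper a hw α β hαβ (ε/4) (by positivity)).and ((upper a hw β 1 hβ (ε/4) (by positivity)).and (eventually_gt_atTop 0)))
  obtain ⟨N0, hN0⟩ := eventually_atTop.1 h
  refine ⟨N0, fun N hN => ?_⟩
  obtain ⟨h1, h2, h3, h4⟩ := hN0 N hN.le
  have hc := cntIcc_cover a α β N
  have hNpos : (0:ℝ) < N := by exact_mod_cast h4
  rw [Real.dist_eq, abs_lt]
  have hεN : 0 < ε * N := by positivity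
  constructor
  · rw [lt_sub_iff_add_lt, lt_div_iff₀ hNpos]
    linarith
  · rw [sub_lt_iff_lt_add, div_lt_iff₀ hNpos]
    linarith

end UDP

theorem uniform_distribution_primes_C1_plus_polynomial
    (f₁ : ℝ → ℝ) (hf₁ : ContDiff ℝ 1 f₁)
    (C : ℝ) (hC : 0 < C) (hbound : ∀ x : ℝ, |x * deriv f₁ x| ≤ C)
    (k : ℕ) (α : Fin k → ℝ) (hirr : ∃ i, Irrational (α i)) :
    UDMod1 (fun n : ℕ =>
      f₁ (nthPrime n) + ∑ i : Fin k, α i * ((nthPrime n : ℕ) : ℝ) ^ ((i : ℕ) + 1)) :=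
  UDP.weyl_crit _ fun h hh ε hε => UDP.primes_weyl f₁ hf₁ C hC hbound k α hirr h hh ε hε

end
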